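/- For every α ∈ (0, 2) and every κ > 0 there exists η > α/2 such that: for every Borel set A ⊆ ℝ × ℝ with dimH A > α, the exceptional set E = {θ ∈ ℝ : dimH (proj_θ '' A) < η} of angles, where proj_θ(x, y) = x·cos θ + y·sin θ, satisfies dimH E ≤ κ. (Bourgain's projection theorem.) -/

import Mathlib

open MeasureTheory
open scoped ENNReal

namespace BP

/-- `u`-separated finite sets. -/
def Sep (u : ℝ) (S : Finset ℝ) : Prop := ∀ x ∈ S, ∀ y ∈ S, x ≠ y → u ≤ |x - y|

/-- `S` is covered by at most `K` translates of `G`. -/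
def Cov (G : Set ℝ) (K : ℝ) (S : Set ℝ) : Prop :=
  ∃ F : Finset ℝ, (F.card : ℝ) ≤ K ∧ ∀ s ∈ S, ∃ f ∈ F, s - f ∈ G

/-- dilation by `c` maps `G` to at most `K` translates of `G`. -/
def Good (G : Set ℝ) (K : ℝ) (c : ℝ) : Prop :=
  ∃ F : Finset ℝ, (F.card : ℝ) ≤ K ∧ ∀ g ∈ G, ∃ f ∈ F, c * g - f ∈ G

lemma Good.mono {G : Set ℝ} {K K' c : ℝ} (h : Good G K c) (hK : K ≤ K') : Good G K' c := by
  obtain ⟨F, h1, h2⟩ := h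
  exact ⟨F, h1.trans hK, h2⟩

lemma Good.one (G : Set ℝ) : Good G 1 1 := ⟨{0}, by simp, fun g hg => ⟨0, by simp, by simpa using hg⟩⟩

lemma Good.neg {G : Set ℝ} (hG : ∀ g ∈ G, -g ∈ G) {K c : ℝ} (h : Good G K c) : Good G K (-c) := by
  classical
  obtain ⟨F, h1, h2⟩ := h
  refine ⟨F.image (fun x => -x), le_trans (by exact_mod_cast Finset.card_image_le) h1, ?_⟩
  intro g hg
  obtain ⟨f, hf, hh⟩ := h2 g hg
  refine ⟨-f, Finset.mem_image_of_mem _ hf, ?_⟩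
  have := hG _ hh
  convert this using 1
  ring

lemma card_image2_le' (f : ℝ → ℝ → ℝ) (A B : Finset ℝ) {K K' : ℝ} (hA : (A.card : ℝ) ≤ K)
    (hB : (B.card : ℝ) ≤ K') : ((Finset.image₂ f A B).card : ℝ) ≤ K * K' := by
  have h1 : ((Finset.image₂ f A B).card : ℝ) ≤ A.card * B.card := by
    exact_mod_cast Finset.card_image₂_le f A B
  have h2 : (0:ℝ) ≤ A.card := by positivity
  have h3 : (0:ℝ) ≤ B.card := by positivity
  nlinarith

lemma Good.mul {G : Set ℝ} {K K' c c' : ℝ} (h : Good G K c) (h' : Good G K' c') :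
    Good G (K * K') (c * c') := by
  classical
  obtain ⟨F, h1, h2⟩ := h
  obtain ⟨F', h1', h2'⟩ := h'
  refine ⟨Finset.image₂ (fun f f' => c * f' + f) F F', card_image2_le' _ _ _ h1 h1', ?_⟩
  intro g hg
  obtain ⟨f', hf', hh'⟩ := h2' g hg
  obtain ⟨f, hf, hh⟩ := h2 _ hh'
  refine ⟨c * f' + f, Finset.mem_image₂_of_mem hf hf', ?_⟩
  convert hh using 1
  ring

lemma Good.pow {G : Set ℝ} {K c : ℝ} (h : Good G K c) (j : ℕ) : Good G (K ^ j) (c ^ j) := by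
  induction j with
  | zero => simpa using Good.one G
  | succ j ih => rw [pow_succ, pow_succ]; exact ih.mul h

lemma Cov.add {G : Set ℝ} {K0 K K' : ℝ} (h0 : ∃ F0 : Finset ℝ, (F0.card : ℝ) ≤ K0 ∧
    ∀ g ∈ G, ∀ g' ∈ G, ∃ f ∈ F0, g + g' - f ∈ G) {S S' : Set ℝ} (h : Cov G K S)
    (h' : Cov G K' S') : Cov G (K0 * K * K') {x | ∃ s ∈ S, ∃ s' ∈ S', x = s + s'} := by
  classical
  obtain ⟨F, h1, h2⟩ := h
  obtain ⟨F', h1', h2'⟩ := h'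
  obtain ⟨F0, h3, h4⟩ := h0
  refine ⟨Finset.image₂ (fun f f' => f + f') (Finset.image₂ (fun f f' => f + f') F0 F) F',
    card_image2_le' _ _ _ (card_image2_le' _ _ _ h3 h1) h1', ?_⟩
  rintro x ⟨s, hs, s', hs', rfl⟩
  obtain ⟨f, hf, hh⟩ := h2 s hs
  obtain ⟨f', hf', hh'⟩ := h2' s' hs'
  obtain ⟨f0, hf0, hh0⟩ := h4 _ hh _ hh'
  refine ⟨f0 + f + f', Finset.mem_image₂_of_mem (Finset.mem_image₂_of_mem hf0 hf) hf', ?_⟩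
  convert hh0 using 1
  ring

lemma Cov.mono {G : Set ℝ} {K K' : ℝ} {S S' : Set ℝ} (h : Cov G K S) (hK : K ≤ K')
    (hS : S' ⊆ S) : Cov G K' S' := by
  obtain ⟨F, h1, h2⟩ := h
  exact ⟨F, h1.trans hK, fun s hs => h2 s (hS hs)⟩

lemma good_iff_cov {G : Set ℝ} {K c : ℝ} : Good G K c ↔ Cov G K {x | ∃ g ∈ G, x = c * g} := by
  constructor
  · rintro ⟨F, h1, h2⟩
    refine ⟨F, h1, ?_⟩
    rintro s ⟨g, hg, rfl⟩
    exact h2 g hg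
  · rintro ⟨F, h1, h2⟩
    exact ⟨F, h1, fun g hg => h2 _ ⟨g, hg, rfl⟩⟩

lemma Good.add {G : Set ℝ} {K0 K K' c c' : ℝ} (h0 : ∃ F0 : Finset ℝ, (F0.card : ℝ) ≤ K0 ∧
    ∀ g ∈ G, ∀ g' ∈ G, ∃ f ∈ F0, g + g' - f ∈ G) (h : Good G K c)
    (h' : Good G K' c') : Good G (K0 * K * K') (c + c') := by
  rw [good_iff_cov] at *
  refine (Cov.add h0 h h').mono le_rfl ?_
  rintro x ⟨g, hg, rfl⟩
  exact ⟨c * g, ⟨g, hg, rfl⟩, c' * g, ⟨g, hg, rfl⟩, by ring⟩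

/-- hypotheses on the approximate ring-module `G`. -/
structure RHyp (b L K : ℝ) (G : Set ℝ) : Prop where
  sym : ∀ g ∈ G, -g ∈ G
  add : ∃ F0 : Finset ℝ, (F0.card : ℝ) ≤ K ∧ ∀ g ∈ G, ∀ g' ∈ G, ∃ f ∈ F0, g + g' - f ∈ G
  bdd : ∀ g ∈ G, |g| ≤ K * L
  upper : ∀ S : Finset ℝ, (S : Set ℝ) ⊆ G → Sep 1 S → (S.card : ℝ) ≤ K * L ^ b
  lower : ∀ u : ℝ, 1 ≤ u → ∃ S : Finset ℝ, (S : Set ℝ) ⊆ G ∧ Sep u S ∧ (L / u) ^ b ≤ K * S.card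

/-- Good with exponent. -/
abbrev GE (G : Set ℝ) (K : ℝ) (m : ℕ) (c : ℝ) : Prop := Good G (K ^ m) c

lemma GE.mono {G : Set ℝ} {K c : ℝ} (hK : 1 ≤ K) {m m' : ℕ} (h : GE G K m c) (hm : m ≤ m') :
    GE G K m' c := Good.mono h (pow_le_pow_right₀ hK hm)

lemma GE.mul {G : Set ℝ} {K c c' : ℝ} {m m' : ℕ} (h : GE G K m c) (h' : GE G K m' c') :
    GE G K (m + m') (c * c') := by
  have := Good.mul h h'
  rwa [← pow_add] at this

lemma GE.add {b L G} {K c c' : ℝ} (hR : RHyp b L K G) {m m' : ℕ} (h : GE G K m c)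
    (h' : GE G K m' c') : GE G K (m + m' + 1) (c + c') := by
  have := Good.add hR.add h h'
  have e : K * K ^ m * K ^ m' = K ^ (m + m' + 1) := by ring
  rwa [e] at this

lemma GE.sub {b L G} {K c c' : ℝ} (hR : RHyp b L K G) {m m' : ℕ} (h : GE G K m c)
    (h' : GE G K m' c') : GE G K (m + m' + 1) (c - c') := by
  rw [sub_eq_add_neg]
  exact GE.add hR h (Good.neg hR.sym h')

lemma GE.pow {G} {K c : ℝ} {m : ℕ} (h : GE G K m c) (j : ℕ) : GE G K (m * j) (c ^ j) := by
  have := Good.pow h j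
  rwa [← pow_mul] at this

lemma cov_self {G : Set ℝ} (K : ℝ) : Cov G (K ^ 0) G :=
  ⟨{0}, by simp, fun g hg => ⟨0, by simp, by simpa using hg⟩⟩

lemma GE.cov {G} {K c : ℝ} {m : ℕ} (h : GE G K m c) : Cov G (K ^ m) {x | ∃ g ∈ G, x = c * g} :=
  good_iff_cov.1 h

lemma CE.add {b L G} {K : ℝ} (hR : RHyp b L K G) {m m' : ℕ} {S S' : Set ℝ} (h : Cov G (K ^ m) S)
    (h' : Cov G (K ^ m') S') : Cov G (K ^ (m + m' + 1)) {x | ∃ s ∈ S, ∃ s' ∈ S', x = s + s'} := by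
  have := Cov.add hR.add h h'
  have e : K * K ^ m * K ^ m' = K ^ (m + m' + 1) := by ring
  rwa [e] at this

/-- count of 1-separated sets in a covered set. -/
lemma card_le_of_cov {b L K G} (hR : RHyp b L K G) {m : ℕ} {S : Finset ℝ} (hK : 1 ≤ K) (hL : 0 ≤ L)
    (hS : Sep 1 S) (h : Cov G (K ^ m) S) : (S.card : ℝ) ≤ K ^ (m + 1) * L ^ b := by
  classical
  obtain ⟨F, h1, h2⟩ := h
  have hsub : S ⊆ F.biUnion (fun f => S.filter (fun s => s - f ∈ G)) := by
    intro s hs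
    obtain ⟨f, hf, hh⟩ := h2 s hs
    simp only [Finset.mem_biUnion, Finset.mem_filter]
    exact ⟨f, hf, hs, hh⟩
  have hfib : ∀ f ∈ F, ((S.filter (fun s => s - f ∈ G)).card : ℝ) ≤ K * L ^ b := by
    intro f hf
    have hinj : Function.Injective (fun s : ℝ => s - f) := fun x y h => by simpa using h
    rw [← Finset.card_image_of_injective _ hinj]
    apply hR.upper
    · intro x hx
      simp only [Finset.coe_image, Set.mem_image, Finset.mem_coe, Finset.mem_filter] at hx
      obtain ⟨s, ⟨_, hs⟩, rfl⟩ := hx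
      exact hs
    · intro x hx y hy hxy
      simp only [Finset.mem_image, Finset.mem_filter] at hx hy
      obtain ⟨s, ⟨hs, _⟩, rfl⟩ := hx
      obtain ⟨t, ⟨ht, _⟩, rfl⟩ := hy
      have : s ≠ t := fun h => hxy (by rw [h])
      have := hS s hs t ht this
      simpa using this
  have hnn : 0 ≤ K * L ^ b := by positivity
  calc (S.card : ℝ) ≤ ((F.biUnion (fun f => S.filter (fun s => s - f ∈ G))).card : ℝ) := by
        exact_mod_cast Finset.card_le_card hsub
    _ ≤ ∑ f ∈ F, ((S.filter (fun s => s - f ∈ G)).card : ℝ) := by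
        exact_mod_cast Finset.card_biUnion_le
    _ ≤ ∑ f ∈ F, K * L ^ b := Finset.sum_le_sum hfib
    _ = F.card * (K * L ^ b) := by simp
    _ ≤ K ^ m * (K * L ^ b) := by gcongr
    _ = _ := by ring

/-- triple-sum separation -/
lemma triple_sep {P Q V : Finset ℝ} {u B s d : ℝ} (hP : Sep u P) (hQ : Sep s Q)
    (hB : ∀ q ∈ Q, ∀ q' ∈ Q, |q - q'| ≤ B) (hV : ∀ v ∈ V, ∀ v' ∈ V, |d * (v - v')| ≤ s / 2)
    (hV1 : ∀ v ∈ V, ∀ v' ∈ V, v ≠ v' → 1 ≤ |d * (v - v')|) (hs : 2 ≤ s) (hu : B + s / 2 + 1 ≤ u) :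
    ∃ S : Finset ℝ, S.card = P.card * Q.card * V.card ∧ Sep 1 S ∧
      (∀ x ∈ S, ∃ p ∈ P, ∃ q ∈ Q, ∃ v ∈ V, x = p + q + d * v) := by
  classical
  have key : ∀ p ∈ P, ∀ p' ∈ P, ∀ q ∈ Q, ∀ q' ∈ Q, ∀ v ∈ V, ∀ v' ∈ V, (p, q, v) ≠ (p', q', v') →
      1 ≤ |(p + q + d * v) - (p' + q' + d * v')| := by
    intro p hp p' hp' q hq q' hq' v hv v' hv' hne
    have e : (p + q + d * v) - (p' + q' + d * v') = (p - p') + (q - q') + d * (v - v') := by ring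
    rw [e]
    have h1 := hB q hq q' hq'
    have h2 := hV v hv v' hv'
    by_cases hpp : p = p'
    · by_cases hqq : q = q'
      · have : v ≠ v' := by
          rintro rfl; exact hne (by rw [hpp, hqq])
        have := hV1 v hv v' hv' this
        simpa [hpp, hqq] using this
      · have h3 := hQ q hq q' hq' hqq
        rw [hpp]
        have := abs_sub_abs_le_abs_sub (q - q') (-(d * (v - v')))
        rw [abs_neg] at this
        simp only [sub_self, zero_add]
        rw [sub_neg_eq_add] at this
        linarith
    · have h3 := hP p hp p' hp' hpp
      have h4 := abs_sub_abs_le_abs_sub (p - p') (-((q - q') + d * (v - v')))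
      rw [abs_neg, sub_neg_eq_add] at h4
      have h5 := abs_add_le (q - q') (d * (v - v'))
      rw [add_assoc]
      linarith
  refine ⟨(P ×ˢ Q ×ˢ V).image (fun t => t.1 + t.2.1 + d * t.2.2), ?_, ?_, ?_⟩
  · rw [Finset.card_image_of_injOn, Finset.card_product, Finset.card_product, mul_assoc]
    rintro ⟨p, q, v⟩ h ⟨p', q', v'⟩ h' heq
    simp only [Finset.coe_product, Set.mem_prod, Finset.mem_coe] at h h' heq
    by_contra hne
    have := key p h.1 p' h'.1 q h.2.1 q' h'.2.1 v h.2.2 v' h'.2.2 hne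
    rw [heq] at this
    simp at this
    linarith
  · intro x hx y hy hxy
    simp only [Finset.mem_image, Finset.mem_product, Prod.exists] at hx hy
    obtain ⟨p, q, v, ⟨h1, h2, h3⟩, rfl⟩ := hx
    obtain ⟨p', q', v', ⟨h1', h2', h3'⟩, rfl⟩ := hy
    apply key p h1 p' h1' q h2 q' h2' v h3 v' h3'
    rintro heq
    simp only [Prod.mk.injEq] at heq
    obtain ⟨rfl, rfl, rfl⟩ := heq
    exact hxy rfl
  · intro x hx
    simp only [Finset.mem_image, Finset.mem_product, Prod.exists] at hx
    obtain ⟨p, q, v, ⟨h1, h2, h3⟩, rfl⟩ := hx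
    exact ⟨p, h1, q, h2, v, h3, rfl⟩

/-- core counting lemma. `La` stands for `L ^ a`. -/
lemma core_count {b L K G La} (hb0 : 0 < b) (hb1 : b < 1) (hK : 1 ≤ K) (hL : 1 ≤ L) (hLa : 1 ≤ La)
    (hR : RHyp b L K G) {Q : Finset ℝ} {s B d : ℝ} {m : ℕ} (hQ : Sep s Q) (hs : 2 ≤ s) (hBs : s ≤ B)
    (hB : ∀ q ∈ Q, ∀ q' ∈ Q, |q - q'| ≤ B) (hd1 : s / (4 * (K * L)) / La ≤ |d|)
    (hd2 : |d| ≤ s / (4 * (K * L))) (hd3 : |d| ≤ 1)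
    (hcov : Cov G (K ^ m) {x | ∃ p ∈ G, ∃ q ∈ Q, ∃ v ∈ G, x = p + q + d * v}) :
    (Q.card : ℝ) ≤ 8 * K ^ (m + 4) * La * (B / s) ^ b := by
  have hd0 : 0 < |d| := lt_of_lt_of_le (by positivity) hd1
  obtain ⟨P, hPG, hPs, hPc⟩ := hR.lower (2 * B) (by linarith)
  obtain ⟨V, hVG, hVs, hVc⟩ := hR.lower (1 / |d|) (by rw [le_div_iff₀ hd0]; linarith)
  obtain ⟨S, hSc, hS1, hSm⟩ := triple_sep (V := V) (d := d) hPs hQ hB (by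
      intro v hv v' hv'
      rw [abs_mul]
      have h1 := hR.bdd v (hVG hv)
      have h2 := hR.bdd v' (hVG hv')
      have h3 : |v - v'| ≤ 2 * (K * L) := by
        have := abs_sub v v'
        linarith
      calc |d| * |v - v'| ≤ s / (4 * (K * L)) * (2 * (K * L)) := by gcongr
        _ = s / 2 := by field_simp; ring) (by
      intro v hv v' hv' hne
      rw [abs_mul]
      have := hVs v hv v' hv' hne
      rw [div_le_iff₀ hd0] at this
      linarith) hs (by linarith)
  have hcard := card_le_of_cov hR (m := m) hK (by linarith) hS1 (hcov.mono le_rfl (by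
    intro x hx
    obtain ⟨p, hp, q, hq, v, hv, rfl⟩ := hSm x hx
    exact ⟨p, hPG hp, q, hq, v, hVG hv, rfl⟩))
  rw [hSc] at hcard
  push_cast at hcard
  have hsp : 0 < s := by linarith
  have hBp : 0 < B := by linarith
  -- lower bound product
  have hV2 : (s / (4 * K) / La) ^ b ≤ K * V.card := by
    refine le_trans ?_ hVc
    apply Real.rpow_le_rpow (by positivity) _ hb0.le
    rw [div_div_eq_mul_div, div_one]
    calc s / (4 * K) / La = L * (s / (4 * (K * L)) / La) := by field_simp
      _ ≤ L * |d| := by gcongr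
  have hprod : L ^ b ≤ (8 * K * La * (B / s)) ^ b * (K * P.card * (K * V.card)) := by
    have e : L = (8 * K * La * (B / s)) * ((L / (2 * B)) * (s / (4 * K) / La)) := by
      field_simp; ring
    calc L ^ b = (8 * K * La * (B / s)) ^ b * ((L / (2 * B)) ^ b * (s / (4 * K) / La) ^ b) := by
          conv_lhs => rw [e]
          rw [Real.mul_rpow (by positivity) (by positivity),
            Real.mul_rpow (x := L / (2 * B)) (by positivity) (by positivity)]
      _ ≤ _ := by clear e; gcongr
  have h8 : (8 * K * La * (B / s)) ^ b ≤ 8 * K * La * (B / s) ^ b := by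
    have hLp : 0 < La := by linarith
    have hKp : 0 < K := by linarith
    rw [Real.mul_rpow (by positivity) (by positivity)]
    refine mul_le_mul_of_nonneg_right ?_ (by positivity)
    have h1 : 1 ≤ 8 * K * La := by nlinarith
    calc (8 * K * La) ^ b ≤ (8 * K * La) ^ (1:ℝ) := Real.rpow_le_rpow_of_exponent_le h1 hb1.le
      _ = _ := Real.rpow_one _
  have hPpos : 0 < (P.card : ℝ) := by
    have : 0 < (L / (2 * B)) ^ b := by positivity
    by_contra h
    have : K * (P.card : ℝ) ≤ 0 := by nlinarith
    linarith
  have hVpos : 0 < (V.card : ℝ) := by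
    have : 0 < (s / (4 * K) / La) ^ b := by positivity
    by_contra h
    have : K * (V.card : ℝ) ≤ 0 := by nlinarith
    linarith
  have hPV : 0 < (P.card : ℝ) * V.card := by positivity
  have hfin : (Q.card : ℝ) * (P.card * V.card) ≤ (8 * K ^ (m + 4) * La * (B / s) ^ b) * (P.card * V.card) := by
    calc (Q.card : ℝ) * (P.card * V.card) = P.card * Q.card * V.card := by ring
      _ ≤ K ^ (m + 1) * L ^ b := hcard
      _ ≤ K ^ (m + 1) * ((8 * K * La * (B / s) ^ b) * (K * P.card * (K * V.card))) := by
          gcongr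
          exact hprod.trans (by gcongr)
      _ = _ := by ring
  exact le_of_mul_le_mul_right hfin hPV

end BP

open MeasureTheory
open scoped ENNReal

namespace BP

lemma sep_card_le {u x l : ℝ} {S : Finset ℝ} (hu : 0 < u) (hl : 0 ≤ l) (hS : Sep u S)
    (h : ∀ s ∈ S, x ≤ s ∧ s ≤ x + l) : (S.card : ℝ) ≤ l / u + 1 := by
  classical
  have hinj : Set.InjOn (fun s : ℝ => ⌊(s - x) / u⌋) S := by
    intro s hs t ht hst
    by_contra hne
    have h1 := hS s hs t ht hne
    simp only at hst
    have h2 := Int.abs_sub_lt_one_of_floor_eq_floor hst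
    rw [← sub_div, abs_div, abs_of_pos hu, div_lt_one hu] at h2
    have e : s - x - (t - x) = s - t := by ring
    rw [e] at h2
    linarith
  have hcard : S.card ≤ (Finset.Icc (0:ℤ) ⌊l / u⌋).card := by
    apply Finset.card_le_card_of_injOn _ _ hinj
    intro s hs
    obtain ⟨h1, h2⟩ := h s hs
    simp only [Finset.coe_Icc, Set.mem_Icc]
    constructor
    · apply Int.floor_nonneg.2
      apply div_nonneg _ hu.le
      linarith
    · apply Int.floor_le_floor
      gcongr
      linarith
  have h0 : 0 ≤ ⌊l / u⌋ := Int.floor_nonneg.2 (by positivity)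
  have h3 : ((Finset.Icc (0:ℤ) ⌊l / u⌋).card : ℝ) = (⌊l / u⌋ : ℝ) + 1 := by
    rw [Int.card_Icc]
    have : ((⌊l / u⌋ + 1 - 0).toNat : ℤ) = ⌊l / u⌋ + 1 := by
      rw [Int.toNat_of_nonneg] <;> omega
    exact_mod_cast this
  calc (S.card : ℝ) ≤ ((Finset.Icc (0:ℤ) ⌊l / u⌋).card : ℝ) := by exact_mod_cast hcard
    _ = (⌊l / u⌋ : ℝ) + 1 := h3
    _ ≤ l / u + 1 := by gcongr; exact Int.floor_le _

lemma exists_max_sep {u : ℝ} (hu : 0 < u) (S : Finset ℝ) :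
    ∃ T ⊆ S, Sep u T ∧ ∀ s ∈ S, ∃ t ∈ T, |s - t| < u := by
  classical
  induction S using Finset.induction_on with
  | empty => exact ⟨∅, by simp, by intro x hx; simp at hx, by simp⟩
  | insert a S ha ih =>
    obtain ⟨T, hT, hs, hc⟩ := ih
    by_cases h : ∃ t ∈ T, |a - t| < u
    · refine ⟨T, hT.trans (Finset.subset_insert _ _), hs, ?_⟩
      intro s hs'
      rcases Finset.mem_insert.1 hs' with rfl | h'
      · exact h
      · exact hc s h'
    · push Not at h
      refine ⟨insert a T, Finset.insert_subset_insert _ hT, ?_, ?_⟩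
      · intro x hx y hy hxy
        rcases Finset.mem_insert.1 hx with rfl | hx'
        · rcases Finset.mem_insert.1 hy with rfl | hy'
          · exact absurd rfl hxy
          · exact h y hy'
        · rcases Finset.mem_insert.1 hy with rfl | hy'
          · rw [abs_sub_comm]; exact h x hx'
          · exact hs x hx' y hy' hxy
      · intro s hs'
        rcases Finset.mem_insert.1 hs' with rfl | h'
        · exact ⟨s, Finset.mem_insert_self _ _, by simpa using hu⟩
        · obtain ⟨t, ht, h2⟩ := hc s h'
          exact ⟨t, Finset.mem_insert_of_mem ht, h2⟩

lemma Sep.subset {u : ℝ} {S T : Finset ℝ} (h : Sep u S) (hT : T ⊆ S) : Sep u T :=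
  fun x hx y hy => h x (hT hx) y (hT hy)

/-- the dichotomy: dense quotient set or a gap. -/
lemma gap_dense {Z : Finset ℝ} {r : ℝ} (hr : 0 < r) (hr2 : r ≤ 1 / 2)
    (hZ : ∃ c ∈ Z, ∃ d ∈ Z, c ≠ d) :
    (∀ t : ℝ, 0 ≤ t → t ≤ 1 → ∃ a ∈ Z, ∃ b ∈ Z, ∃ c ∈ Z, ∃ d ∈ Z, c ≠ d ∧
      |(a - b) / (c - d)| ≤ 2 ∧ |(a - b) / (c - d) - t| ≤ 3 * r) ∨
    (∃ a ∈ Z, ∃ b ∈ Z, ∃ c ∈ Z, ∃ d ∈ Z, ∃ e : ℝ, c ≠ d ∧ (e = a - b ∨ e = (a - b) + (c - d)) ∧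
      |e| ≤ 3 * |c - d| ∧ ∀ a' ∈ Z, ∀ b' ∈ Z, ∀ c' ∈ Z, ∀ d' ∈ Z, c' ≠ d' →
        r ≤ |e / (2 * (c - d)) - (a' - b') / (c' - d')|) := by
  by_cases hgap : (∃ a ∈ Z, ∃ b ∈ Z, ∃ c ∈ Z, ∃ d ∈ Z, ∃ e : ℝ, c ≠ d ∧ (e = a - b ∨ e = (a - b) + (c - d)) ∧
      |e| ≤ 3 * |c - d| ∧ ∀ a' ∈ Z, ∀ b' ∈ Z, ∀ c' ∈ Z, ∀ d' ∈ Z, c' ≠ d' →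
        r ≤ |e / (2 * (c - d)) - (a' - b') / (c' - d')|)
  · exact Or.inr hgap
  · left
    push Not at hgap
    -- closure
    have step : ∀ a ∈ Z, ∀ b ∈ Z, ∀ c ∈ Z, ∀ d ∈ Z, c ≠ d → |(a - b) / (c - d)| ≤ 2 →
        ∀ ε : ℝ, (ε = 0 ∨ ε = 1) → ∃ a' ∈ Z, ∃ b' ∈ Z, ∃ c' ∈ Z, ∃ d' ∈ Z, c' ≠ d' ∧
          |(a' - b') / (c' - d')| ≤ 2 ∧
          |((a - b) / (c - d) + ε) / 2 - (a' - b') / (c' - d')| < r := by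
      intro a ha b hb c hc d hd hcd hq ε hε
      have hcd0 : c - d ≠ 0 := sub_ne_zero.2 hcd
      have hpos : 0 < |c - d| := abs_pos.2 hcd0
      have hab : |a - b| ≤ 2 * |c - d| := by
        rw [abs_div, div_le_iff₀ hpos] at hq
        exact hq
      have he : (a - b) + ε * (c - d) = a - b ∨ (a - b) + ε * (c - d) = (a - b) + (c - d) := by
        rcases hε with rfl | rfl <;> simp
      have he3 : |(a - b) + ε * (c - d)| ≤ 3 * |c - d| := by
        have h1 := abs_add_le (a - b) (ε * (c - d))
        rw [abs_mul] at h1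
        have h2 : |ε| ≤ 1 := by rcases hε with rfl | rfl <;> simp
        nlinarith
      obtain ⟨a', ha', b', hb', c', hc', d', hd', hcd', hlt⟩ :=
        hgap a ha b hb c hc d hd _ hcd he he3
      have e1 : ((a - b) + ε * (c - d)) / (2 * (c - d)) = ((a - b) / (c - d) + ε) / 2 := by
        field_simp
      rw [e1] at hlt
      refine ⟨a', ha', b', hb', c', hc', d', hd', hcd', ?_, hlt⟩
      have h3 : |((a - b) / (c - d) + ε) / 2| ≤ 3 / 2 := by
        rw [← e1, abs_div, abs_mul, abs_two, div_le_iff₀ (by positivity)]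
        linarith
      have h4 := abs_sub_abs_le_abs_sub ((a' - b') / (c' - d')) (((a - b) / (c - d) + ε) / 2)
      rw [abs_sub_comm] at h4
      linarith
    have iter : ∀ m : ℕ, ∀ t : ℝ, 0 ≤ t → t ≤ 1 → ∃ a ∈ Z, ∃ b ∈ Z, ∃ c ∈ Z, ∃ d ∈ Z, c ≠ d ∧
        |(a - b) / (c - d)| ≤ 2 ∧ |(a - b) / (c - d) - t| ≤ 2 * r + 2 * (1 / 2) ^ m := by
      intro m
      induction m with
      | zero =>
        intro t h0 h1
        obtain ⟨c, hc, d, hd, hcd⟩ := hZ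
        refine ⟨c, hc, c, hc, c, hc, d, hd, hcd, by simp, ?_⟩
        simp only [sub_self, zero_div, zero_sub, abs_neg, pow_zero]
        rw [abs_of_nonneg h0]
        linarith
      | succ m ih =>
        intro t h0 h1
        by_cases ht : t ≤ 1 / 2
        · obtain ⟨a, ha, b, hb, c, hc, d, hd, hcd, hq, hqt⟩ := ih (2 * t) (by linarith) (by linarith)
          obtain ⟨a', ha', b', hb', c', hc', d', hd', hcd', hq', hlt⟩ :=
            step a ha b hb c hc d hd hcd hq 0 (Or.inl rfl)
          refine ⟨a', ha', b', hb', c', hc', d', hd', hcd', hq', ?_⟩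
          rw [abs_le] at hqt ⊢
          rw [abs_lt] at hlt
          rw [pow_succ]
          constructor <;> linarith
        · obtain ⟨a, ha, b, hb, c, hc, d, hd, hcd, hq, hqt⟩ := ih (2 * t - 1) (by linarith) (by linarith)
          obtain ⟨a', ha', b', hb', c', hc', d', hd', hcd', hq', hlt⟩ :=
            step a ha b hb c hc d hd hcd hq 1 (Or.inr rfl)
          refine ⟨a', ha', b', hb', c', hc', d', hd', hcd', hq', ?_⟩
          rw [abs_le] at hqt ⊢
          rw [abs_lt] at hlt
          rw [pow_succ]
          constructor <;> linarith
    obtain ⟨m, hm⟩ := exists_pow_lt_of_lt_one (show 0 < r / 2 by positivity) (show (1/2:ℝ) < 1 by norm_num)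
    intro t h0 h1
    obtain ⟨a, ha, b, hb, c, hc, d, hd, hcd, hq, hqt⟩ := iter m t h0 h1
    exact ⟨a, ha, b, hb, c, hc, d, hd, hcd, hq, by linarith⟩

/-- iteration state -/
structure St (G : Set ℝ) (K ρ δ N : ℝ) (k m : ℕ) (Z : Finset ℝ) (D : ℝ) : Prop where
  Dlow : ρ ^ (4 ^ k) ≤ D
  Dup : D ≤ δ
  sep : Sep (ρ ^ (k + 1) * D) Z
  bd : ∀ z ∈ Z, |z| ≤ 3 ^ k * K * D
  card : N ^ (2 ^ k) ≤ Z.card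
  good : ∀ z ∈ Z, GE G K m z

/-- exponents. -/
def mseq : ℕ → ℕ
  | 0 => 4
  | (k+1) => 10 * mseq k + 7

lemma mseq_mono : Monotone mseq := monotone_nat_of_le_succ (fun n => by simp only [mseq]; omega)

/-- Conclusion of the dense alternative. -/
def DenseOut (G : Set ℝ) (K ρ : ℝ) (n m : ℕ) : Prop :=
  ∀ t : ℝ, 0 ≤ t → t ≤ 1 → ∃ d1 d2 : ℝ, ρ ^ (n + 4 ^ n) ≤ |d1| ∧ |d1| ≤ 1 ∧ GE G K m d1 ∧
    GE G K m d2 ∧ |d2| ≤ 2 * |d1| ∧ |d2 / d1 - t| ≤ 3 * ρ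

lemma gap_step {b L K G ρ δ N} {n k : ℕ} (hK : 1 ≤ K) (hR : RHyp b L K G) (hρ : 0 < ρ)
    (hρ2 : ρ ≤ 1 / 2) (hδ : δ * (4 * 3 ^ n * K) ≤ 1) (hN : 1 < N) (hk : k < n)
    {Z : Finset ℝ} {D : ℝ} (h : St G K ρ δ N k (mseq k) Z D) :
    DenseOut G K ρ n (2 * mseq n + 1) ∨ ∃ Z' D', St G K ρ δ N (k + 1) (mseq (k + 1)) Z' D' := by
  classical
  have hD0 : 0 < D := lt_of_lt_of_le (by positivity) h.Dlow
  have hZ : ∃ c ∈ Z, ∃ d ∈ Z, c ≠ d := by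
    have h1 : (1:ℝ) < Z.card := lt_of_lt_of_le (one_lt_pow₀ hN (by positivity)) h.card
    have h2 : 1 < Z.card := by exact_mod_cast h1
    obtain ⟨c, d, hc, hd, hcd⟩ := Finset.one_lt_card_iff.1 h2
    exact ⟨c, hc, d, hd, hcd⟩
  have hdiff : ∀ c ∈ Z, ∀ d ∈ Z, |c - d| ≤ 1 / 2 := by
    intro c hc d hd
    have h1 := h.bd c hc
    have h2 := h.bd d hd
    have h3 := abs_sub c d
    have h4 : (3:ℝ) ^ k ≤ 3 ^ n := pow_le_pow_right₀ (by norm_num) hk.le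
    have h5 : (3:ℝ) ^ k * K * D ≤ 3 ^ n * K * δ := by
      gcongr
      exact h.Dup
    nlinarith
  have hgood : ∀ c ∈ Z, ∀ d ∈ Z, GE G K (2 * mseq k + 1) (c - d) := by
    intro c hc d hd
    have := GE.sub hR (h.good c hc) (h.good d hd)
    exact this.mono hK (by omega)
  have hdl : ∀ c ∈ Z, ∀ d ∈ Z, c ≠ d → ρ ^ (k + 1 + 4 ^ k) ≤ |c - d| := by
    intro c hc d hd hcd
    refine le_trans ?_ (h.sep c hc d hd hcd)
    rw [pow_add]
    gcongr
    exact h.Dlow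
  have hexp : k + 1 + 4 ^ k ≤ n + 4 ^ n := by
    have : 4 ^ k ≤ 4 ^ n := Nat.pow_le_pow_right (by norm_num) hk.le
    omega
  rcases gap_dense hρ hρ2 hZ with hd | ⟨a, ha, b, hb, c, hc, d, hd, e, hcd, he, he3, hgap⟩
  · left
    intro t h0 h1
    obtain ⟨a, ha, b, hb, c, hc, d, hd, hcd, hq, hqt⟩ := hd t h0 h1
    have hpos : 0 < |c - d| := abs_pos.2 (sub_ne_zero.2 hcd)
    have hmm : 2 * mseq k + 1 ≤ 2 * mseq n + 1 := by
      have := mseq_mono hk.le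
      omega
    refine ⟨c - d, a - b, ?_, ?_, (hgood c hc d hd).mono hK hmm, (hgood a ha b hb).mono hK hmm, ?_, hqt⟩
    · refine le_trans ?_ (hdl c hc d hd hcd)
      exact pow_le_pow_of_le_one hρ.le (by linarith) hexp
    · have := hdiff c hc d hd
      linarith
    · rw [abs_div, div_le_iff₀ hpos] at hq
      exact hq
  · right
    have hcd0 : c - d ≠ 0 := sub_ne_zero.2 hcd
    have hpos : 0 < |c - d| := abs_pos.2 hcd0
    have hs0 : 0 < ρ ^ (k + 1) * D := by positivity
    have key : ∀ z1 ∈ Z, ∀ z2 ∈ Z, ∀ w1 ∈ Z, ∀ w2 ∈ Z, (z1, z2) ≠ (w1, w2) →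
        ρ ^ (k + 1 + 1) * (2 * |c - d| * D) ≤
          |(2 * (c - d) * z1 + e * z2) - (2 * (c - d) * w1 + e * w2)| := by
      intro z1 hz1 z2 hz2 w1 hw1 w2 hw2 hne
      have e0 : ρ ^ (k + 1 + 1) * (2 * |c - d| * D) = (2 * |c - d|) * (ρ ^ (k+1) * D) * ρ := by ring
      rw [e0]
      by_cases h2 : z2 = w2
      · have h1 : z1 ≠ w1 := by rintro rfl; exact hne (by rw [h2])
        have h3 := h.sep z1 hz1 w1 hw1 h1
        have e1 : (2 * (c - d) * z1 + e * z2) - (2 * (c - d) * w1 + e * w2)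
          = 2 * (c - d) * (z1 - w1) := by rw [h2]; ring
        rw [e1, abs_mul, abs_mul, abs_two]
        calc (2 * |c - d|) * (ρ ^ (k+1) * D) * ρ ≤ (2 * |c - d|) * (ρ ^ (k+1) * D) * 1 := by
              gcongr; linarith
          _ ≤ 2 * |c - d| * |z1 - w1| := by rw [mul_one]; gcongr
      · have h3 := h.sep z2 hz2 w2 hw2 h2
        have h4 := hgap w1 hw1 z1 hz1 z2 hz2 w2 hw2 h2
        have hz : z2 - w2 ≠ 0 := sub_ne_zero.2 h2
        have e1 : (2 * (c - d) * z1 + e * z2) - (2 * (c - d) * w1 + e * w2)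
          = 2 * (c - d) * (z2 - w2) * (e / (2 * (c - d)) - (w1 - z1) / (z2 - w2)) := by
          field_simp; ring
        rw [e1, abs_mul, abs_mul, abs_mul, abs_two]
        gcongr
    refine ⟨(Z ×ˢ Z).image (fun z => 2 * (c - d) * z.1 + e * z.2), 2 * |c - d| * D, ?_, ?_, ?_, ?_, ?_, ?_⟩
    · have h1 : ρ ^ (k + 1 + 4 ^ k) * ρ ^ (4 ^ k) ≤ |c - d| * D := by
        gcongr
        · exact hdl c hc d hd hcd
        · exact h.Dlow
      rw [← pow_add] at h1
      have h2 : k + 1 + 4 ^ k + 4 ^ k ≤ 4 ^ (k + 1) := by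
        have : k < 4 ^ k := Nat.lt_pow_self (by norm_num)
        rw [pow_succ]; omega
      have h3 : ρ ^ (4 ^ (k+1)) ≤ ρ ^ (k + 1 + 4 ^ k + 4 ^ k) :=
        pow_le_pow_of_le_one hρ.le (by linarith) h2
      have h4 : 0 < |c - d| * D := by positivity
      nlinarith
    · have := hdiff c hc d hd
      have h4 := h.Dup
      nlinarith
    · intro x hx y hy hxy
      simp only [Finset.mem_image, Finset.mem_product, Prod.exists] at hx hy
      obtain ⟨z1, z2, ⟨h1, h2⟩, rfl⟩ := hx
      obtain ⟨w1, w2, ⟨h3, h4⟩, rfl⟩ := hy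
      apply key z1 h1 z2 h2 w1 h3 w2 h4
      intro heq
      simp only [Prod.mk.injEq] at heq
      obtain ⟨rfl, rfl⟩ := heq
      exact hxy rfl
    · intro x hx
      simp only [Finset.mem_image, Finset.mem_product, Prod.exists] at hx
      obtain ⟨z1, z2, ⟨h1, h2⟩, rfl⟩ := hx
      have h5 := h.bd z1 h1
      have h6 := h.bd z2 h2
      calc |2 * (c - d) * z1 + e * z2| ≤ |2 * (c - d) * z1| + |e * z2| := abs_add_le _ _
        _ = 2 * |c - d| * |z1| + |e| * |z2| := by rw [abs_mul, abs_mul, abs_mul, abs_two]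
        _ ≤ 2 * |c - d| * (3 ^ k * K * D) + (3 * |c - d|) * (3 ^ k * K * D) := by gcongr
        _ ≤ _ := by
          have : 0 < |c - d| * (3 ^ k * K * D) := by positivity
          rw [pow_succ]
          nlinarith
    · rw [Finset.card_image_of_injOn, Finset.card_product]
      · have := h.card
        push_cast
        rw [pow_succ 2 k, pow_mul, sq]
        have hN0 : 0 ≤ N ^ 2 ^ k := by positivity
        gcongr
      · rintro ⟨z1, z2⟩ h1 ⟨w1, w2⟩ h2 heq
        simp only [Finset.coe_product, Set.mem_prod, Finset.mem_coe] at h1 h2 heq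
        by_contra hne
        have := key z1 h1.1 z2 h1.2 w1 h2.1 w2 h2.2 hne
        rw [heq, sub_self, abs_zero] at this
        have h9 : 0 < ρ ^ (k + 1 + 1) * (2 * |c - d| * D) := by positivity
        linarith
    · intro x hx
      simp only [Finset.mem_image, Finset.mem_product, Prod.exists] at hx
      obtain ⟨z1, z2, ⟨h1, h2⟩, rfl⟩ := hx
      have g1 : GE G K (4 * mseq k + 3) (2 * (c - d)) := by
        rw [two_mul]
        exact (GE.add hR (hgood c hc d hd) (hgood c hc d hd)).mono hK (by omega)
      have g2 : GE G K (4 * mseq k + 3) e := by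
        rcases he with rfl | rfl
        · exact (hgood a ha b hb).mono hK (by omega)
        · exact (GE.add hR (hgood a ha b hb) (hgood c hc d hd)).mono hK (by omega)
      exact (GE.add hR (g1.mul (h.good z1 h1)) (g2.mul (h.good z2 h2))).mono hK
        (by simp only [mseq]; omega)

lemma dense_of_start {b L K G ρ δ N} {n : ℕ} (hK : 1 ≤ K) (hR : RHyp b L K G) (hρ : 0 < ρ)
    (hρ2 : ρ ≤ 1 / 2) (hδ : δ * (4 * 3 ^ n * K) ≤ 1) (hN : 1 < N)
    (hbig : 2 * 3 ^ n * K / ρ ^ (n + 1) + 1 < N ^ (2 ^ n))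
    {Z : Finset ℝ} {D : ℝ} (h : St G K ρ δ N 0 4 Z D) :
    DenseOut G K ρ n (2 * mseq n + 1) := by
  have main : ∀ k ≤ n, DenseOut G K ρ n (2 * mseq n + 1) ∨ ∃ Z' D', St G K ρ δ N k (mseq k) Z' D' := by
    intro k
    induction k with
    | zero => intro _; exact Or.inr ⟨Z, D, h⟩
    | succ k ih =>
      intro hk
      rcases ih (by omega) with h1 | ⟨Z', D', h1⟩
      · exact Or.inl h1
      · exact gap_step hK hR hρ hρ2 hδ hN (by omega) h1
  rcases main n le_rfl with h1 | ⟨Z', D', h1⟩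
  · exact h1
  · exfalso
    have hD0 : 0 < D' := lt_of_lt_of_le (by positivity) h1.Dlow
    have h2 := sep_card_le (x := -(3 ^ n * K * D')) (l := 2 * (3 ^ n * K * D')) (by positivity) (by positivity) h1.sep (by
      intro s hs
      have := abs_le.1 (h1.bd s hs)
      constructor <;> linarith)
    have h3 := h1.card
    have e : 2 * (3 ^ n * K * D') / (ρ ^ (n + 1) * D') = 2 * 3 ^ n * K / ρ ^ (n + 1) := by
      field_simp
    rw [e] at h2
    linarith

end BP

open MeasureTheory
open scoped ENNReal

namespace BP

lemma cs_fiber {α β : Type*} [DecidableEq α] [DecidableEq β] (S : Finset α) (T : Finset β) (φ : α → β)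
    (h : ∀ s ∈ S, φ s ∈ T) :
    (S.card : ℝ) ^ 2 ≤ T.card * (∑ p ∈ S ×ˢ S, if φ p.1 = φ p.2 then (1:ℝ) else 0) := by
  have h1 : (S.card : ℝ) = ∑ t ∈ T, ((S.filter (fun s => φ s = t)).card : ℝ) := by
    exact_mod_cast Finset.card_eq_sum_card_fiberwise h
  have h2 : (∑ p ∈ S ×ˢ S, if φ p.1 = φ p.2 then (1:ℝ) else 0)
      = ∑ t ∈ T, ((S.filter (fun s => φ s = t)).card : ℝ) ^ 2 := by
    have e1 : ∀ p ∈ S ×ˢ S, (if φ p.1 = φ p.2 then (1:ℝ) else 0)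
        = ∑ t ∈ T, (if φ p.1 = t then (1:ℝ) else 0) * (if φ p.2 = t then (1:ℝ) else 0) := by
      intro p hp
      rw [Finset.mem_product] at hp
      rw [Finset.sum_eq_single (φ p.1)]
      · simp [eq_comm]
      · intro t _ ht
        simp [ht.symm]
      · intro h'
        exact absurd (h _ hp.1) h'
    rw [Finset.sum_congr rfl e1, Finset.sum_comm]
    refine Finset.sum_congr rfl (fun t _ => ?_)
    rw [Finset.sum_product' S S (fun a c => (if φ a = t then (1:ℝ) else 0) * (if φ c = t then (1:ℝ) else 0)),
      ← Finset.sum_mul_sum]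
    rw [sq, Finset.card_filter]
    push_cast
    rfl
  rw [h2, h1]
  exact sq_sum_le_card_mul_sum_sq

lemma sep_card_ball {u c R : ℝ} {S : Finset ℝ} (hu : 0 < u) (hR : 0 ≤ R) (hS : Sep u S)
    (h : ∀ s ∈ S, |s - c| ≤ R) : (S.card : ℝ) ≤ 2 * R / u + 1 := by
  apply sep_card_le (x := c - R) hu (by positivity) hS
  intro s hs
  have := abs_le.1 (h s hs)
  constructor <;> linarith

lemma marstrand_count {X Ξ : Finset ℝ} {r H v0 w m' : ℝ} (hr : 0 < r) (hH : 0 < H) (hv0 : 0 < v0)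
    (hv1 : v0 ≤ 1) (hw : 0 ≤ w) (hX : Sep (r * H) X) (hΞ : Sep (4 * r) Ξ)
    (hW : ∀ ξ ∈ Ξ, ∀ W : Finset ℝ, Sep (r * H) W → (∀ z ∈ W, ∃ x ∈ X, ∃ y ∈ X, z = x + ξ * y) →
      (W.card : ℝ) ≤ w)
    (hm : ∀ y ∈ X, ((X.filter (fun y' => |y' - y| ≤ v0 * H)).card : ℝ) ≤ m') :
    (Ξ.card : ℝ) * (X.card : ℝ) ^ 4 ≤
      w * (5 * Ξ.card * (X.card : ℝ) ^ 2 * m' + 2 / v0 * (X.card : ℝ) ^ 4) := by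
  classical
  set N : ℝ := (X.card : ℝ) with hN
  have hσ : 0 < r * H := by positivity
  -- collisions
  let c : ℝ → (ℝ × ℝ) × (ℝ × ℝ) → ℝ := fun ξ q =>
    if |(q.1.1 - q.2.1) + ξ * (q.1.2 - q.2.2)| < 2 * (r * H) then 1 else 0
  have hc0 : ∀ ξ q, 0 ≤ c ξ q := by intro ξ q; simp only [c]; split_ifs <;> norm_num
  have hlow : ∀ ξ ∈ Ξ, N ^ 4 ≤ w * ∑ q ∈ (X ×ˢ X) ×ˢ (X ×ˢ X), c ξ q := by
    intro ξ hξ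
    obtain ⟨T, hT, hTs, hTc⟩ := exists_max_sep hσ ((X ×ˢ X).image (fun p => p.1 + ξ * p.2))
    have hTw : (T.card : ℝ) ≤ w := by
      apply hW ξ hξ T hTs
      intro z hz
      have := hT hz
      simp only [Finset.mem_image, Finset.mem_product, Prod.exists] at this
      obtain ⟨x, y, ⟨hx, hy⟩, rfl⟩ := this
      exact ⟨x, hx, y, hy, rfl⟩
    have hch : ∀ p : ℝ × ℝ, ∃ t : ℝ, p ∈ X ×ˢ X → (t ∈ T ∧ |p.1 + ξ * p.2 - t| < r * H) := by
      intro p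
      by_cases hp : p ∈ X ×ˢ X
      · obtain ⟨t, ht, h2⟩ := hTc _ (Finset.mem_image_of_mem (fun p => p.1 + ξ * p.2) hp)
        exact ⟨t, fun _ => ⟨ht, h2⟩⟩
      · exact ⟨0, fun h => absurd h hp⟩
    choose φ hφ using hch
    have h1 := cs_fiber (X ×ˢ X) T φ (fun s hs => (hφ s hs).1)
    have h2 : (∑ p ∈ (X ×ˢ X) ×ˢ (X ×ˢ X), if φ p.1 = φ p.2 then (1:ℝ) else 0) ≤
        ∑ q ∈ (X ×ˢ X) ×ˢ (X ×ˢ X), c ξ q := by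
      apply Finset.sum_le_sum
      intro q hq
      rw [Finset.mem_product] at hq
      by_cases he : φ q.1 = φ q.2
      · rw [if_pos he]
        have h3 := (hφ q.1 hq.1).2
        have h4 := (hφ q.2 hq.2).2
        rw [he] at h3
        simp only [c]
        rw [if_pos]
        rw [abs_lt] at *
        constructor <;> linarith
      · rw [if_neg he]; exact hc0 _ _
    have h0 : 0 ≤ ∑ p ∈ (X ×ˢ X) ×ˢ (X ×ˢ X), (if φ p.1 = φ p.2 then (1:ℝ) else 0) :=
      Finset.sum_nonneg (fun p _ => by split_ifs <;> norm_num)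
    rw [Finset.card_product] at h1
    push_cast at h1
    calc N ^ 4 = (N * N) ^ 2 := by ring
      _ ≤ _ := h1
      _ ≤ w * ∑ q ∈ (X ×ˢ X) ×ˢ (X ×ˢ X), c ξ q := by gcongr
  -- near / far
  let near : (ℝ × ℝ) × (ℝ × ℝ) → Prop := fun q => |q.2.2 - q.1.2| ≤ v0 * H
  have hnear : ∀ ξ ∈ Ξ, ∑ q ∈ (X ×ˢ X) ×ˢ (X ×ˢ X), (if near q then c ξ q else 0) ≤ 5 * N ^ 2 * m' := by
    intro ξ hξ
    have e1 : ∑ q ∈ (X ×ˢ X) ×ˢ (X ×ˢ X), (if near q then c ξ q else 0) =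
        ∑ x ∈ X, ∑ y ∈ X, ∑ y' ∈ X, ∑ x' ∈ X, (if |y' - y| ≤ v0 * H then c ξ ((x, y), (x', y')) else 0) := by
      rw [Finset.sum_product, Finset.sum_product]
      refine Finset.sum_congr rfl (fun x _ => Finset.sum_congr rfl (fun y _ => ?_))
      rw [Finset.sum_product_right]
    rw [e1]
    have h1 : ∀ x ∈ X, ∀ y ∈ X, ∑ y' ∈ X, ∑ x' ∈ X, (if |y' - y| ≤ v0 * H then c ξ ((x, y), (x', y')) else 0)
        ≤ 5 * m' := by
      intro x hx y hy
      have h2 : ∀ y' ∈ X, ∑ x' ∈ X, (if |y' - y| ≤ v0 * H then c ξ ((x, y), (x', y')) else 0) ≤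
          if |y' - y| ≤ v0 * H then (5:ℝ) else 0 := by
        intro y' hy'
        by_cases hh : |y' - y| ≤ v0 * H
        · simp only [if_pos hh, c]
          rw [← Finset.sum_filter, Finset.sum_const, nsmul_eq_mul, mul_one]
          have h5 := sep_card_ball (c := x + ξ * (y - y')) (R := 2 * (r * H)) hσ (by positivity)
            (hX.subset (Finset.filter_subset (fun x' => |x - x' + ξ * (y - y')| < 2 * (r * H)) X)) (by
              intro s hs
              rw [Finset.mem_filter] at hs
              rw [abs_sub_comm]
              have e : x + ξ * (y - y') - s = x - s + ξ * (y - y') := by ring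
              rw [e]
              exact hs.2.le)
          have e : 2 * (2 * (r * H)) / (r * H) + 1 = 5 := by field_simp; norm_num
          rw [e] at h5
          exact h5
        · simp [hh]
      calc _ ≤ ∑ y' ∈ X, if |y' - y| ≤ v0 * H then (5:ℝ) else 0 := Finset.sum_le_sum h2
        _ = 5 * ((X.filter (fun y' => |y' - y| ≤ v0 * H)).card : ℝ) := by
            rw [← Finset.sum_filter, Finset.sum_const, nsmul_eq_mul, mul_comm]
        _ ≤ 5 * m' := by gcongr; exact hm y hy
    calc _ ≤ ∑ x ∈ X, ∑ y ∈ X, 5 * m' := Finset.sum_le_sum (fun x hx => Finset.sum_le_sum (fun y hy => h1 x hx y hy))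
      _ = 5 * N ^ 2 * m' := by simp only [Finset.sum_const, nsmul_eq_mul]; ring
  have hfar : ∀ q, ∑ ξ ∈ Ξ, (if near q then 0 else c ξ q) ≤ 2 / v0 := by
    intro q
    by_cases hh : near q
    · simp only [if_pos hh, Finset.sum_const_zero]
      positivity
    · simp only [if_neg hh, c]
      rw [← Finset.sum_filter, Finset.sum_const, nsmul_eq_mul, mul_one]
      simp only [near, not_le] at hh
      set Δ := q.1.2 - q.2.2 with hΔ
      have hΔ' : v0 * H < |Δ| := by rw [hΔ, abs_sub_comm]; exact hh
      have hΔ0 : 0 < |Δ| := lt_trans (by positivity) hΔ'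
      have hΔne : Δ ≠ 0 := abs_pos.1 hΔ0
      have h5 := sep_card_ball (c := -(q.1.1 - q.2.1) / Δ) (R := 2 * r / v0) (show 0 < 4 * r by positivity) (by positivity)
            (hΞ.subset (Finset.filter_subset (fun ξ => |q.1.1 - q.2.1 + ξ * Δ| < 2 * (r * H)) Ξ)) (by
              intro s hs
              rw [Finset.mem_filter] at hs
              have e : s - -(q.1.1 - q.2.1) / Δ = (q.1.1 - q.2.1 + s * Δ) / Δ := by field_simp; ring
              rw [e, abs_div, div_le_div_iff₀ hΔ0 hv0]
              have h6 := hs.2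
              calc |q.1.1 - q.2.1 + s * Δ| * v0 ≤ 2 * (r * H) * v0 := by gcongr
                _ = 2 * r * (v0 * H) := by ring
                _ ≤ 2 * r * |Δ| := by gcongr)
      have e : 2 * (2 * r / v0) / (4 * r) + 1 = 1 / v0 + 1 := by field_simp; ring
      rw [e] at h5
      have h7 : 1 ≤ 1 / v0 := by rw [le_div_iff₀ hv0]; linarith
      calc _ ≤ 1 / v0 + 1 := h5
        _ ≤ 1 / v0 + 1 / v0 := by gcongr
        _ = 2 / v0 := by ring
  have hsplit : ∀ ξ q, c ξ q = (if near q then c ξ q else 0) + (if near q then 0 else c ξ q) := by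
    intro ξ q; split_ifs <;> simp
  have hsum : ∑ ξ ∈ Ξ, ∑ q ∈ (X ×ˢ X) ×ˢ (X ×ˢ X), c ξ q ≤ 5 * Ξ.card * N ^ 2 * m' + 2 / v0 * N ^ 4 := by
    have e2 : ∑ ξ ∈ Ξ, ∑ q ∈ (X ×ˢ X) ×ˢ (X ×ˢ X), c ξ q =
        ∑ ξ ∈ Ξ, ∑ q ∈ (X ×ˢ X) ×ˢ (X ×ˢ X), (if near q then c ξ q else 0) +
        ∑ q ∈ (X ×ˢ X) ×ˢ (X ×ˢ X), ∑ ξ ∈ Ξ, (if near q then 0 else c ξ q) := by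
      rw [Finset.sum_comm (s := (X ×ˢ X) ×ˢ (X ×ˢ X)), ← Finset.sum_add_distrib]
      refine Finset.sum_congr rfl (fun ξ _ => ?_)
      rw [← Finset.sum_add_distrib]
      exact Finset.sum_congr rfl (fun q _ => hsplit ξ q)
    rw [e2]
    have h1 := Finset.sum_le_sum hnear
    have h2 := Finset.sum_le_sum (fun q (_ : q ∈ (X ×ˢ X) ×ˢ (X ×ˢ X)) => hfar q)
    simp only [Finset.sum_const, nsmul_eq_mul, Finset.card_product] at h1 h2
    push_cast at h1 h2
    rw [← hN] at h2
    calc _ ≤ _ := add_le_add h1 h2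
      _ = _ := by ring
  calc (Ξ.card : ℝ) * N ^ 4 = ∑ ξ ∈ Ξ, N ^ 4 := by simp
    _ ≤ ∑ ξ ∈ Ξ, w * ∑ q ∈ (X ×ˢ X) ×ˢ (X ×ˢ X), c ξ q := Finset.sum_le_sum hlow
    _ = w * ∑ ξ ∈ Ξ, ∑ q ∈ (X ×ˢ X) ×ˢ (X ×ˢ X), c ξ q := by rw [Finset.mul_sum]
    _ ≤ _ := by gcongr

end BP

open MeasureTheory
open scoped ENNReal

namespace BP

/-- Dilations available -/
structure CHyp (κ L K : ℝ) (G C : Set ℝ) : Prop where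
  good : ∀ c ∈ C, |c| ≤ K ∧ Good G K c
  many : ∀ ρ : ℝ, 1 / L ≤ ρ → ρ ≤ 1 → ∃ S : Finset ℝ, (S : Set ℝ) ⊆ C ∧ Sep ρ S ∧ ρ ^ (-κ) ≤ K * S.card

lemma exists_small_d {b κ L K La G C} (hκ : 0 < κ) (hK : 1 ≤ K) (hLa : 1 ≤ La) (hL : La ≤ L)
    (hR : RHyp b L K G) (hC : CHyp κ L K G C) (h1 : 3 * K ^ 2 < La ^ (κ / 2)) :
    ∃ d : ℝ, 1 / La ≤ d ∧ d ≤ (La ^ (κ / 2))⁻¹ ∧ GE G K 3 d := by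
  obtain ⟨S, hSC, hS, hcard⟩ := hC.many (1 / La) (by gcongr) (by rw [div_le_one] <;> linarith)
  have hLp : 0 < La := by linarith
  set y := La ^ (κ / 2) with hy
  have hy0 : 0 < y := by positivity
  have e1 : (1 / La) ^ (-κ) = y * y := by
    rw [hy, ← Real.rpow_add hLp, one_div, Real.inv_rpow hLp.le, Real.rpow_neg hLp.le, inv_inv]
    congr 1; ring
  rw [e1] at hcard
  have : ∃ c1 ∈ S, ∃ c2 ∈ S, c1 ≠ c2 ∧ |c1 - c2| < y⁻¹ := by
    by_contra hcon
    push Not at hcon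
    have hsep : Sep y⁻¹ S := hcon
    have h2 := sep_card_ball (c := 0) (R := K) (show 0 < y⁻¹ by positivity) (by linarith) hsep (by
      intro s hs
      rw [sub_zero]
      exact (hC.good s (hSC hs)).1)
    rw [div_inv_eq_mul] at h2
    have h3 : y * y ≤ K * (2 * K * y + 1) := hcard.trans (by gcongr)
    have h4 : 1 ≤ y := Real.one_le_rpow hLa (by positivity)
    nlinarith
  obtain ⟨c1, hc1, c2, hc2, hne, hlt⟩ := this
  refine ⟨|c1 - c2|, hS c1 hc1 c2 hc2 hne, hlt.le, ?_⟩
  have g1 : GE G K 1 c1 := by have := (hC.good c1 (hSC hc1)).2; simpa [GE] using this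
  have g2 : GE G K 1 c2 := by have := (hC.good c2 (hSC hc2)).2; simpa [GE] using this
  have g3 : GE G K 3 (c1 - c2) := GE.sub hR g1 g2
  rcases abs_choice (c1 - c2) with h | h
  · rw [h]; exact g3
  · rw [h]; exact Good.neg hR.sym g3

lemma exists_pow_near {d y La r : ℝ} {J : ℕ} (hLa : 0 < La) (hr : 0 < r) (hr2 : r ≤ 1 / 2) (hd : 1 / La ≤ d)
    (hdy : d ≤ y) (hJ : y ^ J ≤ r / 4) : ∃ j ≤ J, r / 4 / La ≤ d ^ j ∧ d ^ j ≤ r / 4 := by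
  have hd0 : 0 < d := lt_of_lt_of_le (by positivity) hd
  have hex : ∃ j, d ^ j ≤ r / 4 := ⟨J, (pow_le_pow_left₀ hd0.le hdy J).trans hJ⟩
  classical
  refine ⟨Nat.find hex, Nat.find_min' hex ((pow_le_pow_left₀ hd0.le hdy J).trans hJ), ?_, Nat.find_spec hex⟩
  rcases hj : Nat.find hex with _ | i
  · have := Nat.find_spec hex
    rw [hj] at this
    simp at this
    linarith
  · have h1 := Nat.find_min hex (m := i) (by omega)
    push Not at h1
    rw [pow_succ, div_eq_mul_one_div]
    gcongr

lemma core_use1 {b L K La G} (hb0 : 0 < b) (hb1 : b < 1) (hK : 1 ≤ K) (hL : 1 ≤ L) (hLa : 1 ≤ La)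
    (hR : RHyp b L K G) {r d d1 d2 : ℝ} {m J M : ℕ} (hr : 0 < r) (hr2 : r ≤ 1 / 2)
    (hd1 : r / 4 / La ≤ d) (hd2 : d ≤ r / 4) (hdg : GE G K (3 * J) d)
    (hg1 : GE G K m d1) (hg2 : GE G K m d2) (hd1p : d1 ≠ 0) (hd11 : |d1| ≤ 1) (hd21 : |d2| ≤ 2 * |d1|)
    (hs : 2 ≤ |d1| * r * (K * L)) (hM : 3 * m + 3 * J + 7 ≤ M)
    {W : Finset ℝ} (hW : Sep (r * (K * L)) W) (hWG : ∀ z ∈ W, ∃ x ∈ G, ∃ y ∈ G, z = x + d2 / d1 * y) :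
    (W.card : ℝ) ≤ 48 * K ^ M * La * (r ^ b)⁻¹ := by
  classical
  have hd1pos : 0 < |d1| := abs_pos.2 hd1p
  have hd0 : 0 < d := lt_of_lt_of_le (by positivity) hd1
  have hKL : 0 < K * L := by positivity
  have hinj : Function.Injective (fun z : ℝ => d1 * z) := mul_right_injective₀ hd1p
  have habs : |d1 * d| = |d1| * d := by rw [abs_mul, abs_of_pos hd0]
  have hz : ∀ z ∈ W, |z| ≤ 3 * (K * L) := by
    intro z hz
    obtain ⟨x, hx, y, hy, rfl⟩ := hWG z hz
    have h1 := hR.bdd x hx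
    have h2 := hR.bdd y hy
    have h3 : |d2 / d1| ≤ 2 := by rw [abs_div, div_le_iff₀ hd1pos]; exact hd21
    calc |x + d2 / d1 * y| ≤ |x| + |d2 / d1 * y| := abs_add_le _ _
      _ = |x| + |d2 / d1| * |y| := by rw [abs_mul]
      _ ≤ K * L + 2 * (K * L) := by gcongr
      _ = _ := by ring
  have hcov : Cov G (K ^ (M - 4)) {x | ∃ p ∈ G, ∃ q ∈ W.image (fun z : ℝ => d1 * z), ∃ v ∈ G, x = p + q + (d1 * d) * v} := by
    have c1 := CE.add hR (CE.add hR (CE.add hR (cov_self K) hg1.cov) hg2.cov) (hg1.mul hdg).cov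
    refine c1.mono (pow_le_pow_right₀ hK (by omega)) ?_
    rintro x ⟨p, hp, q, hq, v, hv, rfl⟩
    rw [Finset.mem_image] at hq
    obtain ⟨z, hz, rfl⟩ := hq
    obtain ⟨x, hx, y, hy, rfl⟩ := hWG z hz
    exact ⟨p + d1 * x + d2 * y, ⟨p + d1 * x, ⟨p, hp, _, ⟨x, hx, rfl⟩, rfl⟩, _, ⟨y, hy, rfl⟩, rfl⟩,
      _, ⟨v, hv, rfl⟩, by field_simp; ring⟩
  have hmain := core_count hb0 hb1 hK hL hLa hR (Q := W.image (fun z : ℝ => d1 * z))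
    (s := |d1| * r * (K * L)) (B := 6 * |d1| * (K * L)) (d := d1 * d) (m := M - 4) (by
      intro x hx y hy hxy
      rw [Finset.mem_image] at hx hy
      obtain ⟨x, hx, rfl⟩ := hx
      obtain ⟨y, hy, rfl⟩ := hy
      have := hW x hx y hy (fun h => hxy (by rw [h]))
      rw [← mul_sub, abs_mul, mul_assoc]
      gcongr) hs (by
      have : 0 < |d1| * (K * L) := by positivity
      nlinarith) (by
      intro x hx y hy
      rw [Finset.mem_image] at hx hy
      obtain ⟨x, hx, rfl⟩ := hx
      obtain ⟨y, hy, rfl⟩ := hy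
      have h1 := hz x hx
      have h2 := hz y hy
      have h3 := abs_sub x y
      rw [← mul_sub, abs_mul]
      calc |d1| * |x - y| ≤ |d1| * (6 * (K * L)) := by gcongr; linarith
        _ = _ := by ring) (by
      rw [habs]
      calc |d1| * r * (K * L) / (4 * (K * L)) / La = |d1| * (r / 4 / La) := by field_simp
        _ ≤ _ := by gcongr) (by
      rw [habs]
      calc |d1| * d ≤ |d1| * (r / 4) := by gcongr
        _ = _ := by field_simp) (by
      rw [habs]
      nlinarith) hcov
  rw [Finset.card_image_of_injective _ hinj] at hmain
  have hM4 : M - 4 + 4 = M := by omega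
  rw [hM4] at hmain
  refine hmain.trans ?_
  have e : 6 * |d1| * (K * L) / (|d1| * r * (K * L)) = 6 * r⁻¹ := by field_simp
  rw [e, Real.mul_rpow (by norm_num) (by positivity), Real.inv_rpow hr.le]
  have h6 : (6:ℝ) ^ b ≤ 6 := by
    calc (6:ℝ) ^ b ≤ 6 ^ (1:ℝ) := Real.rpow_le_rpow_of_exponent_le (by norm_num) hb1.le
      _ = 6 := Real.rpow_one _
  calc 8 * K ^ M * La * (6 ^ b * (r ^ b)⁻¹) ≤ 8 * K ^ M * La * (6 * (r ^ b)⁻¹) := by gcongr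
    _ = _ := by ring

lemma core_use2 {b L K La G} (hb0 : 0 < b) (hb1 : b < 1) (hK : 1 ≤ K) (hL : 1 ≤ L) (hLa : 1 ≤ La)
    (hR : RHyp b L K G) {r d v0 : ℝ} {J M : ℕ} (hr : 0 < r) (hr2 : r ≤ 1 / 2)
    (hd1 : r / 4 / La ≤ d) (hd2 : d ≤ r / 4) (hdg : GE G K (3 * J) d) (hv : r ≤ v0)
    (hs : 2 ≤ r * (K * L)) (hM : 3 * J + 6 ≤ M)
    {W : Finset ℝ} (hW : Sep (r * (K * L)) W) (hWG : (W : Set ℝ) ⊆ G)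
    (hWB : ∀ q ∈ W, ∀ q' ∈ W, |q - q'| ≤ 2 * (v0 * (K * L))) :
    (W.card : ℝ) ≤ 16 * K ^ M * La * v0 ^ b * (r ^ b)⁻¹ := by
  have hd0 : 0 < d := lt_of_lt_of_le (by positivity) hd1
  have hv0 : 0 < v0 := by linarith
  have hKL : 0 < K * L := by positivity
  have habs : |d| = d := by rw [abs_of_pos hd0]
  have hcov : Cov G (K ^ (M - 4)) {x | ∃ p ∈ G, ∃ q ∈ W, ∃ v ∈ G, x = p + q + d * v} := by
    have c1 := CE.add hR (CE.add hR (cov_self K) (cov_self K)) hdg.cov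
    refine c1.mono (pow_le_pow_right₀ hK (by omega)) ?_
    rintro x ⟨p, hp, q, hq, v, hv, rfl⟩
    exact ⟨p + q, ⟨p, hp, q, hWG hq, rfl⟩, _, ⟨v, hv, rfl⟩, by ring⟩
  have hmain := core_count hb0 hb1 hK hL hLa hR (m := M - 4) hW hs (by
      have : r * (K * L) ≤ v0 * (K * L) := by gcongr
      have : 0 < v0 * (K * L) := by positivity
      linarith) hWB (by
      rw [habs]
      calc r * (K * L) / (4 * (K * L)) / La = (r / 4 / La) := by field_simp
        _ ≤ _ := hd1) (by
      rw [habs]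
      calc d ≤ r / 4 := hd2
        _ = _ := by field_simp) (by
      rw [habs]
      linarith) hcov
  have hM4 : M - 4 + 4 = M := by omega
  rw [hM4] at hmain
  refine hmain.trans ?_
  have e : 2 * (v0 * (K * L)) / (r * (K * L)) = 2 * (v0 * r⁻¹) := by field_simp
  rw [e, Real.mul_rpow (by norm_num) (by positivity), Real.mul_rpow (by positivity) (by positivity), Real.inv_rpow hr.le]
  have h6 : (2:ℝ) ^ b ≤ 2 := by
    calc (2:ℝ) ^ b ≤ 2 ^ (1:ℝ) := Real.rpow_le_rpow_of_exponent_le (by norm_num) hb1.le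
      _ = 2 := Real.rpow_one _
  calc 8 * K ^ M * La * (2 ^ b * (v0 ^ b * (r ^ b)⁻¹)) ≤ 8 * K ^ M * La * (2 * (v0 ^ b * (r ^ b)⁻¹)) := by gcongr
    _ = _ := by ring

set_option maxHeartbeats 2000000 in
lemma ring_core {b κ L K La r : ℝ} {G C : Set ℝ} {n J M : ℕ} (hb0 : 0 < b) (hb1 : b < 1) (hκ : 0 < κ)
    (hK : 1 ≤ K) (hL : 1 ≤ L) (hLa : 1 ≤ La) (hr : 0 < r) (hr2 : r ≤ 1 / 2)
    (hR : RHyp b L K G) (hC : CHyp κ L K G C)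
    (h1 : 3 * K ^ 2 < La ^ (κ / 2)) (h2 : ((La ^ (κ / 2))⁻¹) ^ J ≤ r / 4)
    (h3 : (La ^ (κ / 2))⁻¹ * (4 * 3 ^ n * K) ≤ 1) (h4 : r ≤ 1 / La) (h4' : 1 / L ≤ r)
    (h5 : K < r ^ (-κ)) (h6 : 2 * 3 ^ n * K / r ^ (n + 1) + 1 < (r ^ (-κ) / K) ^ (2 ^ n))
    (h7 : 2 ≤ r ^ (n + 4 ^ n) * r * (K * L)) (hM : 3 * (2 * mseq n + 1) + 3 * J + 7 ≤ M)
    (h8 : 4800 * K ^ (2 * M + 4) * La ^ 2 * r ^ (b * ((1 - b) / 2)) < 1) : False := by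
  classical
  have hLaL : La ≤ L := by
    have := h4'.trans h4
    rwa [one_div_le_one_div (by linarith) (by linarith)] at this
  have hKL : 0 < K * L := by positivity
  obtain ⟨d0, hd0, hd0y, hd0g⟩ := exists_small_d hκ hK hLa hLaL hR hC h1
  obtain ⟨j, hjJ, hj1, hj2⟩ := exists_pow_near (by linarith) hr hr2 hd0 hd0y h2
  have hdg : GE G K (3 * J) (d0 ^ j) := (hd0g.pow j).mono hK (by omega)
  have hd0p : 0 < d0 := lt_of_lt_of_le (by positivity) hd0
  -- initial set
  obtain ⟨S, hSC, hS, hScard⟩ := hC.many r h4' (by linarith)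
  have hstart : St G K r (La ^ (κ / 2))⁻¹ (r ^ (-κ) / K) 0 4 (S.image (fun c : ℝ => d0 * c)) d0 := by
    refine ⟨by simpa using h4.trans hd0, hd0y, ?_, ?_, ?_, ?_⟩
    · intro x hx y hy hxy
      rw [Finset.mem_image] at hx hy
      obtain ⟨x, hx, rfl⟩ := hx
      obtain ⟨y, hy, rfl⟩ := hy
      have := hS x hx y hy (fun h => hxy (by rw [h]))
      rw [← mul_sub, abs_mul, abs_of_pos hd0p, zero_add, pow_one, mul_comm]
      gcongr
    · intro x hx
      rw [Finset.mem_image] at hx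
      obtain ⟨x, hx, rfl⟩ := hx
      have := (hC.good x (hSC hx)).1
      rw [abs_mul, abs_of_pos hd0p, pow_zero, one_mul, mul_comm]
      gcongr
    · rw [Finset.card_image_of_injective _ (mul_right_injective₀ hd0p.ne'), pow_zero, pow_one,
        div_le_iff₀ (by linarith), mul_comm]
      exact hScard
    · intro x hx
      rw [Finset.mem_image] at hx
      obtain ⟨x, hx, rfl⟩ := hx
      have g1 : GE G K 1 x := by have := (hC.good x (hSC hx)).2; simpa [GE] using this
      exact hd0g.mul g1
  have hdense := dense_of_start hK hR hr hr2 h3 (by rw [lt_div_iff₀ (by linarith)]; linarith) h6 hstart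
  -- Ξ
  choose d1 d2 hD using (fun i : ℕ => fun (hi : 10 * r * i ≤ 1) => hdense (10 * r * i) (by positivity) hi)
  let ξ : ℕ → ℝ := fun i => if hi : 10 * r * i ≤ 1 then d2 i hi / d1 i hi else 0
  set I : ℕ := ⌊1 / (10 * r)⌋₊ + 1 with hI
  have hiI : ∀ i < I, 10 * r * i ≤ 1 := by
    intro i hi
    have h9 : i ≤ ⌊1 / (10 * r)⌋₊ := by omega
    have h10 : (i : ℝ) ≤ 1 / (10 * r) := (Nat.le_floor_iff (by positivity)).1 h9
    rw [le_div_iff₀ (by positivity)] at h10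
    linarith
  have hξ : ∀ i < I, |ξ i - 10 * r * i| ≤ 3 * r := by
    intro i hi
    simp only [ξ, dif_pos (hiI i hi)]
    exact (hD i (hiI i hi)).2.2.2.2.2
  have hξsep : ∀ i < I, ∀ i' < I, i ≠ i' → 4 * r ≤ |ξ i - ξ i'| := by
    intro i hi i' hi' hne
    have a1 := hξ i hi
    have a2 := hξ i' hi'
    have a3 : (1:ℝ) ≤ |(i:ℝ) - i'| := by
      have : (1:ℤ) ≤ |(i:ℤ) - i'| := Int.one_le_abs (by omega)
      exact_mod_cast this
    have a4 : 10 * r ≤ |10 * r * i - 10 * r * i'| := by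
      rw [← mul_sub, abs_mul, abs_of_pos (by positivity : 0 < 10 * r)]
      nlinarith
    have a5 : |10 * r * i - 10 * r * i'| ≤ |ξ i - ξ i'| + |ξ i - 10 * r * i| + |ξ i' - 10 * r * i'| := by
      have e : 10 * r * (i:ℝ) - 10 * r * i' = (ξ i - ξ i') - (ξ i - 10 * r * i) + (ξ i' - 10 * r * i') := by ring
      rw [e]
      exact (abs_add_le _ _).trans (by gcongr; exact abs_sub _ _)
    linarith
  set Ξ : Finset ℝ := (Finset.range I).image ξ with hΞ
  have hΞcard : Ξ.card = I := by
    rw [hΞ, Finset.card_image_of_injOn, Finset.card_range]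
    intro i hi i' hi' heq
    by_contra hne
    have := hξsep i (by simpa using hi) i' (by simpa using hi') hne
    rw [heq, sub_self, abs_zero] at this
    linarith
  have hΞsep : Sep (4 * r) Ξ := by
    intro x hx y hy hxy
    rw [hΞ, Finset.mem_image] at hx hy
    obtain ⟨i, hi, rfl⟩ := hx
    obtain ⟨i', hi', rfl⟩ := hy
    exact hξsep i (by simpa using hi) i' (by simpa using hi') (fun h => hxy (by rw [h]))
  have hIlow : 1 / (10 * r) ≤ (Ξ.card : ℝ) := by
    rw [hΞcard, hI]
    push_cast
    exact (Nat.lt_floor_add_one _).le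
  -- X
  have hsr : 2 ≤ r * (K * L) := by
    refine h7.trans ?_
    have : r ^ (n + 4 ^ n) ≤ 1 := pow_le_one₀ hr.le (by linarith)
    rw [mul_assoc]
    have h9 : 0 < r * (K * L) := by positivity
    nlinarith
  obtain ⟨X, hXG, hXs, hXc⟩ := hR.lower (r * (K * L)) (by linarith)
  set N : ℝ := (X.card : ℝ) with hN
  have hrb : 0 < r ^ b := by positivity
  have hNlow : (r ^ b)⁻¹ ≤ K ^ 2 * N := by
    have e : L / (r * (K * L)) = r⁻¹ * K⁻¹ := by field_simp
    rw [e, Real.mul_rpow (by positivity) (by positivity), Real.inv_rpow hr.le, Real.inv_rpow (by linarith)] at hXc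
    have hKb : K ^ b ≤ K := by
      calc K ^ b ≤ K ^ (1:ℝ) := Real.rpow_le_rpow_of_exponent_le hK hb1.le
        _ = K := Real.rpow_one _
    have hKb0 : 0 < K ^ b := by positivity
    calc (r ^ b)⁻¹ = (r ^ b)⁻¹ * (K ^ b)⁻¹ * K ^ b := by field_simp
      _ ≤ K * N * K := by gcongr
      _ = _ := by ring
  have hNpos : 0 < N := by
    have : 0 < (r ^ b)⁻¹ := by positivity
    by_contra h
    have : K ^ 2 * N ≤ 0 := by nlinarith [sq_nonneg K]
    linarith
  set v0 : ℝ := r ^ ((1 - b) / 2) with hv0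
  have hv0p : 0 < v0 := by positivity
  have hv01 : v0 ≤ 1 := Real.rpow_le_one hr.le (by linarith) (by linarith)
  have hrv : r ≤ v0 := by
    calc r = r ^ (1:ℝ) := (Real.rpow_one r).symm
      _ ≤ v0 := Real.rpow_le_rpow_of_exponent_ge hr (by linarith) (by linarith)
  have hmar := marstrand_count (X := X) (Ξ := Ξ) (H := K * L) (v0 := v0)
    (w := 48 * K ^ M * La * (r ^ b)⁻¹) (m' := 16 * K ^ M * La * v0 ^ b * (r ^ b)⁻¹) hr hKL hv0p hv01
    (by positivity) hXs hΞsep (by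
      intro x hx W hWs hWX
      rw [hΞ, Finset.mem_image] at hx
      obtain ⟨i, hi, rfl⟩ := hx
      have hi' := hiI i (by simpa using hi)
      obtain ⟨p1, p2, p3, p4, p5, p6⟩ := hD i hi'
      have hne : d1 i hi' ≠ 0 := by
        intro h0
        rw [h0, abs_zero] at p1
        have : 0 < r ^ (n + 4 ^ n) := by positivity
        linarith
      refine core_use1 hb0 hb1 hK hL hLa hR hr hr2 hj1 hj2 hdg p3 p4 hne p2 p5 ?_ hM hWs ?_
      · refine h7.trans ?_
        gcongr
      · intro z hz
        obtain ⟨x, hx, y, hy, rfl⟩ := hWX z hz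
        refine ⟨x, hXG hx, y, hXG hy, ?_⟩
        simp only [ξ, dif_pos hi']) (by
      intro y hy
      refine core_use2 hb0 hb1 hK hL hLa hR hr hr2 hj1 hj2 hdg hrv hsr (by omega)
        (hXs.subset (Finset.filter_subset _ _)) ?_ ?_
      · intro z hz
        rw [Finset.coe_filter] at hz
        exact hXG hz.1
      · intro q hq q' hq'
        rw [Finset.mem_filter] at hq hq'
        have a1 := abs_le.1 hq.2
        have a2 := abs_le.1 hq'.2
        rw [abs_le]
        constructor <;> linarith)
  rw [← hN] at hmar
  have hΞp : 0 < (Ξ.card : ℝ) := lt_of_lt_of_le (by positivity) hIlow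
  -- final contradiction
  have hv0b : v0 ^ b = r ^ (b * ((1 - b) / 2)) := by
    rw [hv0, ← Real.rpow_mul hr.le]; congr 1; ring
  set g : ℝ := r ^ (b * ((1 - b) / 2)) with hg
  have hg0 : 0 < g := by positivity
  have hrv2 : (r ^ b)⁻¹ * r / v0 ≤ g := by
    have e : (r ^ b)⁻¹ * r / v0 = r ^ ((1 - b) / 2) := by
      rw [← Real.rpow_neg hr.le, hv0, div_eq_mul_inv, ← Real.rpow_neg hr.le]
      nth_rewrite 2 [← Real.rpow_one r]
      rw [← Real.rpow_add hr, ← Real.rpow_add hr]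
      congr 1; ring
    rw [e, hg]
    apply Real.rpow_le_rpow_of_exponent_ge hr (by linarith)
    nlinarith
  have t1 : 48 * K ^ M * La * (r ^ b)⁻¹ * (5 * Ξ.card * N ^ 2 * (16 * K ^ M * La * v0 ^ b * (r ^ b)⁻¹)) ≤
      3840 * K ^ (2 * M + 4) * La ^ 2 * g * (Ξ.card * N ^ 4) := by
    have : (r ^ b)⁻¹ * (r ^ b)⁻¹ ≤ (K ^ 2 * N) * (K ^ 2 * N) := by gcongr
    calc _ = 3840 * K ^ (2 * M) * La ^ 2 * g * Ξ.card * N ^ 2 * ((r ^ b)⁻¹ * (r ^ b)⁻¹) := by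
            rw [hv0b]; ring
      _ ≤ 3840 * K ^ (2 * M) * La ^ 2 * g * Ξ.card * N ^ 2 * ((K ^ 2 * N) * (K ^ 2 * N)) := by gcongr
      _ = _ := by ring
  have t2 : 48 * K ^ M * La * (r ^ b)⁻¹ * (2 / v0 * N ^ 4) ≤
      960 * K ^ (2 * M + 4) * La ^ 2 * g * (Ξ.card * N ^ 4) := by
    have hone : 1 ≤ 10 * r * Ξ.card := by
      rw [div_le_iff₀ (by positivity)] at hIlow
      linarith
    have hKM : K ^ M ≤ K ^ (2 * M + 4) := pow_le_pow_right₀ hK (by omega)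
    have hLL : La ≤ La ^ 2 := by nlinarith
    calc _ = 96 * K ^ M * La * (r ^ b)⁻¹ / v0 * N ^ 4 * 1 := by ring
      _ ≤ 96 * K ^ M * La * (r ^ b)⁻¹ / v0 * N ^ 4 * (10 * r * Ξ.card) := by gcongr
      _ = 960 * K ^ M * La * ((r ^ b)⁻¹ * r / v0) * (Ξ.card * N ^ 4) := by ring
      _ ≤ 960 * K ^ (2 * M + 4) * La ^ 2 * g * (Ξ.card * N ^ 4) := by gcongr
  have t3 : (Ξ.card : ℝ) * N ^ 4 ≤ (4800 * K ^ (2 * M + 4) * La ^ 2 * g) * (Ξ.card * N ^ 4) := by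
    calc _ ≤ _ := hmar
      _ = _ := mul_add _ _ _
      _ ≤ _ := add_le_add t1 t2
      _ = _ := by ring
  have t4 : 0 < (Ξ.card : ℝ) * N ^ 4 := by positivity
  nlinarith

end BP

open MeasureTheory
open scoped ENNReal

namespace BP

lemma ev_rpow (c p q : ℝ) (h : p < q) : ∀ᶠ L : ℝ in Filter.atTop, c * L ^ p < L ^ q := by
  have h1 := (tendsto_rpow_atTop (show 0 < q - p by linarith)).eventually_gt_atTop c
  filter_upwards [h1, Filter.eventually_gt_atTop 0] with L h2 h3
  have e : L ^ q = L ^ (q - p) * L ^ p := by rw [← Real.rpow_add h3]; congr 1; ring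
  rw [e]
  have : 0 < L ^ p := by positivity
  gcongr

lemma exists_n_aux {κ : ℝ} (hκ : 0 < κ) : ∃ n : ℕ, (n:ℝ) + 5 ≤ 2 ^ n * κ := by
  have h1 : Filter.Tendsto (fun n : ℕ => (n:ℝ) ^ 1 / (2:ℝ) ^ n) Filter.atTop (nhds 0) :=
    tendsto_pow_const_div_const_pow_of_one_lt 1 (by norm_num)
  have h2 := (h1.eventually_lt_const (show (0:ℝ) < κ / 6 by positivity)).and (Filter.eventually_ge_atTop 1)
  obtain ⟨n, hn, hn1⟩ := h2.exists
  refine ⟨n, ?_⟩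
  rw [pow_one, div_lt_iff₀ (by positivity)] at hn
  have : (1:ℝ) ≤ n := by exact_mod_cast hn1
  linarith

theorem ring_thm {b κ : ℝ} (hb0 : 0 < b) (hb1 : b < 1) (hκ : 0 < κ) :
    ∃ ε : ℝ, 0 < ε ∧ ∃ L0 : ℝ, ∀ L : ℝ, L0 ≤ L → ∀ G C : Set ℝ, RHyp b L (L ^ ε) G →
      CHyp κ L (L ^ ε) G C → False := by
  obtain ⟨n, hn⟩ := exists_n_aux hκ
  set T : ℝ := (n:ℝ) + 4 ^ n + 3 with hT
  have hT3 : 3 ≤ T := by rw [hT]; have : (0:ℝ) ≤ n := by positivity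
                         have : (0:ℝ) ≤ 4 ^ n := by positivity
                         linarith
  obtain ⟨τ, hτ⟩ : ∃ τ : ℝ, τ = 1 / (2 * T) := ⟨_, rfl⟩
  have hτ0 : 0 < τ := by rw [hτ]; positivity
  have hτT : τ * T = 1 / 2 := by rw [hτ]; field_simp
  have hτ1 : τ ≤ 1 / 6 := by nlinarith
  obtain ⟨g, hg⟩ : ∃ g : ℝ, g = τ * (b * ((1 - b) / 2)) := ⟨_, rfl⟩
  have hb2 : 0 < b * ((1 - b) / 2) := by apply mul_pos hb0; linarith
  have hb3 : b * ((1 - b) / 2) ≤ 1 := by nlinarith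
  have hg0 : 0 < g := by rw [hg]; positivity
  have hgτ : g ≤ τ := by rw [hg]; nlinarith
  obtain ⟨a, ha⟩ : ∃ a : ℝ, a = g / 8 := ⟨_, rfl⟩
  have ha0 : 0 < a := by rw [ha]; positivity
  have haτ : a ≤ τ / 8 := by rw [ha]; linarith
  obtain ⟨J, hJ⟩ := exists_nat_gt (4 * τ / (a * κ))
  rw [div_lt_iff₀ (by positivity)] at hJ
  obtain ⟨M, hM⟩ : ∃ M : ℕ, M = 3 * (2 * mseq n + 1) + 3 * J + 7 := ⟨_, rfl⟩
  obtain ⟨ε, hε0, hε1, hε2, hε3⟩ : ∃ ε : ℝ, 0 < ε ∧ ε ≤ a * κ / 16 ∧ ε * (2 ^ n + 1) ≤ τ ∧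
      ε * (2 * M + 4) ≤ g / 8 := by
    refine ⟨min (a * κ / 16) (min (τ / (2 ^ n + 1)) (g / 8 / (2 * M + 4))), by positivity, min_le_left _ _, ?_, ?_⟩
    · rw [← le_div_iff₀ (by positivity)]
      exact (min_le_right _ _).trans (min_le_left _ _)
    · rw [← le_div_iff₀ (by positivity)]
      exact (min_le_right _ _).trans (min_le_right _ _)
  have haκ : 0 < a * κ := by positivity
  have hev := (Filter.eventually_gt_atTop (1:ℝ)).and <| (ev_rpow 3 (2 * ε) (a * κ / 2) (by linarith)).and <|
    (ev_rpow 4 τ (a * κ / 2 * J) (by nlinarith)).and <|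
    (ev_rpow (4 * 3 ^ n) ε (a * κ / 2) (by linarith)).and <|
    (ev_rpow 2 0 τ hτ0).and <|
    (ev_rpow (2 * 3 ^ n + 1) (ε + τ * (n + 1)) ((τ * κ - ε) * 2 ^ n) (by nlinarith)).and <|
    (ev_rpow 2 (τ * (n + 4 ^ n + 1)) (1 + ε) (by nlinarith)).and <|
    (ev_rpow 4800 (ε * (2 * M + 4) + 2 * a) g (by linarith))
  obtain ⟨L0, hL0⟩ := Filter.eventually_atTop.1 hev
  refine ⟨ε, hε0, L0, fun L hL G C hR hC => ?_⟩
  obtain ⟨hL1, e1, e2, e3, e4, e5, e6, e7⟩ := hL0 L hL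
  have hLp : 0 < L := by linarith
  have hpow : ∀ (x : ℝ) (k : ℕ), (L ^ x) ^ k = L ^ (x * k) := fun x k => by
    rw [← Real.rpow_natCast, ← Real.rpow_mul hLp.le]
  have hrp : ∀ x y : ℝ, (L ^ x) ^ y = L ^ (x * y) := fun x y => by rw [← Real.rpow_mul hLp.le]
  have hK1 : 1 ≤ L ^ ε := Real.one_le_rpow hL1.le hε0.le
  refine ring_core (n := n) (J := J) (M := M) (La := L ^ a) (r := L ^ (-τ)) hb0 hb1 hκ hK1 hL1.le
    (Real.one_le_rpow hL1.le ha0.le) (by positivity) ?_ hR hC ?_ ?_ ?_ ?_ ?_ ?_ ?_ ?_ hM.ge ?_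
  · rw [Real.rpow_neg hLp.le, one_div]
    rw [Real.rpow_zero, mul_one] at e4
    exact inv_anti₀ (by norm_num) e4.le
  · rw [hpow, hrp]
    have E1 : ε * ((2:ℕ):ℝ) = 2 * ε := by push_cast; ring
    have E2 : a * (κ / 2) = a * κ / 2 := by ring
    rw [E1, E2]; exact e1
  · have E2 : a * (κ / 2) = a * κ / 2 := by ring
    rw [hrp, inv_pow, hpow, E2, Real.rpow_neg hLp.le]
    rw [← one_div, div_le_div_iff₀ (by positivity) (by norm_num), one_mul, inv_mul_eq_div,
      le_div_iff₀ (by positivity)]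
    exact e2.le
  · have E2 : a * (κ / 2) = a * κ / 2 := by ring
    rw [hrp, E2, inv_mul_le_iff₀ (by positivity), mul_one]
    exact e3.le
  · rw [one_div, ← Real.rpow_neg hLp.le]
    exact Real.rpow_le_rpow_of_exponent_le hL1.le (by linarith)
  · rw [one_div]
    nth_rewrite 1 [← Real.rpow_one L]
    rw [← Real.rpow_neg hLp.le]
    exact Real.rpow_le_rpow_of_exponent_le hL1.le (by linarith)
  · rw [hrp]
    apply Real.rpow_lt_rpow_of_exponent_lt hL1
    nlinarith
  · rw [hrp, ← Real.rpow_sub hLp, hpow, hpow]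
    have E1 : (-τ * -κ - ε) * ((2 ^ n : ℕ) : ℝ) = (τ * κ - ε) * 2 ^ n := by push_cast; ring
    rw [E1]
    refine lt_of_le_of_lt ?_ e5
    have E2 : 2 * 3 ^ n * L ^ ε / L ^ (-τ * ((n + 1 : ℕ) : ℝ)) = 2 * 3 ^ n * L ^ (ε + τ * (n + 1)) := by
      rw [mul_div_assoc, ← Real.rpow_sub hLp]
      congr 2
      push_cast; ring
    rw [E2, add_mul, one_mul]
    gcongr
    exact Real.one_le_rpow hL1.le (by positivity)
  · rw [hpow]
    nth_rewrite 4 [← Real.rpow_one L]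
    rw [← Real.rpow_add hLp, ← Real.rpow_add hLp, ← Real.rpow_add hLp]
    have E : (1 + ε) = (-τ * ((n + 4 ^ n : ℕ) : ℝ) + -τ + (ε + 1)) + τ * (n + 4 ^ n + 1) := by
      push_cast; ring
    rw [E, Real.rpow_add hLp] at e6
    exact (lt_of_mul_lt_mul_right e6 (by positivity)).le
  · rw [hpow, hpow, hrp, mul_assoc 4800, ← Real.rpow_add hLp]
    have E1 : ε * ((2 * M + 4 : ℕ) : ℝ) + a * ((2 : ℕ) : ℝ) = ε * (2 * M + 4) + 2 * a := by
      push_cast; ring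
    have E2 : -τ * (b * ((1 - b) / 2)) = -g := by rw [hg]; ring
    rw [E1, E2, Real.rpow_neg hLp.le, ← div_eq_mul_inv, div_lt_one (by positivity)]
    exact e7

end BP

open MeasureTheory
open scoped ENNReal

namespace BP

section graph
variable {α β : Type*} [DecidableEq α] [DecidableEq β]

lemma card_eq_sum_rows (X : Finset α) (Y : Finset β) (G : Finset (α × β)) (hG : G ⊆ X ×ˢ Y) :
    (G.card : ℝ) = ∑ x ∈ X, ((Y.filter (fun y => (x, y) ∈ G)).card : ℝ) := by
  have e : G = (X ×ˢ Y).filter (fun p => p ∈ G) := by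
    ext p; simp only [Finset.mem_filter]; exact ⟨fun h => ⟨hG h, h⟩, fun h => h.2⟩
  conv_lhs => rw [e]
  rw [Finset.card_filter, Finset.sum_product]
  push_cast
  refine Finset.sum_congr rfl (fun x _ => ?_)
  rw [Finset.card_filter]
  push_cast
  rfl

lemma card_eq_sum_cols (X : Finset α) (Y : Finset β) (G : Finset (α × β)) (hG : G ⊆ X ×ˢ Y) :
    (G.card : ℝ) = ∑ y ∈ Y, ((X.filter (fun x => (x, y) ∈ G)).card : ℝ) := by
  have e : G = (X ×ˢ Y).filter (fun p => p ∈ G) := by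
    ext p; simp only [Finset.mem_filter]; exact ⟨fun h => ⟨hG h, h⟩, fun h => h.2⟩
  conv_lhs => rw [e]
  rw [Finset.card_filter, Finset.sum_product_right]
  push_cast
  refine Finset.sum_congr rfl (fun x _ => ?_)
  rw [Finset.card_filter]
  push_cast
  rfl

/-- the set of paths of length four from `x` to `x'`. -/
def paths (X : Finset α) (Y : Finset β) (G : Finset (α × β)) (x x' : α) : Finset (β × α × β) :=
  (Y ×ˢ X ×ˢ Y).filter (fun t => (x, t.1) ∈ G ∧ (t.2.1, t.1) ∈ G ∧ (t.2.1, t.2.2) ∈ G ∧ (x', t.2.2) ∈ G)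

set_option maxHeartbeats 1000000 in
/-- choose a vertex `y` whose neighbourhood is large with few bad pairs -/
lemma exists_good_nbhd (X : Finset α) (Y : Finset β) (G : Finset (α × β)) (hG : G ⊆ X ×ˢ Y) {n K : ℝ}
    (hn : 0 < n) (hK : 1 ≤ K) (hX : (X.card : ℝ) ≤ n) (hY : (Y.card : ℝ) ≤ n)
    (hGc : n ^ 2 / (2 * K) ≤ G.card) :
    ∃ U ⊆ X, n ^ 2 / (8 * K ^ 2) ≤ (U.card : ℝ) ^ 2 ∧
      (((U ×ˢ U).filter (fun p => ((Y.filter (fun y => (p.1, y) ∈ G ∧ (p.2, y) ∈ G)).card : ℝ) < n / (64 * K ^ 2))).card : ℝ)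
        ≤ (U.card : ℝ) ^ 2 / 8 := by
  classical
  let U : β → Finset α := fun y => X.filter (fun x => (x, y) ∈ G)
  let cd : α × α → ℝ := fun p => ((Y.filter (fun y => (p.1, y) ∈ G ∧ (p.2, y) ∈ G)).card : ℝ)
  let bad : β → ℝ := fun y => (((U y ×ˢ U y).filter (fun p => cd p < n / (64 * K ^ 2))).card : ℝ)
  have h1 : (G.card : ℝ) = ∑ y ∈ Y, ((U y).card : ℝ) := card_eq_sum_cols X Y G hG
  have h2 : (G.card : ℝ) ^ 2 ≤ n * ∑ y ∈ Y, ((U y).card : ℝ) ^ 2 := by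
    rw [h1]
    exact sq_sum_le_card_mul_sum_sq.trans
      (mul_le_mul_of_nonneg_right hY (Finset.sum_nonneg (fun _ _ => sq_nonneg _)))
  have h3 : ∑ y ∈ Y, bad y ≤ n ^ 3 / (64 * K ^ 2) := by
    have e : ∀ y ∈ Y, bad y = ∑ p ∈ (X ×ˢ X).filter (fun p => cd p < n / (64 * K ^ 2)),
        (if (p.1, y) ∈ G ∧ (p.2, y) ∈ G then (1:ℝ) else 0) := by
      intro y _
      simp only [bad]
      rw [← Finset.sum_filter, Finset.sum_const, nsmul_eq_mul, mul_one]
      congr 2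
      ext p
      simp only [U, Finset.mem_filter, Finset.mem_product]
      tauto
    rw [Finset.sum_congr rfl e, Finset.sum_comm]
    have h4 : ∀ p ∈ (X ×ˢ X).filter (fun p => cd p < n / (64 * K ^ 2)),
        ∑ y ∈ Y, (if (p.1, y) ∈ G ∧ (p.2, y) ∈ G then (1:ℝ) else 0) ≤ n / (64 * K ^ 2) := by
      intro p hp
      rw [← Finset.sum_filter, Finset.sum_const, nsmul_eq_mul, mul_one]
      exact (Finset.mem_filter.1 hp).2.le
    calc _ ≤ ∑ p ∈ (X ×ˢ X).filter (fun p => cd p < n / (64 * K ^ 2)), n / (64 * K ^ 2) := Finset.sum_le_sum h4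
      _ = (((X ×ˢ X).filter (fun p => cd p < n / (64 * K ^ 2))).card : ℝ) * (n / (64 * K ^ 2)) := by simp
      _ ≤ (n * n) * (n / (64 * K ^ 2)) := by
          gcongr
          calc (((X ×ˢ X).filter (fun p => cd p < n / (64 * K ^ 2))).card : ℝ) ≤ ((X ×ˢ X).card : ℝ) := by
                exact_mod_cast Finset.card_filter_le _ _
            _ = (X.card : ℝ) * X.card := by rw [Finset.card_product]; push_cast; rfl
            _ ≤ n * n := by gcongr
      _ = _ := by ring
  have h5 : n ^ 3 / (8 * K ^ 2) ≤ ∑ y ∈ Y, (((U y).card : ℝ) ^ 2 - 8 * bad y) := by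
    rw [Finset.sum_sub_distrib, ← Finset.mul_sum]
    have h6 : n ^ 3 / (4 * K ^ 2) ≤ ∑ y ∈ Y, ((U y).card : ℝ) ^ 2 := by
      have : (n ^ 2 / (2 * K)) ^ 2 ≤ n * ∑ y ∈ Y, ((U y).card : ℝ) ^ 2 := by
        refine le_trans ?_ h2
        gcongr
      have e : (n ^ 2 / (2 * K)) ^ 2 = n * (n ^ 3 / (4 * K ^ 2)) := by field_simp; ring
      rw [e] at this
      exact le_of_mul_le_mul_left this hn
    have e2 : n ^ 3 / (8 * K ^ 2) = n ^ 3 / (4 * K ^ 2) - 8 * (n ^ 3 / (64 * K ^ 2)) := by field_simp; ring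
    rw [e2]
    linarith
  have h7 : ∃ y ∈ Y, n ^ 2 / (8 * K ^ 2) ≤ ((U y).card : ℝ) ^ 2 - 8 * bad y := by
    by_contra hcon
    push Not at hcon
    rcases Finset.eq_empty_or_nonempty Y with hY0 | hY0
    · rw [hY0, Finset.sum_empty] at h5
      have : 0 < n ^ 3 / (8 * K ^ 2) := by positivity
      linarith
    · have := Finset.sum_lt_sum_of_nonempty hY0 hcon
      rw [Finset.sum_const, nsmul_eq_mul] at this
      have h8 : (Y.card : ℝ) * (n ^ 2 / (8 * K ^ 2)) ≤ n * (n ^ 2 / (8 * K ^ 2)) := by gcongr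
      have e : n * (n ^ 2 / (8 * K ^ 2)) = n ^ 3 / (8 * K ^ 2) := by ring
      linarith
  obtain ⟨y, hy, h8⟩ := h7
  have hb0 : 0 ≤ bad y := by simp only [bad]; positivity
  refine ⟨U y, Finset.filter_subset _ _, by linarith, ?_⟩
  have h9 : 0 < n ^ 2 / (8 * K ^ 2) := by positivity
  have : bad y ≤ ((U y).card : ℝ) ^ 2 / 8 := by linarith
  exact this

lemma bsg_graph (X : Finset α) (Y : Finset β) (G : Finset (α × β)) (hG : G ⊆ X ×ˢ Y) {n K : ℝ}
    (hn : 0 < n) (hK : 1 ≤ K) (hX : (X.card : ℝ) ≤ n) (hY : (Y.card : ℝ) ≤ n)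
    (hGc : n ^ 2 / K ≤ G.card) :
    ∃ X' ⊆ X, n ^ 2 / (2 ^ 15 * K ^ 5) ≤ ((G.filter (fun p => p.1 ∈ X')).card : ℝ) ∧
      ∀ x ∈ X', ∀ x' ∈ X', n ^ 3 / (2 ^ 15 * K ^ 5) ≤ ((paths X Y G x x').card : ℝ) := by
  classical
  have hKp : 0 < K := by linarith
  let deg : α → ℝ := fun x => ((Y.filter (fun y => (x, y) ∈ G)).card : ℝ)
  set X1 := X.filter (fun x => n / (2 * K) ≤ deg x) with hX1
  set G1 := G.filter (fun p => p.1 ∈ X1) with hG1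
  have hG1G : G1 ⊆ G := Finset.filter_subset _ _
  have hG1s : G1 ⊆ X1 ×ˢ Y := by
    intro p hp
    rw [hG1, Finset.mem_filter] at hp
    have := hG hp.1
    rw [Finset.mem_product] at this ⊢
    exact ⟨hp.2, this.2⟩
  have hdeg1 : ∀ x ∈ X1, (Y.filter (fun y => (x, y) ∈ G1)) = (Y.filter (fun y => (x, y) ∈ G)) := by
    intro x hx
    ext y
    simp only [hG1, Finset.mem_filter]
    tauto
  have hG1c : n ^ 2 / (2 * K) ≤ G1.card := by
    have e1 := card_eq_sum_rows X Y G hG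
    have e2 := card_eq_sum_rows X1 Y G1 hG1s
    rw [Finset.sum_congr rfl (fun x hx => by rw [hdeg1 x hx])] at e2
    have e3 : (G.card : ℝ) = G1.card + ∑ x ∈ X.filter (fun x => ¬ n / (2 * K) ≤ deg x), deg x := by
      rw [e1, e2, hX1]
      exact (Finset.sum_filter_add_sum_filter_not X _ _).symm
    have e4 : ∑ x ∈ X.filter (fun x => ¬ n / (2 * K) ≤ deg x), deg x ≤ n * (n / (2 * K)) := by
      calc _ ≤ ∑ x ∈ X.filter (fun x => ¬ n / (2 * K) ≤ deg x), n / (2 * K) := by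
            apply Finset.sum_le_sum
            intro x hx
            rw [Finset.mem_filter, not_le] at hx
            exact hx.2.le
        _ = ((X.filter (fun x => ¬ n / (2 * K) ≤ deg x)).card : ℝ) * (n / (2 * K)) := by simp
        _ ≤ n * (n / (2 * K)) := by
            gcongr
            exact le_trans (by exact_mod_cast Finset.card_filter_le _ _) hX
    have e5 : n ^ 2 / K = n ^ 2 / (2 * K) + n * (n / (2 * K)) := by field_simp; ring
    linarith
  have hX1c : (X1.card : ℝ) ≤ n := le_trans (by exact_mod_cast Finset.card_filter_le _ _) hX
  obtain ⟨U, hU, hUc, hUb⟩ := exists_good_nbhd X1 Y G1 hG1s hn hK hX1c hY hG1c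
  set isbad : α → α → Prop := fun x x' => ((Y.filter (fun y => (x, y) ∈ G1 ∧ (x', y) ∈ G1)).card : ℝ) < n / (64 * K ^ 2) with hbad
  have hUlow : n / (3 * K) ≤ U.card := by
    have h1 : (n / (3 * K)) ^ 2 ≤ (U.card : ℝ) ^ 2 := by
      refine le_trans ?_ hUc
      rw [div_pow]
      gcongr
      nlinarith
    exact (abs_le_of_sq_le_sq' h1 (by positivity)).2
  have hUpos : 0 < (U.card : ℝ) := lt_of_lt_of_le (by positivity) hUlow
  set X' := U.filter (fun x => ((U.filter (fun x' => isbad x x')).card : ℝ) ≤ U.card / 4) with hX'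
  have hX'low : (U.card : ℝ) / 2 ≤ X'.card := by
    have e1 : (((U ×ˢ U).filter (fun p => isbad p.1 p.2)).card : ℝ) = ∑ x ∈ U, ((U.filter (fun x' => isbad x x')).card : ℝ) := by
      rw [Finset.card_filter, Finset.sum_product]
      push_cast
      refine Finset.sum_congr rfl (fun x _ => ?_)
      rw [Finset.card_filter]
      push_cast
      rfl
    have e2 : ((U.filter (fun x => ¬ ((U.filter (fun x' => isbad x x')).card : ℝ) ≤ U.card / 4)).card : ℝ) * (U.card / 4) ≤ (U.card : ℝ) ^ 2 / 8 := by
      calc _ = ∑ x ∈ U.filter (fun x => ¬ ((U.filter (fun x' => isbad x x')).card : ℝ) ≤ U.card / 4), (U.card : ℝ) / 4 := by simp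
        _ ≤ ∑ x ∈ U.filter (fun x => ¬ ((U.filter (fun x' => isbad x x')).card : ℝ) ≤ U.card / 4), ((U.filter (fun x' => isbad x x')).card : ℝ) := by
            apply Finset.sum_le_sum
            intro x hx
            rw [Finset.mem_filter, not_le] at hx
            exact hx.2.le
        _ ≤ ∑ x ∈ U, ((U.filter (fun x' => isbad x x')).card : ℝ) :=
            Finset.sum_le_sum_of_subset_of_nonneg (Finset.filter_subset _ _) (fun _ _ _ => by positivity)
        _ ≤ _ := by rw [← e1]; exact hUb
    have e3 : ((U.filter (fun x => ¬ ((U.filter (fun x' => isbad x x')).card : ℝ) ≤ U.card / 4)).card : ℝ) ≤ U.card / 2 := by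
      have : (U.card : ℝ) ^ 2 / 8 = (U.card / 2) * (U.card / 4) := by ring
      rw [this] at e2
      exact le_of_mul_le_mul_right e2 (by positivity)
    have e4 : (X'.card : ℝ) + ((U.filter (fun x => ¬ ((U.filter (fun x' => isbad x x')).card : ℝ) ≤ U.card / 4)).card : ℝ) = U.card := by
      rw [hX']
      exact_mod_cast Finset.card_filter_add_card_filter_not (s := U) (fun x => ((U.filter (fun x' => isbad x x')).card : ℝ) ≤ U.card / 4)
    linarith
  have hX'U : X' ⊆ U := Finset.filter_subset _ _
  have hX'X : X' ⊆ X := (hX'U.trans hU).trans (Finset.filter_subset _ _)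
  have hK5 : 12 * K ^ 2 ≤ 2 ^ 15 * K ^ 5 := by
    have : K ^ 2 ≤ K ^ 5 := pow_le_pow_right₀ hK (by norm_num)
    have : 0 < K ^ 5 := by positivity
    nlinarith
  refine ⟨X', hX'X, ?_, ?_⟩
  · have e1 := card_eq_sum_rows X' Y (G.filter (fun p => p.1 ∈ X')) (by
      intro p hp
      rw [Finset.mem_filter] at hp
      have := hG hp.1
      rw [Finset.mem_product] at this ⊢
      exact ⟨hp.2, this.2⟩)
    rw [e1]
    calc n ^ 2 / (2 ^ 15 * K ^ 5) ≤ n ^ 2 / (12 * K ^ 2) := by gcongr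
      _ = (n / (3 * K) / 2) * (n / (2 * K)) := by field_simp; norm_num
      _ ≤ (X'.card : ℝ) * (n / (2 * K)) := by gcongr; linarith
      _ = ∑ x ∈ X', n / (2 * K) := by simp
      _ ≤ _ := by
        apply Finset.sum_le_sum
        intro x hx
        have h1 := (Finset.mem_filter.1 (hU (hX'U hx))).2
        refine h1.trans (le_of_eq ?_)
        simp only [deg]
        congr 2
        ext y
        simp only [Finset.mem_filter]
        tauto
  · intro x hx x' hx'
    set V := U.filter (fun z => ¬ isbad x z ∧ ¬ isbad x' z) with hV
    have hVlow : (U.card : ℝ) / 2 ≤ V.card := by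
      have h1 := (Finset.mem_filter.1 hx).2
      have h2 := (Finset.mem_filter.1 hx').2
      have h3 : U ⊆ V ∪ (U.filter (fun z => isbad x z) ∪ U.filter (fun z => isbad x' z)) := by
        intro z hz
        simp only [hV, Finset.mem_union, Finset.mem_filter]
        tauto
      have h4 : (U.card : ℝ) ≤ V.card + ((U.filter (fun z => isbad x z)).card + (U.filter (fun z => isbad x' z)).card) := by
        have := (Finset.card_le_card h3).trans ((Finset.card_union_le _ _).trans (Nat.add_le_add_left (Finset.card_union_le _ _) _))
        exact_mod_cast this
      linarith
    -- sub-family of paths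
    let N : α → α → Finset β := fun x z => Y.filter (fun y => (x, y) ∈ G1 ∧ (z, y) ∈ G1)
    have hsub : (V.sigma (fun z => N x z ×ˢ N x' z)).image (fun t => ((t.2.1, t.1, t.2.2) : β × α × β)) ⊆ paths X Y G x x' := by
      intro t ht
      rw [Finset.mem_image] at ht
      obtain ⟨⟨z, y1, y2⟩, h, rfl⟩ := ht
      simp only [Finset.mem_sigma, Finset.mem_product, N, Finset.mem_filter] at h
      obtain ⟨hz, ⟨hy1, ha, hb⟩, hy2, hc, hd⟩ := h
      have hzX : z ∈ X := (Finset.filter_subset _ _) (hU (Finset.mem_of_mem_filter z hz))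
      simp only [paths, Finset.mem_filter, Finset.mem_product]
      exact ⟨⟨hy1, hzX, hy2⟩, hG1G ha, hG1G hb, hG1G hd, hG1G hc⟩
    have hcard : ((V.sigma (fun z => N x z ×ˢ N x' z)).card : ℝ) ≤ (paths X Y G x x').card := by
      rw [← Finset.card_image_of_injective (V.sigma (fun z => N x z ×ˢ N x' z)) (f := fun t => ((t.2.1, t.1, t.2.2) : β × α × β))]
      · exact_mod_cast Finset.card_le_card hsub
      · rintro ⟨z, y1, y2⟩ ⟨z', y1', y2'⟩ h
        simp only [Prod.mk.injEq] at h
        obtain ⟨rfl, rfl, rfl⟩ := h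
        rfl
    refine le_trans ?_ hcard
    rw [Finset.card_sigma]
    push_cast
    have hK6 : 6 * (64 : ℝ) ^ 2 * K ^ 5 ≤ 2 ^ 15 * K ^ 5 := by
      have : 0 < K ^ 5 := by positivity
      nlinarith
    calc n ^ 3 / (2 ^ 15 * K ^ 5) ≤ n ^ 3 / (6 * 64 ^ 2 * K ^ 5) := by gcongr
      _ = (n / (3 * K) / 2) * ((n / (64 * K ^ 2)) * (n / (64 * K ^ 2))) := by field_simp; norm_num
      _ ≤ (V.card : ℝ) * ((n / (64 * K ^ 2)) * (n / (64 * K ^ 2))) := by gcongr; linarith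
      _ = ∑ z ∈ V, (n / (64 * K ^ 2)) * (n / (64 * K ^ 2)) := by simp
      _ ≤ _ := by
        apply Finset.sum_le_sum
        intro z hz
        obtain ⟨_, h1, h2⟩ := Finset.mem_filter.1 hz
        simp only [isbad, not_lt] at h1 h2
        rw [Finset.card_product]
        push_cast
        gcongr
end graph

end BP

open MeasureTheory
open scoped ENNReal Pointwise

namespace BP

/-- discretised linear form -/
noncomputable def fl (p q : ℝ) (x y : ℤ) : ℤ := ⌊p * x + q * y⌋

lemma fl_inj_right {p q : ℝ} (hq : 1 ≤ |q|) {x y y' : ℤ} (h : fl p q x y = fl p q x y') : y = y' := by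
  have h1 := Int.abs_sub_lt_one_of_floor_eq_floor h
  have e : p * x + q * y - (p * x + q * y') = q * ((y - y' : ℤ) : ℝ) := by push_cast; ring
  rw [e, abs_mul] at h1
  by_contra hne
  have h2 : (1:ℝ) ≤ |((y - y' : ℤ) : ℝ)| := by
    have : (1:ℤ) ≤ |y - y'| := Int.one_le_abs (by omega)
    exact_mod_cast this
  nlinarith

lemma fl_inj_left {p q : ℝ} (hp : 1 ≤ |p|) {x x' y : ℤ} (h : fl p q x y = fl p q x' y) : x = x' := by
  have h1 := Int.abs_sub_lt_one_of_floor_eq_floor h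
  have e : p * x + q * y - (p * x' + q * y) = p * ((x - x' : ℤ) : ℝ) := by push_cast; ring
  rw [e, abs_mul] at h1
  by_contra hne
  have h2 : (1:ℝ) ≤ |((x - x' : ℤ) : ℝ)| := by
    have : (1:ℤ) ≤ |x - x'| := Int.one_le_abs (by omega)
    exact_mod_cast this
  nlinarith

lemma bsg_one (X Y : Finset ℤ) (G : Finset (ℤ × ℤ)) (hG : G ⊆ X ×ˢ Y) {n K p q : ℝ}
    (hn : 0 < n) (hK : 1 ≤ K) (hX : (X.card : ℝ) ≤ n) (hY : (Y.card : ℝ) ≤ n)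
    (hGc : n ^ 2 / K ≤ G.card) (hp : 1 ≤ |p|) (hq : 1 ≤ |q|)
    (hf : ((G.image (fun t => fl p q t.1 t.2)).card : ℝ) ≤ K * n) :
    ∃ X' ⊆ X, n ^ 2 / (2 ^ 18 * K ^ 9) ≤ ((G.filter (fun p => p.1 ∈ X')).card : ℝ) ∧
      ((X' - X').card : ℝ) ≤ 2 ^ 18 * K ^ 9 * n := by
  classical
  obtain ⟨X', hX', hc, hpaths⟩ := bsg_graph X Y G hG hn hK hX hY hGc
  have hKp : 0 < K := by linarith
  refine ⟨X', hX', le_trans ?_ hc, ?_⟩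
  · gcongr
    · norm_num
    · norm_num
    · norm_num
  · -- representatives
    have hrep : ∀ δ : ℤ, ∃ x x' : ℤ, δ ∈ X' - X' → (x ∈ X' ∧ x' ∈ X' ∧ x - x' = δ) := by
      intro δ
      by_cases h : δ ∈ X' - X'
      · obtain ⟨x, hx, x', hx', h2⟩ := Finset.mem_sub.1 h
        exact ⟨x, x', fun _ => ⟨hx, hx', h2⟩⟩
      · exact ⟨0, 0, fun h' => absurd h' h⟩
    choose a a' ha using hrep
    set F := G.image (fun t => fl p q t.1 t.2) with hF
    let S := (X' - X').sigma (fun δ => paths X Y G (a δ) (a' δ))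
    let s1 : (Σ _ : ℤ, ℤ × ℤ × ℤ) → ℤ := fun t => fl p q (a t.1) t.2.1
    let s2 : (Σ _ : ℤ, ℤ × ℤ × ℤ) → ℤ := fun t => fl p q t.2.2.1 t.2.1
    let s3 : (Σ _ : ℤ, ℤ × ℤ × ℤ) → ℤ := fun t => fl p q t.2.2.1 t.2.2.2
    let s4 : (Σ _ : ℤ, ℤ × ℤ × ℤ) → ℤ := fun t => fl p q (a' t.1) t.2.2.2
    let off : (Σ _ : ℤ, ℤ × ℤ × ℤ) → ℤ := fun t =>
      t.1 - ⌊((s1 t - s2 t + s3 t - s4 t : ℤ) : ℝ) / p⌋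
    let Φ : (Σ _ : ℤ, ℤ × ℤ × ℤ) → ℤ × ℤ × ℤ × ℤ × ℤ := fun t => (s1 t, s2 t, s3 t, s4 t, off t)
    have hmap : Set.MapsTo Φ S ((F ×ˢ F ×ˢ F ×ˢ F ×ˢ Finset.Icc (-3:ℤ) 3 : Finset _) : Set (ℤ × ℤ × ℤ × ℤ × ℤ)) := by
      rintro ⟨δ, y1, z, y2⟩ ht
      simp only [S, Finset.coe_sigma, Set.mem_sigma_iff, Finset.mem_coe] at ht
      obtain ⟨hδ, ht⟩ := ht
      obtain ⟨h1, h2, h3⟩ := ha δ hδ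
      simp only [paths, Finset.mem_filter, Finset.mem_product] at ht
      obtain ⟨-, g1, g2, g3, g4⟩ := ht
      simp only [Φ, Finset.coe_product, Set.mem_prod, Finset.mem_coe]
      refine ⟨Finset.mem_image_of_mem (fun t : ℤ × ℤ => fl p q t.1 t.2) g1,
        Finset.mem_image_of_mem (fun t : ℤ × ℤ => fl p q t.1 t.2) g2,
        Finset.mem_image_of_mem (fun t : ℤ × ℤ => fl p q t.1 t.2) g3,
        Finset.mem_image_of_mem (fun t : ℤ × ℤ => fl p q t.1 t.2) g4, ?_⟩
      simp only [off, s1, s2, s3, s4]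
      set A1 := fl p q (a δ) y1 with hA1
      set A2 := fl p q z y1 with hA2
      set A3 := fl p q z y2 with hA3
      set A4 := fl p q (a' δ) y2 with hA4
      have b1 := Int.floor_le (p * (a δ) + q * y1)
      have b1' := Int.lt_floor_add_one (p * (a δ) + q * y1)
      have b2 := Int.floor_le (p * z + q * y1)
      have b2' := Int.lt_floor_add_one (p * z + q * y1)
      have b3 := Int.floor_le (p * z + q * y2)
      have b3' := Int.lt_floor_add_one (p * z + q * y2)
      have b4 := Int.floor_le (p * (a' δ) + q * y2)
      have b4' := Int.lt_floor_add_one (p * (a' δ) + q * y2)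
      change (A1:ℝ) ≤ _ at b1
      change _ < (A1:ℝ) + 1 at b1'
      change (A2:ℝ) ≤ _ at b2
      change _ < (A2:ℝ) + 1 at b2'
      change (A3:ℝ) ≤ _ at b3
      change _ < (A3:ℝ) + 1 at b3'
      change (A4:ℝ) ≤ _ at b4
      change _ < (A4:ℝ) + 1 at b4'
      set w : ℝ := ((A1 - A2 + A3 - A4 : ℤ) : ℝ) with hw
      have hwe : w = (A1:ℝ) - A2 + A3 - A4 := by rw [hw]; push_cast; ring
      have hδe : (δ:ℝ) = a δ - a' δ := by rw [← h3]; push_cast; simp only [h3]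
      have hpd : |p * δ - w| < 2 := by
        rw [hwe, hδe, abs_lt]
        constructor <;> linarith
      have hp0 : p ≠ 0 := by rintro rfl; simp at hp; linarith
      have hdw : |(δ:ℝ) - w / p| < 2 := by
        have e : (δ:ℝ) - w / p = (p * δ - w) / p := by field_simp
        rw [e, abs_div, div_lt_iff₀ (by linarith)]
        linarith
      have c1 := Int.floor_le (w / p)
      have c2 := Int.lt_floor_add_one (w / p)
      rw [abs_lt] at hdw
      simp only [Finset.mem_Icc]
      constructor
      · have : (-3:ℝ) < ((δ - ⌊w / p⌋ : ℤ) : ℝ) := by push_cast; linarith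
        have h9 : (-3:ℤ) < δ - ⌊w / p⌋ := by exact_mod_cast this
        omega
      · have : ((δ - ⌊w / p⌋ : ℤ) : ℝ) < 3 := by push_cast; linarith
        have h9 : δ - ⌊w / p⌋ < 3 := by exact_mod_cast this
        omega
    have hinj : Set.InjOn Φ S := by
      rintro ⟨δ, y1, z, y2⟩ ht ⟨δ', y1', z', y2'⟩ ht' heq
      simp only [Φ, Prod.mk.injEq, off] at heq
      obtain ⟨e1, e2, e3, e4, e5⟩ := heq
      rw [e1, e2, e3, e4] at e5
      have hδ : δ = δ' := by
        simpa using e5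
      subst hδ
      simp only [s1, s2, s3, s4] at e1 e2 e3 e4
      have hy1 := fl_inj_right hq e1
      subst hy1
      have hz := fl_inj_left hp e2
      subst hz
      have hy2 := fl_inj_right hq e3
      subst hy2
      rfl
    have hcard := Finset.card_le_card_of_injOn Φ hmap hinj
    have h1 : (S.card : ℝ) ≤ (K * n) ^ 4 * 7 := by
      simp only [Finset.card_product, Int.card_Icc] at hcard
      have h2 : (S.card : ℝ) ≤ F.card * (F.card * (F.card * (F.card * 7))) := by
        have e7 : ((3:ℤ) + 1 - -3).toNat = 7 := by rfl
        rw [e7] at hcard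
        exact_mod_cast hcard
      refine h2.trans ?_
      have : (F.card : ℝ) * (F.card * (F.card * (F.card * 7))) = (F.card : ℝ) ^ 4 * 7 := by ring
      rw [this]
      gcongr
    have h2 : ((X' - X').card : ℝ) * (n ^ 3 / (2 ^ 15 * K ^ 5)) ≤ S.card := by
      simp only [S]
      rw [Finset.card_sigma]
      push_cast
      calc ((X' - X').card : ℝ) * (n ^ 3 / (2 ^ 15 * K ^ 5)) = ∑ δ ∈ X' - X', n ^ 3 / (2 ^ 15 * K ^ 5) := by simp
        _ ≤ _ := by
          apply Finset.sum_le_sum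
          intro δ hδ
          obtain ⟨h1, h2, h3⟩ := ha δ hδ
          exact hpaths _ h1 _ h2
    have h3 : ((X' - X').card : ℝ) * (n ^ 3 / (2 ^ 15 * K ^ 5)) ≤ (7 * 2 ^ 15 * K ^ 9 * n) * (n ^ 3 / (2 ^ 15 * K ^ 5)) := by
      refine (h2.trans h1).trans (le_of_eq ?_)
      field_simp
    have h4 := le_of_mul_le_mul_right h3 (by positivity)
    refine h4.trans ?_
    gcongr
    norm_num

lemma bsg_two (X Y : Finset ℤ) (G : Finset (ℤ × ℤ)) (hG : G ⊆ X ×ˢ Y) {n K p q : ℝ}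
    (hn : 0 < n) (hK : 1 ≤ K) (hX : (X.card : ℝ) ≤ n) (hY : (Y.card : ℝ) ≤ n)
    (hGc : n ^ 2 / K ≤ G.card) (hp : 1 ≤ |p|) (hq : 1 ≤ |q|)
    (hf : ((G.image (fun t => fl p q t.1 t.2)).card : ℝ) ≤ K * n) :
    ∃ X' ⊆ X, ∃ Y' ⊆ Y, n ^ 2 / (2 ^ 180 * K ^ 81) ≤ ((G.filter (fun p => p.1 ∈ X' ∧ p.2 ∈ Y')).card : ℝ) ∧
      ((X' - X').card : ℝ) ≤ 2 ^ 180 * K ^ 81 * n ∧ ((Y' - Y').card : ℝ) ≤ 2 ^ 180 * K ^ 81 * n := by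
  classical
  have hKp : 0 < K := by linarith
  set K2 : ℝ := 2 ^ 18 * K ^ 9 with hK2
  have hKK2 : K ≤ K2 := by
    have : K ≤ K ^ 9 := le_self_pow₀ hK (by norm_num)
    rw [hK2]
    have : 0 < K ^ 9 := by positivity
    nlinarith
  have hK21 : 1 ≤ K2 := hK.trans hKK2
  have hswap : ∀ H : Finset (ℤ × ℤ), (H.image Prod.swap).card = H.card := fun H =>
    Finset.card_image_of_injective _ Prod.swap_injective
  have hK3 : 2 ^ 18 * K2 ^ 9 = 2 ^ 180 * K ^ 81 := by rw [hK2]; ring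
  have hK23 : K2 ≤ 2 ^ 180 * K ^ 81 := by
    rw [← hK3]
    have : K2 ≤ K2 ^ 9 := le_self_pow₀ hK21 (by norm_num)
    have : 0 < K2 ^ 9 := by positivity
    nlinarith
  obtain ⟨Y', hY', hc1, hd1⟩ := bsg_one Y X (G.image Prod.swap) (by
      intro t ht
      rw [Finset.mem_image] at ht
      obtain ⟨s, hs, rfl⟩ := ht
      have := hG hs
      rw [Finset.mem_product] at this ⊢
      exact ⟨this.2, this.1⟩) hn hK hY hX (by rw [hswap]; exact hGc) hq hp (by
      refine le_trans (le_of_eq ?_) hf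
      congr 2
      rw [Finset.image_image]
      apply Finset.image_congr
      intro t _
      simp only [Function.comp, Prod.swap, fl]
      congr 1; ring)
  have hc1' : n ^ 2 / K2 ≤ ((G.filter (fun t => t.2 ∈ Y')).card : ℝ) := by
    refine hc1.trans (le_of_eq ?_)
    rw [← hswap (G.filter (fun t => t.2 ∈ Y'))]
    congr 2
    ext t
    simp only [Finset.mem_filter, Finset.mem_image]
    constructor
    · rintro ⟨⟨s, hs, rfl⟩, h2⟩
      exact ⟨s, ⟨hs, h2⟩, rfl⟩
    · rintro ⟨s, ⟨hs, h2⟩, rfl⟩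
      exact ⟨⟨s, hs, rfl⟩, h2⟩
  obtain ⟨X', hX', hc2, hd2⟩ := bsg_one X Y (G.filter (fun t => t.2 ∈ Y')) ((Finset.filter_subset _ _).trans hG)
    hn hK21 hX hY hc1' hp hq (by
      calc _ ≤ ((G.image (fun t => fl p q t.1 t.2)).card : ℝ) := by
            exact_mod_cast Finset.card_le_card (Finset.image_subset_image (Finset.filter_subset _ _))
        _ ≤ K * n := hf
        _ ≤ K2 * n := by gcongr)
  rw [hK3] at hc2 hd2
  refine ⟨X', hX', Y', hY', ?_, hd2, hd1.trans (by gcongr)⟩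
  refine hc2.trans (le_of_eq ?_)
  rw [Finset.filter_filter]
  congr 2
  ext t
  simp only [Finset.mem_filter]
  tauto

/-- Ruzsa-type triangle inequality for the form `fl`. -/
lemma fl_triangle (X0 Y0 : Finset ℤ) {p q N : ℝ} (hp : 1 ≤ |p|) (P : Finset (ℤ × ℤ))
    (hP : P ⊆ X0 ×ˢ Y0) (s : ℤ) (hs : ∀ t ∈ P, fl p q t.1 t.2 = s) (hN : N ≤ P.card) :
    (((X0 ×ˢ Y0).image (fun t => fl p q t.1 t.2)).card : ℝ) * N ≤
      3 * (X0 - X0).card * (Y0 - Y0).card := by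
  classical
  set F := (X0 ×ˢ Y0).image (fun t => fl p q t.1 t.2) with hF
  have hrep : ∀ v : ℤ, ∃ t : ℤ × ℤ, v ∈ F → (t ∈ X0 ×ˢ Y0 ∧ fl p q t.1 t.2 = v) := by
    intro v
    by_cases h : v ∈ F
    · obtain ⟨t, ht, h2⟩ := Finset.mem_image.1 h
      exact ⟨t, fun _ => ⟨ht, h2⟩⟩
    · exact ⟨(0,0), fun h' => absurd h' h⟩
  choose a ha using hrep
  -- (v, t) ↦ (a v - t) coordinates and a correction
  let Φ : ℤ × (ℤ × ℤ) → ℤ × ℤ × ℤ := fun vt => ((a vt.1).1 - vt.2.1, (a vt.1).2 - vt.2.2,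
    vt.1 - s - ⌊p * (((a vt.1).1 - vt.2.1 : ℤ) : ℝ) + q * (((a vt.1).2 - vt.2.2 : ℤ) : ℝ)⌋)
  have hmap : Set.MapsTo Φ (F ×ˢ P : Finset _) ((X0 - X0) ×ˢ (Y0 - Y0) ×ˢ Finset.Icc (-1:ℤ) 1 : Finset _) := by
    rintro ⟨v, t⟩ hvt
    simp only [Finset.coe_product, Set.mem_prod, Finset.mem_coe] at hvt
    obtain ⟨hv, ht⟩ := hvt
    obtain ⟨h1, h2⟩ := ha v hv
    have h3 := hs t ht
    have h4 := hP ht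
    rw [Finset.mem_product] at h1 h4
    simp only [Φ, Finset.coe_product, Set.mem_prod, Finset.mem_coe]
    refine ⟨Finset.sub_mem_sub h1.1 h4.1, Finset.sub_mem_sub h1.2 h4.2, ?_⟩
    have b1 := Int.floor_le (p * (a v).1 + q * (a v).2)
    have b1' := Int.lt_floor_add_one (p * (a v).1 + q * (a v).2)
    have b2 := Int.floor_le (p * t.1 + q * t.2)
    have b2' := Int.lt_floor_add_one (p * t.1 + q * t.2)
    change ⌊p * ((a v).1:ℝ) + q * (a v).2⌋ = v at h2
    change ⌊p * (t.1:ℝ) + q * t.2⌋ = s at h3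
    rw [h2] at b1 b1'
    rw [h3] at b2 b2'
    set w := p * (((a v).1 - t.1 : ℤ) : ℝ) + q * (((a v).2 - t.2 : ℤ) : ℝ) with hw
    have hwe : w = (p * (a v).1 + q * (a v).2) - (p * t.1 + q * t.2) := by rw [hw]; push_cast; ring
    have c1 := Int.floor_le w
    have c2 := Int.lt_floor_add_one w
    rw [Finset.mem_Icc]
    constructor
    · have : (-2:ℝ) < ((v - s - ⌊w⌋ : ℤ) : ℝ) := by push_cast; linarith
      have h9 : (-2:ℤ) < v - s - ⌊w⌋ := by exact_mod_cast this
      omega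
    · have : ((v - s - ⌊w⌋ : ℤ) : ℝ) < 2 := by push_cast; linarith
      have h9 : v - s - ⌊w⌋ < 2 := by exact_mod_cast this
      omega
  have hinj : Set.InjOn Φ (F ×ˢ P : Finset _) := by
    rintro ⟨v, t⟩ hvt ⟨v', t'⟩ hvt' heq
    simp only [Φ, Prod.mk.injEq] at heq
    obtain ⟨e1, e2, e3⟩ := heq
    rw [e1, e2] at e3
    have hv : v = v' := by omega
    subst hv
    have h1 : t.1 = t'.1 := by omega
    have h2 : t.2 = t'.2 := by omega
    rw [Prod.ext h1 h2]
  have hcard := Finset.card_le_card_of_injOn Φ hmap hinj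
  simp only [Finset.card_product, Int.card_Icc] at hcard
  have e3 : ((1:ℤ) + 1 - -1).toNat = 3 := by rfl
  rw [e3] at hcard
  have h1 : (F.card : ℝ) * P.card ≤ (X0 - X0).card * ((Y0 - Y0).card * 3) := by exact_mod_cast hcard
  calc (F.card : ℝ) * N ≤ F.card * P.card := by gcongr
    _ ≤ _ := h1
    _ = _ := by ring

end BP

open MeasureTheory
open scoped ENNReal Pointwise

namespace BP

lemma itv_exists {R : ℝ} (hR : 0 ≤ R) : ∃ I : Finset ℝ, (I.card : ℝ) ≤ 2 * R + 3 ∧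
    ∀ e : ℝ, |e| ≤ R → ∃ i ∈ I, |e - i| ≤ 1 := by
  classical
  refine ⟨(Finset.Icc (-⌈R⌉) ⌈R⌉).image (fun i : ℤ => (i : ℝ)), ?_, ?_⟩
  · have h1 : ((Finset.Icc (-⌈R⌉) ⌈R⌉).card : ℝ) = ((⌈R⌉ + 1 - -⌈R⌉ : ℤ) : ℝ) := by
      rw [Int.card_Icc]
      have : 0 ≤ ⌈R⌉ := Int.ceil_nonneg hR
      have h2 : ((⌈R⌉ + 1 - -⌈R⌉).toNat : ℤ) = ⌈R⌉ + 1 - -⌈R⌉ := Int.toNat_of_nonneg (by linarith)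
      exact_mod_cast h2
    have h2 : (((Finset.Icc (-⌈R⌉) ⌈R⌉).image (fun i : ℤ => (i : ℝ))).card : ℝ) ≤
        ((Finset.Icc (-⌈R⌉) ⌈R⌉).card : ℝ) := by exact_mod_cast Finset.card_image_le
    have h3 := Int.ceil_lt_add_one R
    rw [h1] at h2
    push_cast at h2
    linarith
  · intro e he
    have h := abs_le.1 he
    refine ⟨(⌊e⌋ : ℝ), Finset.mem_image.2 ⟨⌊e⌋, ?_, rfl⟩, ?_⟩
    · rw [Finset.mem_Icc]
      constructor
      · rw [Int.le_floor]; push_cast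
        have := Int.le_ceil R; linarith
      · have h1 : (⌊e⌋ : ℝ) ≤ ⌈R⌉ := (Int.floor_le e).trans (h.2.trans (Int.le_ceil R))
        exact_mod_cast h1
    · have h1 := Int.floor_le e
      have h2 := Int.lt_floor_add_one e
      rw [abs_le]; constructor <;> linarith

lemma dbl_cover {X : Finset ℤ} (hX : X.Nonempty) {K : ℝ} (hK : ((X - X).card : ℝ) ≤ K * X.card) :
    ∃ F : Finset ℤ, (F.card : ℝ) ≤ K ^ 5 ∧ ∀ a ∈ X, ∀ b ∈ X, ∀ c ∈ X, ∀ d ∈ X,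
      ∃ f ∈ F, ∃ x ∈ X, ∃ x' ∈ X, (a - b) + (c - d) = f + (x - x') := by
  classical
  have hc : (0:ℝ) < X.card := by exact_mod_cast hX.card_pos
  have h1 := Finset.pluennecke_ruzsa_inequality_nsmul_sub_nsmul_sub hX X 3 2
  have h2 : ((3 • X - 2 • X).card : ℝ) ≤ ((X - X).card / X.card : ℝ) ^ 5 * X.card := by
    have h1' := (NNRat.cast_le (K := ℝ)).2 h1
    push_cast at h1'
    exact h1'
  have h3 : ((3 • X - 2 • X).card : ℝ) ≤ K ^ 5 * X.card := by
    refine h2.trans (mul_le_mul_of_nonneg_right ?_ hc.le)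
    refine pow_le_pow_left₀ (by positivity) ?_ 5
    rwa [div_le_iff₀ hc]
  have hsub : (2 • X - 2 • X) + X ⊆ 3 • X - 2 • X := by
    have : (2 • X - 2 • X) + X = 3 • X - 2 • X := by
      rw [succ_nsmul X 2, add_sub_right_comm]
    rw [this]
  have h4 : (((2 • X - 2 • X) + X).card : ℝ) ≤ K ^ 5 * X.card :=
    le_trans (by exact_mod_cast Finset.card_le_card hsub) h3
  obtain ⟨F, -, hF, hcov⟩ := Finset.ruzsa_covering_add hX h4
  refine ⟨F, hF, ?_⟩
  intro a ha b hb c hc d hd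
  have hm : (a - b) + (c - d) ∈ 2 • X - 2 • X := by
    have : (a - b) + (c - d) = (a + c) - (b + d) := by ring
    rw [this, two_nsmul]
    exact Finset.sub_mem_sub (Finset.add_mem_add ha hc) (Finset.add_mem_add hb hd)
  obtain ⟨f, hf, z, hz, h5⟩ := Finset.mem_add.1 (hcov hm)
  obtain ⟨x, hx, x', hx', rfl⟩ := Finset.mem_sub.1 hz
  exact ⟨f, hf, x, hx, x', hx', h5.symm⟩

/-- thickened difference set -/
def GD (X : Finset ℤ) : Set ℝ := {g | ∃ x ∈ X, ∃ x' ∈ X, |g - ((x:ℝ) - x')| ≤ 1}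

lemma card_image3 {α β γ δ : Type*} [DecidableEq δ] (A : Finset α) (B : Finset β) (C : Finset γ) (f : α × β × γ → δ)
    {a b c : ℝ} (ha : (A.card : ℝ) ≤ a) (hb : (B.card : ℝ) ≤ b) (hc : (C.card : ℝ) ≤ c) :
    (((A ×ˢ B ×ˢ C).image f).card : ℝ) ≤ a * (b * c) := by
  have h1 : (((A ×ˢ B ×ˢ C).image f).card : ℝ) ≤ ((A ×ˢ B ×ˢ C).card : ℝ) := by
    exact_mod_cast Finset.card_image_le
  refine h1.trans ?_
  rw [Finset.card_product, Finset.card_product]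
  push_cast
  have : (0:ℝ) ≤ A.card := by positivity
  have : (0:ℝ) ≤ B.card := by positivity
  have : (0:ℝ) ≤ C.card := by positivity
  exact mul_le_mul ha (mul_le_mul hb hc (by positivity) (by linarith)) (by positivity) (by linarith)

lemma GD_add {X : Finset ℤ} (hX : X.Nonempty) {K : ℝ} (hK0 : 0 ≤ K) (hK : ((X - X).card : ℝ) ≤ K * X.card) :
    ∃ F0 : Finset ℝ, (F0.card : ℝ) ≤ 7 * K ^ 5 ∧ ∀ g ∈ GD X, ∀ g' ∈ GD X, ∃ f ∈ F0, g + g' - f ∈ GD X := by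
  classical
  obtain ⟨F, hF, hcov⟩ := dbl_cover hX hK
  obtain ⟨I, hI, hIc⟩ := itv_exists (show (0:ℝ) ≤ 2 by norm_num)
  refine ⟨((Finset.univ : Finset Unit) ×ˢ F ×ˢ I).image (fun t => (t.2.1 : ℝ) + t.2.2), ?_, ?_⟩
  · refine (card_image3 (a := 1) _ _ _ _ (by simp) hF hI).trans ?_
    nlinarith [pow_nonneg hK0 5]
  · rintro g ⟨a, ha, b, hb, h1⟩ g' ⟨c, hc, d, hd, h2⟩
    obtain ⟨f, hf, x, hx, x', hx', h3⟩ := hcov a ha b hb c hc d hd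
    obtain ⟨i, hi, h4⟩ := hIc ((g - (a - b)) + (g' - (c - d))) (by
      refine (abs_add_le _ _).trans ?_; linarith)
    have h3' : ((a:ℝ) - b) + (c - d) = f + (x - x') := by exact_mod_cast h3
    refine ⟨(f:ℝ) + i, Finset.mem_image.2 ⟨((), f, i), by simp [hf, hi], rfl⟩, x, hx, x', hx', ?_⟩
    convert h4 using 2
    linarith

/-- `c • GD Y` is covered by few translates of `GD X`. -/
lemma GD_cov_yx {X Y : Finset ℤ} (hX : X.Nonempty) {K K1 c M : ℝ} (hM : 1 ≤ M) (hcM : |c| ≤ M)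
    (hK0 : 0 ≤ K) (hK1 : 0 ≤ K1)
    (hK : ((X - X).card : ℝ) ≤ K * X.card)
    (him : (((X ×ˢ Y).image (fun t => fl 1 c t.1 t.2)).card : ℝ) ≤ K1 * X.card) :
    ∃ F : Finset ℝ, (F.card : ℝ) ≤ 9 * M * K1 ^ 2 * K ^ 5 ∧ ∀ g ∈ GD Y, ∃ f ∈ F, c * g - f ∈ GD X := by
  classical
  obtain ⟨F, hF, hcov⟩ := dbl_cover hX hK
  set B := Y.image (fun y : ℤ => ⌊c * y⌋) with hB
  have hBX : B + X ⊆ (X ×ˢ Y).image (fun t => fl 1 c t.1 t.2) := by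
    intro z hz
    obtain ⟨v, hv, x, hx, rfl⟩ := Finset.mem_add.1 hz
    obtain ⟨y, hy, rfl⟩ := Finset.mem_image.1 hv
    refine Finset.mem_image.2 ⟨(x, y), Finset.mem_product.2 ⟨hx, hy⟩, ?_⟩
    simp only [fl, one_mul]
    rw [Int.floor_intCast_add, add_comm]
  have h4 : ((B + X).card : ℝ) ≤ K1 * X.card := le_trans (by exact_mod_cast Finset.card_le_card hBX) him
  obtain ⟨F1, -, hF1, hcov1⟩ := Finset.ruzsa_covering_add hX h4
  obtain ⟨I, hI, hIc⟩ := itv_exists (show (0:ℝ) ≤ M + 1 by linarith)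
  refine ⟨((F1 ×ˢ F1) ×ˢ F ×ˢ I).image (fun t => ((t.1.1 : ℝ) - t.1.2) + t.2.1 + t.2.2), ?_, ?_⟩
  · refine (card_image3 (a := K1 ^ 2) _ _ _ _ ?_ hF hI).trans ?_
    · rw [Finset.card_product]; push_cast
      nlinarith [show (0:ℝ) ≤ F1.card by positivity]
    · have e : K1 ^ 2 * (K ^ 5 * (2 * (M + 1) + 3)) = (K1 ^ 2 * K ^ 5) * (2 * M + 5) := by ring
      have e2 : 9 * M * K1 ^ 2 * K ^ 5 = (K1 ^ 2 * K ^ 5) * (9 * M) := by ring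
      rw [e, e2]
      exact mul_le_mul_of_nonneg_left (by linarith) (by positivity)
  · rintro g ⟨y, hy, y', hy', hg⟩
    have hc1 : ∀ y ∈ Y, ∃ f ∈ F1, ∃ x ∈ X, ∃ x' ∈ X, ⌊c * (y:ℝ)⌋ = f + (x - x') := by
      intro y hy
      have := hcov1 (Finset.mem_image_of_mem (fun y : ℤ => ⌊c * (y:ℝ)⌋) hy)
      obtain ⟨f, hf, z, hz, h5⟩ := Finset.mem_add.1 this
      obtain ⟨x, hx, x', hx', rfl⟩ := Finset.mem_sub.1 hz
      exact ⟨f, hf, x, hx, x', hx', h5.symm⟩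
    obtain ⟨f1, hf1, a, ha, b, hb, e1⟩ := hc1 y hy
    obtain ⟨f2, hf2, d, hd, e, he, e2⟩ := hc1 y' hy'
    obtain ⟨f, hf, x, hx, x', hx', h3⟩ := hcov a ha b hb e he d hd
    have h3' : ((a:ℝ) - b) + (e - d) = f + (x - x') := by exact_mod_cast h3
    have e1' : (⌊c * (y:ℝ)⌋ : ℝ) = f1 + (a - b) := by exact_mod_cast e1
    have e2' : (⌊c * (y':ℝ)⌋ : ℝ) = f2 + (d - e) := by exact_mod_cast e2
    have k1 := Int.floor_le (c * (y:ℝ))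
    have k2 := Int.lt_floor_add_one (c * (y:ℝ))
    have k3 := Int.floor_le (c * (y':ℝ))
    have k4 := Int.lt_floor_add_one (c * (y':ℝ))
    have k5 : |c * (g - (y - y'))| ≤ M := by
      rw [abs_mul]
      nlinarith [abs_nonneg c, abs_nonneg (g - ((y:ℝ) - y'))]
    have k6 := abs_le.1 k5
    obtain ⟨i, hi, h4⟩ := hIc (c * g - (⌊c * (y:ℝ)⌋ - ⌊c * (y':ℝ)⌋)) (by
      rw [abs_le]; constructor <;> nlinarith)
    refine ⟨((f1:ℝ) - f2) + f + i, Finset.mem_image.2 ⟨((f1, f2), f, i), by simp [hf1, hf2, hf, hi], rfl⟩,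
      x, hx, x', hx', ?_⟩
    convert h4 using 2
    rw [e1', e2']
    linarith

/-- `GD X` is covered by few translates of `c • GD Y`. -/
lemma GD_cov_xy {X Y : Finset ℤ} (hY : Y.Nonempty) {K K1 c M : ℝ} (hM : 1 ≤ M) (hcM : 1 / M ≤ |c|)
    (hK0 : 0 ≤ K) (hK1 : 0 ≤ K1)
    (hK : ((Y - Y).card : ℝ) ≤ K * Y.card)
    (him : (((X ×ˢ Y).image (fun t => fl 1 c t.1 t.2)).card : ℝ) ≤ K1 * Y.card) :
    ∃ F : Finset ℝ, (F.card : ℝ) ≤ 99 * M ^ 3 * K1 ^ 2 * K ^ 5 ∧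
      ∀ g ∈ GD X, ∃ f ∈ F, ∃ h ∈ GD Y, g - f = c * h := by
  classical
  obtain ⟨F, hF, hcov⟩ := dbl_cover hY hK
  have hM0 : 0 < M := by linarith
  have hc0 : 0 < |c| := lt_of_lt_of_le (by positivity) hcM
  have hc1 : c ≠ 0 := abs_pos.1 hc0
  have hMc : 1 ≤ M * |c| := by rw [div_le_iff₀ hM0] at hcM; linarith
  set B := Y.image (fun y : ℤ => ⌊c * y⌋) with hB
  have hBX : X + B ⊆ (X ×ˢ Y).image (fun t => fl 1 c t.1 t.2) := by
    intro z hz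
    obtain ⟨x, hx, v, hv, rfl⟩ := Finset.mem_add.1 hz
    obtain ⟨y, hy, rfl⟩ := Finset.mem_image.1 hv
    refine Finset.mem_image.2 ⟨(x, y), Finset.mem_product.2 ⟨hx, hy⟩, ?_⟩
    simp only [fl, one_mul]
    rw [Int.floor_intCast_add]
  have hBn : B.Nonempty := hY.image _
  have hYB : (Y.card : ℝ) ≤ 3 * M * B.card := by
    have hfib : ∀ v ∈ B, ((Y.filter (fun y : ℤ => ⌊c * y⌋ = v)).card : ℝ) ≤ 3 * M := by
      intro v hv
      obtain ⟨y0, hy0, hv0⟩ := Finset.mem_image.1 hv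
      have h1 : ((Y.filter (fun y : ℤ => ⌊c * y⌋ = v)).image (fun i : ℤ => (i:ℝ))).card =
          (Y.filter (fun y : ℤ => ⌊c * y⌋ = v)).card :=
        Finset.card_image_of_injective _ Int.cast_injective
      rw [← h1]
      refine (sep_card_ball (u := 1) (c := y0) (R := M) one_pos hM0.le ?_ ?_).trans (by linarith)
      · intro x hx y hy hne
        obtain ⟨x, -, rfl⟩ := Finset.mem_image.1 hx
        obtain ⟨y, -, rfl⟩ := Finset.mem_image.1 hy
        have : x ≠ y := fun h => hne (by rw [h])
        have : (1:ℤ) ≤ |x - y| := Int.one_le_abs (by omega)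
        exact_mod_cast this
      · intro s hs
        obtain ⟨y, hy, rfl⟩ := Finset.mem_image.1 hs
        have h2 : ⌊c * (y:ℝ)⌋ = ⌊c * (y0:ℝ)⌋ := by rw [(Finset.mem_filter.1 hy).2, ← hv0]
        have h3 := Int.abs_sub_lt_one_of_floor_eq_floor h2
        rw [← mul_sub, abs_mul] at h3
        nlinarith [abs_nonneg ((y:ℝ) - y0)]
    have h5 : (Y.card : ℝ) = ∑ v ∈ B, ((Y.filter (fun y : ℤ => ⌊c * y⌋ = v)).card : ℝ) := by
      exact_mod_cast Finset.card_eq_sum_card_image (fun y : ℤ => ⌊c * y⌋) Y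
    rw [h5]
    refine (Finset.sum_le_sum hfib).trans ?_
    rw [Finset.sum_const, nsmul_eq_mul, mul_comm]
  have h4 : ((X + B).card : ℝ) ≤ (3 * M * K1) * B.card := by
    refine le_trans (by exact_mod_cast Finset.card_le_card hBX) (him.trans ?_)
    calc K1 * Y.card ≤ K1 * (3 * M * B.card) := mul_le_mul_of_nonneg_left hYB hK1
      _ = _ := by ring
  obtain ⟨F1, -, hF1, hcov1⟩ := Finset.ruzsa_covering_add hBn h4
  obtain ⟨I, hI, hIc⟩ := itv_exists (show (0:ℝ) ≤ 3 * M by linarith)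
  refine ⟨((F1 ×ˢ F1) ×ˢ F ×ˢ I).image (fun t => ((t.1.1 : ℝ) - t.1.2) + c * t.2.1 + c * t.2.2), ?_, ?_⟩
  · refine (card_image3 (a := (3 * M * K1) ^ 2) _ _ _ _ ?_ hF hI).trans ?_
    · rw [Finset.card_product]; push_cast
      nlinarith [show (0:ℝ) ≤ F1.card by positivity]
    · have e : (3 * M * K1) ^ 2 * (K ^ 5 * (2 * (3 * M) + 3)) = (9 * M ^ 2 * K1 ^ 2 * K ^ 5) * (6 * M + 3) := by ring
      have e2 : 99 * M ^ 3 * K1 ^ 2 * K ^ 5 = (9 * M ^ 2 * K1 ^ 2 * K ^ 5) * (11 * M) := by ring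
      rw [e, e2]
      exact mul_le_mul_of_nonneg_left (by linarith) (by positivity)
  · rintro g ⟨x, hx, x', hx', hg⟩
    have hc1' : ∀ x ∈ X, ∃ f ∈ F1, ∃ y ∈ Y, ∃ y' ∈ Y, x = f + (⌊c * (y:ℝ)⌋ - ⌊c * (y':ℝ)⌋) := by
      intro x hx
      obtain ⟨f, hf, z, hz, h5⟩ := Finset.mem_add.1 (hcov1 hx)
      obtain ⟨v, hv, v', hv', rfl⟩ := Finset.mem_sub.1 hz
      obtain ⟨y, hy, rfl⟩ := Finset.mem_image.1 hv
      obtain ⟨y', hy', rfl⟩ := Finset.mem_image.1 hv'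
      exact ⟨f, hf, y, hy, y', hy', h5.symm⟩
    obtain ⟨f1, hf1, a, ha, b, hb, e1⟩ := hc1' x hx
    obtain ⟨f2, hf2, d, hd, e, he, e2⟩ := hc1' x' hx'
    obtain ⟨f, hf, y, hy, y', hy', h3⟩ := hcov a ha b hb e he d hd
    have h3' : ((a:ℝ) - b) + (e - d) = f + (y - y') := by exact_mod_cast h3
    have e1' : (x : ℝ) = f1 + (⌊c * (a:ℝ)⌋ - ⌊c * (b:ℝ)⌋) := by exact_mod_cast e1
    have e2' : (x' : ℝ) = f2 + (⌊c * (d:ℝ)⌋ - ⌊c * (e:ℝ)⌋) := by exact_mod_cast e2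
    have k1 := Int.floor_le (c * (a:ℝ))
    have k2 := Int.lt_floor_add_one (c * (a:ℝ))
    have k3 := Int.floor_le (c * (b:ℝ))
    have k4 := Int.lt_floor_add_one (c * (b:ℝ))
    have k1' := Int.floor_le (c * (d:ℝ))
    have k2' := Int.lt_floor_add_one (c * (d:ℝ))
    have k3' := Int.floor_le (c * (e:ℝ))
    have k4' := Int.lt_floor_add_one (c * (e:ℝ))
    have k6 := abs_le.1 hg
    set r := g - (f1 - f2) - c * (((a:ℝ) - b) + (e - d)) with hr
    have hr3 : |r| ≤ 3 := by
      rw [abs_le]; constructor <;> rw [hr] <;> nlinarith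
    obtain ⟨i, hi, h4⟩ := hIc (r / c) (by
      rw [abs_div, div_le_iff₀ hc0]; nlinarith)
    refine ⟨((f1:ℝ) - f2) + c * f + c * i, Finset.mem_image.2 ⟨((f1, f2), f, i), by simp [hf1, hf2, hf, hi], rfl⟩,
      ((y:ℝ) - y') + (r / c - i), ⟨y, hy, y', hy', ?_⟩, ?_⟩
    · convert h4 using 2; ring
    · have : c * (r / c) = r := by field_simp
      calc g - (((f1:ℝ) - f2) + c * f + c * i) = r + c * (((a:ℝ) - b) + (e - d)) - c * f - c * i := by
            rw [hr]; ring
        _ = c * (r / c) + c * (f + (y - y')) - c * f - c * i := by rw [this, h3']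
        _ = _ := by ring

end BP

open MeasureTheory
open scoped ENNReal Pointwise

namespace BP

/-- The data fed to the ring theorem. -/
structure AHyp (b κ L M : ℝ) (X Y : Finset ℤ) (C : Set ℝ) : Prop where
  cX : L ^ b / M ≤ X.card
  cY : L ^ b / M ≤ Y.card
  dX : ((X - X).card : ℝ) ≤ M * L ^ b
  dY : ((Y - Y).card : ℝ) ≤ M * L ^ b
  bd : ∀ x ∈ X, ∀ x' ∈ X, |(x:ℝ) - x'| ≤ M * L
  cc : ∀ c ∈ C, 1 / M ≤ |c| ∧ |c| ≤ M ∧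
    (((X ×ˢ Y).image (fun t => fl 1 c t.1 t.2)).card : ℝ) ≤ M * L ^ b
  many : ∀ ρ : ℝ, 1 / L ≤ ρ → ρ ≤ 1 → ∃ S : Finset ℝ, (S : Set ℝ) ⊆ C ∧ Sep ρ S ∧ ρ ^ (-κ) ≤ M * S.card
  low : ∀ u : ℝ, 1 ≤ u → ∀ FX FY : Finset ℝ, (∀ x ∈ X, ∃ f ∈ FX, |(x:ℝ) - f| ≤ u) →
    (∀ y ∈ Y, ∃ f ∈ FY, |(y:ℝ) - f| ≤ u) → (L / u) ^ (2 * b) ≤ M * FX.card * FY.card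

lemma AHyp.nonemptyC {b κ L M : ℝ} {X Y : Finset ℤ} {C : Set ℝ} (h : AHyp b κ L M X Y C) (hL : 1 ≤ L) :
    ∃ c, c ∈ C := by
  obtain ⟨S, hS, -, hc⟩ := h.many 1 (by rw [div_le_one] <;> linarith) le_rfl
  rw [Real.one_rpow] at hc
  rcases S.eq_empty_or_nonempty with rfl | ⟨c, hc⟩
  · simp at hc; linarith
  · exact ⟨c, hS hc⟩

lemma AHyp.doubX {b κ L M : ℝ} {X Y : Finset ℤ} {C : Set ℝ} (h : AHyp b κ L M X Y C)
    (hM : 1 ≤ M) : M * L ^ b ≤ M ^ 2 * X.card := by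
  have := h.cX
  have hM0 : 0 < M := by linarith
  rw [div_le_iff₀ hM0] at this
  nlinarith

lemma AHyp.doubY {b κ L M : ℝ} {X Y : Finset ℤ} {C : Set ℝ} (h : AHyp b κ L M X Y C)
    (hM : 1 ≤ M) : M * L ^ b ≤ M ^ 2 * Y.card := by
  have := h.cY
  have hM0 : 0 < M := by linarith
  rw [div_le_iff₀ hM0] at this
  nlinarith

lemma AHyp.rhyp {b κ L M : ℝ} {X Y : Finset ℤ} {C : Set ℝ} (h : AHyp b κ L M X Y C) (hb0 : 0 < b)
    (hb1 : b < 1) (hL : 1 ≤ L) (hM : 1 ≤ M) {K : ℝ} (hK : 1000 * M ^ 32 ≤ K) : RHyp b L K (GD X) := by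
  classical
  have hL0 : 0 < L := by linarith
  have hM0 : 0 < M := by linarith
  have hLb : 0 < L ^ b := by positivity
  have hXn : X.Nonempty := by
    rw [← Finset.card_pos]
    have := h.cX
    have h2 : (0:ℝ) < X.card := lt_of_lt_of_le (by positivity) this
    exact_mod_cast h2
  have hpow : ∀ k ≤ 32, M ^ k ≤ M ^ 32 := fun k hk => pow_le_pow_right₀ hM hk
  have hK1 : 2 * M ≤ K := by have := hpow 1 (by norm_num); rw [pow_one] at this; linarith
  have hK2 : 3 * M ≤ K := by have := hpow 1 (by norm_num); rw [pow_one] at this; linarith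
  constructor
  · rintro g ⟨x, hx, x', hx', h1⟩
    refine ⟨x', hx', x, hx, ?_⟩
    rw [← abs_neg]; convert h1 using 2; ring
  · obtain ⟨F0, h1, h2⟩ := GD_add hXn (K := M ^ 2) (by positivity) (h.dX.trans (h.doubX hM))
    refine ⟨F0, h1.trans ?_, h2⟩
    have := hpow 10 (by norm_num)
    have e : (M ^ 2) ^ 5 = M ^ 10 := by ring
    rw [e]; nlinarith [pow_pos hM0 32]
  · rintro g ⟨x, hx, x', hx', h1⟩
    have h2 := h.bd x hx x' hx'
    have h3 : |g| ≤ 1 + M * L := by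
      calc |g| = |(g - (x - x')) + (x - x')| := by congr 1; ring
        _ ≤ _ := (abs_add_le _ _).trans (by linarith)
    nlinarith
  · intro S hS hsep
    have hch : ∀ s : ℝ, ∃ d : ℤ, s ∈ S → d ∈ X - X ∧ |s - d| ≤ 1 := by
      intro s
      by_cases hs : s ∈ S
      · obtain ⟨x, hx, x', hx', h1⟩ := hS hs
        exact ⟨x - x', fun _ => ⟨Finset.sub_mem_sub hx hx', by push_cast; exact h1⟩⟩
      · exact ⟨0, fun h => absurd h hs⟩
    choose d hd using hch
    have h1 : (S.card : ℝ) = ∑ v ∈ X - X, ((S.filter (fun s => d s = v)).card : ℝ) := by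
      exact_mod_cast Finset.card_eq_sum_card_fiberwise (fun s hs => (hd s hs).1)
    have h2 : ∀ v ∈ X - X, ((S.filter (fun s => d s = v)).card : ℝ) ≤ 3 := by
      intro v hv
      refine (sep_card_ball (u := 1) (c := v) (R := 1) one_pos zero_le_one
        (hsep.subset (Finset.filter_subset _ _)) ?_).trans (by norm_num)
      intro s hs
      rw [Finset.mem_filter] at hs
      rw [← hs.2]; exact (hd s hs.1).2
    rw [h1]
    refine (Finset.sum_le_sum h2).trans ?_
    rw [Finset.sum_const, nsmul_eq_mul]
    have := h.dX
    nlinarith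
  · intro u hu
    have hu0 : 0 < u := by linarith
    obtain ⟨S, hSX, hsep, hcov⟩ := exists_max_sep hu0 ((X - X).image (fun i : ℤ => (i:ℝ)))
    refine ⟨S, ?_, hsep, ?_⟩
    · intro s hs
      obtain ⟨d, hd, rfl⟩ := Finset.mem_image.1 (hSX hs)
      obtain ⟨x, hx, x', hx', rfl⟩ := Finset.mem_sub.1 hd
      exact ⟨x, hx, x', hx', by push_cast; simp⟩
    · obtain ⟨c, hcC⟩ := h.nonemptyC hL
      obtain ⟨hc1, hc2, hc3⟩ := h.cc c hcC
      obtain ⟨F, hF, hFc⟩ := GD_cov_yx (Y := Y) hXn (K := M ^ 2) (K1 := M ^ 2) hM hc2 (by positivity) (by positivity)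
        (h.dX.trans (h.doubX hM)) (hc3.trans (h.doubX hM))
      have hc0 : 0 < |c| := lt_of_lt_of_le (by positivity) hc1
      have hcne : c ≠ 0 := abs_pos.1 hc0
      have hMc : 1 ≤ M * |c| := by rw [div_le_iff₀ hM0] at hc1; linarith
      obtain ⟨x0, hx0⟩ := hXn
      have hYn : Y.Nonempty := by
        rw [← Finset.card_pos]
        have := h.cY
        have h2 : (0:ℝ) < Y.card := lt_of_lt_of_le (by positivity) this
        exact_mod_cast h2
      obtain ⟨y0, hy0⟩ := hYn
      have hXS : ∀ x ∈ X, ∀ x' ∈ X, ∃ s ∈ S, |((x:ℝ) - x') - s| < u := by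
        intro x hx x' hx'
        obtain ⟨s, hs, h1⟩ := hcov (((x - x' : ℤ)) : ℝ) (Finset.mem_image_of_mem _ (Finset.sub_mem_sub hx hx'))
        refine ⟨s, hs, by push_cast at h1; exact h1⟩
      have hlow := h.low (2 * M * u) (by nlinarith) (S.image (fun s => (x0:ℝ) + s))
        ((F ×ˢ S).image (fun t => (y0:ℝ) + (t.1 + t.2) / c)) (by
          intro x hx
          obtain ⟨s, hs, h1⟩ := hXS x hx x0 hx0
          refine ⟨x0 + s, Finset.mem_image_of_mem _ hs, ?_⟩
          rw [show (x:ℝ) - (x0 + s) = (x - x0) - s by ring]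
          nlinarith) (by
          intro y hy
          obtain ⟨f, hf, x, hx, x', hx', h1⟩ := hFc ((y:ℝ) - y0) ⟨y, hy, y0, hy0, by simp⟩
          obtain ⟨s, hs, h2⟩ := hXS x hx x' hx'
          refine ⟨y0 + (f + s) / c, Finset.mem_image.2 ⟨(f, s), Finset.mem_product.2 ⟨hf, hs⟩, rfl⟩, ?_⟩
          have e : (y:ℝ) - (y0 + (f + s) / c) = (c * (y - y0) - f - s) / c := by field_simp; ring
          rw [e, abs_div, div_le_iff₀ hc0]
          have h3 : |c * ((y:ℝ) - y0) - f - s| ≤ 1 + u := by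
            calc |c * ((y:ℝ) - y0) - f - s| = |(c * ((y:ℝ) - y0) - f - (x - x')) + ((x - x') - s)| := by congr 1; ring
              _ ≤ _ := (abs_add_le _ _).trans (by linarith)
          nlinarith)
      have hs1 : ((S.image (fun s => (x0:ℝ) + s)).card : ℝ) ≤ S.card := by exact_mod_cast Finset.card_image_le
      have hs2 : (((F ×ˢ S).image (fun t => (y0:ℝ) + (t.1 + t.2) / c)).card : ℝ) ≤ 9 * M ^ 15 * S.card := by
        refine le_trans (Nat.cast_le.2 Finset.card_image_le) ?_
        rw [Finset.card_product]; push_cast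
        refine mul_le_mul_of_nonneg_right (hF.trans (le_of_eq (by ring))) (by positivity)
      have h5 : (L / (2 * M * u)) ^ (2 * b) ≤ 9 * M ^ 16 * S.card ^ 2 := by
        refine hlow.trans ?_
        calc M * ((S.image (fun s => (x0:ℝ) + s)).card : ℝ) * (((F ×ˢ S).image (fun t => (y0:ℝ) + (t.1 + t.2) / c)).card : ℝ)
            ≤ M * S.card * (9 * M ^ 15 * S.card) := by
              refine mul_le_mul (mul_le_mul_of_nonneg_left hs1 hM0.le) hs2 (by positivity) (by positivity)
          _ = _ := by ring
      have e1 : (L / (2 * M * u)) ^ (2 * b) = ((L / (2 * M * u)) ^ b) ^ 2 := by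
        rw [← Real.rpow_natCast, ← Real.rpow_mul (by positivity)]; congr 1; push_cast; ring
      have h6 : (L / (2 * M * u)) ^ b ≤ 3 * M ^ 8 * S.card := by
        rw [e1] at h5
        refine (pow_le_pow_iff_left₀ (by positivity) (by positivity) two_ne_zero).1 (h5.trans (le_of_eq (by ring)))
      have e2 : (L / u) ^ b = (L / (2 * M * u)) ^ b * (2 * M) ^ b := by
        rw [← Real.mul_rpow (by positivity) (by positivity)]; congr 1; field_simp
      have h7 : (2 * M) ^ b ≤ 2 * M := by
        calc (2 * M) ^ b ≤ (2 * M) ^ (1:ℝ) := Real.rpow_le_rpow_of_exponent_le (by linarith) hb1.le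
          _ = _ := Real.rpow_one _
      rw [e2]
      calc (L / (2 * M * u)) ^ b * (2 * M) ^ b ≤ (3 * M ^ 8 * S.card) * (2 * M) := by
            refine mul_le_mul h6 h7 (by positivity) (by positivity)
        _ = (6 * M ^ 9) * S.card := by ring
        _ ≤ K * S.card := by
            refine mul_le_mul_of_nonneg_right ?_ (by positivity)
            have := hpow 9 (by norm_num)
            nlinarith [pow_pos hM0 32]

lemma AHyp.chyp {b κ L M : ℝ} {X Y : Finset ℤ} {C : Set ℝ} (h : AHyp b κ L M X Y C) (hκ0 : 0 < κ)
    (hκ1 : κ ≤ 1) (hL : 1 ≤ L) (hM : 1 ≤ M) {K : ℝ} (hK : 1000 * M ^ 32 ≤ K) :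
    ∃ C' : Set ℝ, CHyp κ L K (GD X) C' := by
  classical
  have hL0 : 0 < L := by linarith
  have hM0 : 0 < M := by linarith
  have hLb : 0 < L ^ b := by positivity
  have hXn : X.Nonempty := by
    rw [← Finset.card_pos]
    have := h.cX
    have h2 : (0:ℝ) < X.card := lt_of_lt_of_le (by positivity) this
    exact_mod_cast h2
  have hYn : Y.Nonempty := by
    rw [← Finset.card_pos]
    have := h.cY
    have h2 : (0:ℝ) < Y.card := lt_of_lt_of_le (by positivity) this
    exact_mod_cast h2
  have hpow : ∀ k ≤ 32, M ^ k ≤ M ^ 32 := fun k hk => pow_le_pow_right₀ hM hk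
  have hK2 : M ^ 2 ≤ K := by have := hpow 2 (by norm_num); nlinarith [pow_pos hM0 32]
  obtain ⟨c0, hc0C⟩ := h.nonemptyC hL
  obtain ⟨ha1, ha2, ha3⟩ := h.cc c0 hc0C
  have hc0 : 0 < |c0| := lt_of_lt_of_le (by positivity) ha1
  have hcne : c0 ≠ 0 := abs_pos.1 hc0
  have hMc : 1 ≤ M * |c0| := by rw [div_le_iff₀ hM0] at ha1; linarith
  refine ⟨(fun c => c / c0) '' C, ?_, ?_⟩
  · rintro _ ⟨c, hcC, rfl⟩
    obtain ⟨hc1, hc2, hc3⟩ := h.cc c hcC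
    constructor
    · simp only [abs_div]
      rw [div_le_iff₀ hc0]
      nlinarith
    · obtain ⟨F, hF, hFc⟩ := GD_cov_yx (Y := Y) hXn (K := M ^ 2) (K1 := M ^ 2) hM hc2 (by positivity) (by positivity)
        (h.dX.trans (h.doubX hM)) (hc3.trans (h.doubX hM))
      obtain ⟨F', hF', hFc'⟩ := GD_cov_xy (X := X) hYn (K := M ^ 2) (K1 := M ^ 2) hM ha1 (by positivity) (by positivity)
        (h.dY.trans (h.doubY hM)) (ha3.trans (h.doubY hM))
      refine ⟨(F' ×ˢ F).image (fun t => c / c0 * t.1 + t.2), ?_, ?_⟩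
      · refine le_trans (Nat.cast_le.2 Finset.card_image_le) ?_
        rw [Finset.card_product]; push_cast
        calc (F'.card : ℝ) * F.card ≤ (99 * M ^ 3 * (M ^ 2) ^ 2 * (M ^ 2) ^ 5) * (9 * M * (M ^ 2) ^ 2 * (M ^ 2) ^ 5) :=
              mul_le_mul hF' hF (by positivity) (by positivity)
          _ = 891 * M ^ 32 := by ring
          _ ≤ K := by nlinarith [pow_pos hM0 32]
      · intro g hg
        obtain ⟨f', hf', z, hz, h1⟩ := hFc' g hg
        obtain ⟨f, hf, h2⟩ := hFc z hz
        refine ⟨c / c0 * f' + f, Finset.mem_image.2 ⟨(f', f), Finset.mem_product.2 ⟨hf', hf⟩, rfl⟩, ?_⟩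
        have e : c / c0 * g - (c / c0 * f' + f) = c * z - f := by
          have : g = f' + c0 * z := by linarith
          rw [this]; field_simp; ring
        rw [e]; exact h2
  · intro ρ h1 h2
    have hρ : 0 < ρ := lt_of_lt_of_le (by positivity) h1
    have hMκ : M ^ κ ≤ M := by
      calc M ^ κ ≤ M ^ (1:ℝ) := Real.rpow_le_rpow_of_exponent_le hM hκ1
        _ = _ := Real.rpow_one _
    by_cases h3 : ρ * M ≤ 1
    · obtain ⟨S, hS, hsep, hcard⟩ := h.many (ρ * M) (by nlinarith) h3
      refine ⟨S.image (fun c => c / c0), ?_, ?_, ?_⟩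
      · intro x hx
        obtain ⟨s, hs, rfl⟩ := Finset.mem_image.1 hx
        exact ⟨s, hS hs, rfl⟩
      · intro x hx y hy hne
        obtain ⟨x, hxs, rfl⟩ := Finset.mem_image.1 hx
        obtain ⟨y, hys, rfl⟩ := Finset.mem_image.1 hy
        have := hsep x hxs y hys (fun h => hne (by rw [h]))
        rw [← sub_div, abs_div, le_div_iff₀ hc0]
        nlinarith
      · rw [Finset.card_image_of_injective _ (fun x y hxy => by simpa [div_left_inj' hcne] using hxy)]
        rw [Real.mul_rpow hρ.le hM0.le] at hcard
        have e : ρ ^ (-κ) = (ρ ^ (-κ) * M ^ (-κ)) * M ^ κ := by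
          rw [mul_assoc, ← Real.rpow_add hM0]; simp
        rw [e]
        clear e
        calc (ρ ^ (-κ) * M ^ (-κ)) * M ^ κ ≤ (M * S.card) * M :=
              mul_le_mul hcard hMκ (by positivity) (by positivity)
          _ = M ^ 2 * S.card := by ring
          _ ≤ K * S.card := mul_le_mul_of_nonneg_right hK2 (by positivity)
    · refine ⟨{c0 / c0}, by simpa using ⟨c0, hc0C, rfl⟩, ?_, ?_⟩
      · intro x hx y hy hne
        simp at hx hy; exact absurd (hx.trans hy.symm) hne
      · push Not at h3
        simp only [Finset.card_singleton, Nat.cast_one, mul_one]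
        have h4 : ρ⁻¹ ≤ M := by rw [inv_le_iff_one_le_mul₀ hρ]; linarith
        rw [Real.rpow_neg hρ.le, ← Real.inv_rpow hρ.le]
        calc ρ⁻¹ ^ κ ≤ M ^ κ := Real.rpow_le_rpow (by positivity) h4 hκ0.le
          _ ≤ M := hMκ
          _ ≤ M ^ 2 := by nlinarith
          _ ≤ K := hK2

theorem layerA {b κ : ℝ} (hb0 : 0 < b) (hb1 : b < 1) (hκ : 0 < κ) (hκ1 : κ ≤ 1) :
    ∃ ε : ℝ, 0 < ε ∧ ∃ L0 : ℝ, ∀ L : ℝ, L0 ≤ L → ∀ M : ℝ, 1 ≤ M → M ≤ L ^ ε → ∀ (X Y : Finset ℤ) (C : Set ℝ),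
      AHyp b κ L M X Y C → False := by
  obtain ⟨ε, hε, L0, h⟩ := ring_thm hb0 hb1 hκ
  obtain ⟨L1, hL1⟩ := Filter.eventually_atTop.1 (ev_rpow 1000 (32 * (ε / 64)) ε (by linarith))
  refine ⟨ε / 64, by positivity, max L0 (max L1 1), ?_⟩
  intro L hL M hM hML X Y C hA
  have hL0 : L0 ≤ L := (le_max_left _ _).trans hL
  have hL1' : L1 ≤ L := (le_max_left _ _).trans ((le_max_right _ _).trans hL)
  have hL2 : 1 ≤ L := (le_max_right _ _).trans ((le_max_right _ _).trans hL)
  have hK : 1000 * M ^ 32 ≤ L ^ ε := by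
    have h1 := hL1 L hL1'
    have h2 : M ^ 32 ≤ L ^ (32 * (ε / 64)) := by
      calc M ^ 32 ≤ (L ^ (ε / 64)) ^ 32 := pow_le_pow_left₀ (by linarith) hML 32
        _ = _ := by rw [← Real.rpow_natCast, ← Real.rpow_mul (by linarith)]; congr 1; push_cast; ring
    linarith
  obtain ⟨C', hC'⟩ := hA.chyp hκ hκ1 hL2 hM hK
  exact h L hL0 _ _ (hA.rhyp hb0 hb1 hL2 hM hK) hC'

end BP

open MeasureTheory
open scoped ENNReal Pointwise

namespace BP

lemma cover_sum {α β : Type*} (S : Finset α) (F : Finset β) (R : α → β → Prop) [∀ b, DecidablePred (fun a => R a b)]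
    (w : α → ℝ) (hw : ∀ a ∈ S, 0 ≤ w a) (hc : ∀ a ∈ S, ∃ b ∈ F, R a b) :
    ∑ a ∈ S, w a ≤ ∑ b ∈ F, ∑ a ∈ S.filter (fun a => R a b), w a := by
  simp_rw [Finset.sum_filter]
  rw [Finset.sum_comm]
  refine Finset.sum_le_sum fun a ha => ?_
  obtain ⟨b, hb, hR⟩ := hc a ha
  refine le_trans ?_ (Finset.single_le_sum (f := fun b => if R a b then w a else 0) ?_ hb)
  · simp [hR]
  · intro b' _
    split_ifs
    · exact hw a ha
    · exact le_rfl

lemma cs_pick {ι α : Type*} [DecidableEq α] (T : Finset ι) (Z : Finset α) (ν : ι → ℝ) (H : ι → Finset α)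
    (hν : ∀ θ ∈ T, 0 < ν θ) (hν1 : ∑ θ ∈ T, ν θ ≤ 1) {σ h z : ℝ} (hσ : 0 < σ) (hh : 0 < h) (hz : 0 < z)
    (hνσ : σ ≤ ∑ θ ∈ T, ν θ)
    (hH : ∀ θ ∈ T, H θ ⊆ Z) (hHc : ∀ θ ∈ T, h ≤ (H θ).card) (hZ : (Z.card : ℝ) ≤ z) :
    ∃ θ0 ∈ T, (σ * h) ^ 2 / (2 * z ^ 2) ≤ ∑ θ ∈ T.filter (fun θ => (σ * h) ^ 2 / (2 * z) ≤ ((H θ ∩ H θ0).card : ℝ)), ν θ := by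
  set N : α → ℝ := fun t => ∑ θ ∈ T, ν θ * (if t ∈ H θ then 1 else 0) with hN
  have hcard : ∀ A : Finset α, A ⊆ Z → (A.card : ℝ) = ∑ t ∈ Z, if t ∈ A then (1:ℝ) else 0 := by
    intro A hA
    rw [Finset.sum_ite_mem, Finset.inter_eq_right.2 hA]; simp
  have h1 : σ * h ≤ ∑ t ∈ Z, N t := by
    rw [hN]; simp only
    rw [Finset.sum_comm]
    calc σ * h ≤ (∑ θ ∈ T, ν θ) * h := mul_le_mul_of_nonneg_right hνσ hh.le
      _ = ∑ θ ∈ T, ν θ * h := by rw [Finset.sum_mul]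
      _ ≤ _ := by
        refine Finset.sum_le_sum fun θ hθ => ?_
        rw [← Finset.mul_sum, ← hcard _ (hH θ hθ)]
        exact mul_le_mul_of_nonneg_left (hHc θ hθ) (hν θ hθ).le
  have h2 : (∑ t ∈ Z, N t) ^ 2 ≤ Z.card * ∑ t ∈ Z, N t ^ 2 := sq_sum_le_card_mul_sum_sq
  have h3 : ∑ t ∈ Z, N t ^ 2 = ∑ θ0 ∈ T, ν θ0 * ∑ θ ∈ T, ν θ * ((H θ ∩ H θ0).card : ℝ) := by
    have : ∀ t ∈ Z, N t ^ 2 = ∑ θ0 ∈ T, ∑ θ ∈ T, ν θ0 * (ν θ * (if t ∈ H θ ∩ H θ0 then 1 else 0)) := by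
      intro t _
      rw [sq, hN]; simp only
      rw [Finset.sum_mul_sum]
      refine Finset.sum_congr rfl fun a _ => Finset.sum_congr rfl fun b _ => ?_
      simp only [Finset.mem_inter]
      by_cases ha : t ∈ H a <;> by_cases hb : t ∈ H b <;> simp [ha, hb]
    rw [Finset.sum_congr rfl this, Finset.sum_comm]
    refine Finset.sum_congr rfl fun a ha => ?_
    rw [Finset.sum_comm, Finset.mul_sum]
    refine Finset.sum_congr rfl fun b hb => ?_
    rw [hcard _ (Finset.inter_subset_left.trans (hH b hb)), Finset.mul_sum, Finset.mul_sum]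
  have h4 : (σ * h) ^ 2 / z ≤ ∑ t ∈ Z, N t ^ 2 := by
    rw [div_le_iff₀ hz]
    have h5 : (σ * h) ^ 2 ≤ (∑ t ∈ Z, N t) ^ 2 := pow_le_pow_left₀ (by positivity) h1 2
    have h6 : 0 ≤ ∑ t ∈ Z, N t ^ 2 := Finset.sum_nonneg fun _ _ => sq_nonneg _
    nlinarith
  rw [h3] at h4
  have hTn : T.Nonempty := by
    rcases T.eq_empty_or_nonempty with rfl | h
    · simp at hνσ; linarith
    · exact h
  set τ : ℝ := (σ * h) ^ 2 / z with hτ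
  have hτ0 : 0 < τ := by positivity
  have h5 : ∑ θ ∈ T, ν θ * τ ≤ ∑ θ0 ∈ T, ν θ0 * ∑ θ ∈ T, ν θ * ((H θ ∩ H θ0).card : ℝ) := by
    rw [← Finset.sum_mul]; nlinarith
  obtain ⟨θ0, hθ0, h6⟩ := Finset.exists_le_of_sum_le hTn h5
  have h7 := le_of_mul_le_mul_left h6 (hν θ0 hθ0)
  refine ⟨θ0, hθ0, ?_⟩
  have e1 : (σ * h) ^ 2 / (2 * z) = τ / 2 := by rw [hτ]; field_simp
  have e2 : (σ * h) ^ 2 / (2 * z ^ 2) = τ / (2 * z) := by rw [hτ]; field_simp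
  rw [e1, e2]
  have h8 : ∑ θ ∈ T, ν θ * ((H θ ∩ H θ0).card : ℝ) ≤
      z * (∑ θ ∈ T.filter (fun θ => τ / 2 ≤ ((H θ ∩ H θ0).card : ℝ)), ν θ) + ∑ θ ∈ T, ν θ * (τ / 2) := by
    rw [Finset.mul_sum, Finset.sum_filter, ← Finset.sum_add_distrib]
    refine Finset.sum_le_sum fun θ hθ => ?_
    have hp := hν θ hθ
    split_ifs with hc
    · have : ((H θ ∩ H θ0).card : ℝ) ≤ z :=
        le_trans (by exact_mod_cast Finset.card_le_card (Finset.inter_subset_left.trans (hH θ hθ))) hZ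
      nlinarith [mul_le_mul_of_nonneg_left this hp.le, mul_pos hp hτ0]
    · push Not at hc
      nlinarith [mul_le_mul_of_nonneg_left hc.le hp.le]
  rw [← Finset.sum_mul] at h8
  rw [div_le_iff₀ (by positivity)]
  nlinarith

structure BHyp {ι : Type*} (b κ L M : ℝ) (X Y : Finset ℤ) (T : Finset ι) (ν p q : ι → ℝ)
    (G : ι → Finset (ℤ × ℤ)) (w : ℤ × ℤ → ℝ) : Prop where
  cX : (X.card : ℝ) ≤ M * L ^ b
  cY : (Y.card : ℝ) ≤ M * L ^ b
  bd : ∀ x ∈ X, ∀ x' ∈ X, |(x:ℝ) - x'| ≤ M * L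
  ν0 : ∀ θ ∈ T, 0 < ν θ
  ν1 : ∑ θ ∈ T, ν θ ≤ 1
  νM : 1 / M ≤ ∑ θ ∈ T, ν θ
  p1 : ∀ θ ∈ T, 1 ≤ |p θ| ∧ |p θ| ≤ M
  q1 : ∀ θ ∈ T, 1 ≤ |q θ| ∧ |q θ| ≤ M
  Gs : ∀ θ ∈ T, G θ ⊆ X ×ˢ Y
  Gc : ∀ θ ∈ T, (L ^ b) ^ 2 / M ≤ (G θ).card
  Gi : ∀ θ ∈ T, (((G θ).image (fun t => fl (p θ) (q θ) t.1 t.2)).card : ℝ) ≤ M * L ^ b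
  w0 : ∀ t, 0 ≤ w t
  wl : ∀ θ ∈ T, ∀ t ∈ G θ, 1 / (M * (L ^ b) ^ 2) ≤ w t
  wu : ∀ u : ℝ, 1 ≤ u → ∀ x0 y0 : ℝ,
    ∑ t ∈ (X ×ˢ Y).filter (fun t => |(t.1:ℝ) - x0| ≤ u ∧ |(t.2:ℝ) - y0| ≤ u), w t ≤ M * (u / L) ^ (2 * b)
  νc : ∀ ρ : ℝ, 1 / L ≤ ρ → ρ ≤ 1 → ∀ c0 : ℝ, ∑ θ ∈ T.filter (fun θ => |q θ / p θ - c0| ≤ ρ), ν θ ≤ M * ρ ^ κ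

/-- popular value -/
lemma exists_popular {α : Type*} [DecidableEq α] (P : Finset α) (f : α → ℤ) {N n : ℝ} (hn : 0 < n)
    (hP : N ≤ P.card) (him : ((P.image f).card : ℝ) ≤ n) (hne : P.Nonempty) :
    ∃ s : ℤ, N / n ≤ ((P.filter (fun t => f t = s)).card : ℝ) := by
  by_contra hcon
  push Not at hcon
  have h5 : (P.card : ℝ) = ∑ v ∈ P.image f, ((P.filter (fun t => f t = v)).card : ℝ) := by
    exact_mod_cast Finset.card_eq_sum_card_image f P
  have h6 : ∑ v ∈ P.image f, ((P.filter (fun t => f t = v)).card : ℝ) < ∑ v ∈ P.image f, N / n :=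
    Finset.sum_lt_sum_of_nonempty (hne.image f) (fun v _ => hcon v)
  rw [← h5, Finset.sum_const, nsmul_eq_mul] at h6
  have h7 : 0 < N / n := lt_of_le_of_lt (by positivity) (hcon 0)
  have : ((P.image f).card : ℝ) * (N / n) ≤ N := by
    calc ((P.image f).card : ℝ) * (N / n) ≤ n * (N / n) := mul_le_mul_of_nonneg_right him h7.le
      _ = N := by field_simp
  linarith

/-- passing from `p x + q y` to `x + (q/p) y`. -/
lemma fl_div (Z : Finset (ℤ × ℤ)) {p q : ℝ} (hp : 1 ≤ |p|) :
    ((Z.image (fun t => fl 1 (q / p) t.1 t.2)).card : ℝ) ≤ 3 * (Z.image (fun t => fl p q t.1 t.2)).card := by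
  classical
  have hsub : Z.image (fun t => fl 1 (q / p) t.1 t.2) ⊆
      ((Z.image (fun t => fl p q t.1 t.2)) ×ˢ Finset.Icc (-1:ℤ) 1).image (fun r => ⌊(r.1 : ℝ) / p⌋ + r.2) := by
    intro v hv
    obtain ⟨⟨x, y⟩, ht, rfl⟩ := Finset.mem_image.1 hv
    refine Finset.mem_image.2 ⟨(fl p q x y, fl 1 (q / p) x y - ⌊(fl p q x y : ℝ) / p⌋), ?_, by ring⟩
    refine Finset.mem_product.2 ⟨Finset.mem_image_of_mem (fun t : ℤ × ℤ => fl p q t.1 t.2) ht, ?_⟩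
    have hp0 : p ≠ 0 := by rintro rfl; simp at hp; linarith
    have hpp : 0 < |p| := by linarith
    have k1 := Int.floor_le (p * x + q * y)
    have k2 := Int.lt_floor_add_one (p * x + q * y)
    change ((fl p q x y : ℤ) : ℝ) ≤ _ at k1
    change _ < ((fl p q x y : ℤ) : ℝ) + 1 at k2
    set s : ℤ := fl p q x y
    have e : 1 * (x:ℝ) + q / p * y = s / p + (p * x + q * y - s) / p := by field_simp; ring
    have h3 : |(p * x + q * y - s) / p| < 1 := by
      rw [abs_div, div_lt_one hpp]
      refine lt_of_lt_of_le ?_ hp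
      rw [abs_lt]; constructor <;> linarith
    rw [abs_lt] at h3
    have k3 := Int.floor_le ((s:ℝ) / p)
    have k4 := Int.lt_floor_add_one ((s:ℝ) / p)
    have k5 := Int.floor_le (1 * (x:ℝ) + q / p * y)
    have k6 := Int.lt_floor_add_one (1 * (x:ℝ) + q / p * y)
    have hf : fl 1 (q / p) x y = ⌊1 * (x:ℝ) + q / p * y⌋ := rfl
    simp only [Finset.mem_Icc, hf]
    constructor
    · have : ((-2:ℤ):ℝ) < ((⌊1 * (x:ℝ) + q / p * y⌋ - ⌊(s:ℝ) / p⌋ : ℤ) : ℝ) := by push_cast; linarith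
      have := Int.cast_lt.1 this
      omega
    · have : ((⌊1 * (x:ℝ) + q / p * y⌋ - ⌊(s:ℝ) / p⌋ : ℤ) : ℝ) < ((2:ℤ):ℝ) := by push_cast; linarith
      have := Int.cast_lt.1 this
      omega
  have h1 := (Finset.card_le_card hsub).trans Finset.card_image_le
  rw [Finset.card_product, Int.card_Icc] at h1
  have e3 : ((1:ℤ) + 1 - -1).toNat = 3 := by rfl
  rw [e3] at h1
  have h2 : ((Z.image (fun t => fl 1 (q / p) t.1 t.2)).card : ℝ) ≤ ((Z.image (fun t => fl p q t.1 t.2)).card * 3 : ℕ) :=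
    Nat.cast_le.2 h1
  push_cast at h2
  linarith

end BP

open MeasureTheory
open scoped ENNReal Pointwise

namespace BP

set_option maxHeartbeats 1000000 in
lemma BHyp.ahyp {ι : Type*} {b κ L M : ℝ} {X Y : Finset ℤ} {T : Finset ι} {ν p q : ι → ℝ}
    {G : ι → Finset (ℤ × ℤ)} {w : ℤ × ℤ → ℝ} (h : BHyp b κ L M X Y T ν p q G w) (hb0 : 0 < b)
    (hL : 1 ≤ L) (hM : 1 ≤ M) {M2 M' : ℝ} (hM2 : M2 = 2 ^ 180 * (M ^ 3) ^ 81) (hM' : M' = 18 * M2 ^ 4 * M ^ 3) :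
    ∃ (X0 Y0 : Finset ℤ) (C : Set ℝ), AHyp b κ L M' X0 Y0 C := by
  classical
  have hL0 : 0 < L := by linarith
  have hM0 : 0 < M := by linarith
  have hLb : 0 < L ^ b := by positivity
  have hM21 : 1 ≤ M2 := by
    rw [hM2]
    have h1 : (1:ℝ) ≤ 2 ^ 180 := one_le_pow₀ (by norm_num)
    have h2 : (1:ℝ) ≤ (M ^ 3) ^ 81 := one_le_pow₀ (one_le_pow₀ hM)
    nlinarith
  have hM20 : 0 < M2 := by linarith
  set n := M * L ^ b with hn
  have hn0 : 0 < n := by positivity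
  have hB : ∀ θ : ι, ∃ X' Y' : Finset ℤ, θ ∈ T → (X' ⊆ X ∧ Y' ⊆ Y ∧
      n ^ 2 / M2 ≤ (((G θ).filter (fun p => p.1 ∈ X' ∧ p.2 ∈ Y')).card : ℝ) ∧
      ((X' - X').card : ℝ) ≤ M2 * n ∧ ((Y' - Y').card : ℝ) ≤ M2 * n) := by
    intro θ
    by_cases hθ : θ ∈ T
    · have hc : n ^ 2 / M ^ 3 ≤ (G θ).card := by
        refine le_trans (le_of_eq ?_) (h.Gc θ hθ)
        rw [hn]; field_simp
      have hi : (((G θ).image (fun t => fl (p θ) (q θ) t.1 t.2)).card : ℝ) ≤ M ^ 3 * n := by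
        refine (h.Gi θ hθ).trans ?_
        have : (1:ℝ) ≤ M ^ 3 := one_le_pow₀ hM
        nlinarith
      obtain ⟨X', h1, Y', h2, h3, h4, h5⟩ := bsg_two X Y (G θ) (h.Gs θ hθ) hn0 (one_le_pow₀ hM) h.cX h.cY hc
        (h.p1 θ hθ).1 (h.q1 θ hθ).1 hi
      rw [← hM2] at h3 h4 h5
      exact ⟨X', Y', fun _ => ⟨h1, h2, h3, h4, h5⟩⟩
    · exact ⟨∅, ∅, fun h => absurd h hθ⟩
  choose XX YY hXY using hB
  set H : ι → Finset (ℤ × ℤ) := fun θ => (G θ).filter (fun p => p.1 ∈ XX θ ∧ p.2 ∈ YY θ) with hH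
  have hZ : ((X ×ˢ Y).card : ℝ) ≤ n ^ 2 := by
    rw [Finset.card_product]; push_cast
    have := h.cX
    have := h.cY
    rw [sq]
    exact mul_le_mul h.cX h.cY (by positivity) hn0.le
  obtain ⟨θ0, hθ0, hpick⟩ := cs_pick T (X ×ˢ Y) ν H h.ν0 h.ν1 (σ := 1 / M) (h := n ^ 2 / M2) (z := n ^ 2)
    (by positivity) (by positivity) (by positivity) h.νM
    (fun θ hθ => (Finset.filter_subset _ _).trans (h.Gs θ hθ)) (fun θ hθ => (hXY θ hθ).2.2.1) hZ
  have e1 : (1 / M * (n ^ 2 / M2)) ^ 2 / (2 * (n ^ 2) ^ 2) = 1 / (2 * M ^ 2 * M2 ^ 2) := by field_simp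
  have e2 : (1 / M * (n ^ 2 / M2)) ^ 2 / (2 * n ^ 2) = n ^ 2 / (2 * M ^ 2 * M2 ^ 2) := by field_simp
  rw [e1, e2] at hpick
  set T' := T.filter (fun θ => n ^ 2 / (2 * M ^ 2 * M2 ^ 2) ≤ ((H θ ∩ H θ0).card : ℝ)) with hT'
  obtain ⟨hX0, hY0, hH0, hdX, hdY⟩ := hXY θ0 hθ0
  have hM'1 : 2 * M ^ 3 * M2 ^ 2 ≤ M' := by
    rw [hM']
    have : (1:ℝ) ≤ M2 ^ 2 := one_le_pow₀ hM21
    have e : 18 * M2 ^ 4 * M ^ 3 = (2 * M ^ 3 * M2 ^ 2) * (9 * M2 ^ 2) := by ring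
    rw [e]
    have : 0 < 2 * M ^ 3 * M2 ^ 2 := by positivity
    nlinarith
  have hm2 : M2 ≤ M2 ^ 2 := by nlinarith
  have hm3 : M ≤ M ^ 3 := by nlinarith [mul_pos hM0 hM0]
  have hM'2 : M * M2 ≤ M' := by
    have : M * M2 ≤ M ^ 3 * M2 ^ 2 := mul_le_mul hm3 hm2 (by positivity) (by positivity)
    nlinarith [mul_pos hM0 hM20]
  have hM'M2 : M2 ≤ M' := by nlinarith
  have hM'M : M ≤ M' := by nlinarith
  have hM'0 : 0 < M' := by linarith
  have hXc : ((XX θ0).card : ℝ) ≤ n := le_trans (by exact_mod_cast Finset.card_le_card hX0) h.cX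
  have hYc : ((YY θ0).card : ℝ) ≤ n := le_trans (by exact_mod_cast Finset.card_le_card hY0) h.cY
  have hHsub : H θ0 ⊆ XX θ0 ×ˢ YY θ0 := by
    intro t ht
    exact Finset.mem_product.2 (Finset.mem_filter.1 ht).2
  have hprod : n ^ 2 / M2 ≤ ((XX θ0).card : ℝ) * (YY θ0).card := by
    refine hH0.trans ?_
    have := Finset.card_le_card hHsub
    rw [Finset.card_product] at this
    exact_mod_cast this
  have hlow1 : ∀ a c : ℝ, 0 ≤ a → c ≤ n → n ^ 2 / M2 ≤ a * c → L ^ b / M' ≤ a := by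
    intro a c ha hc hac
    have h1 : n ^ 2 / M2 ≤ a * n := hac.trans (mul_le_mul_of_nonneg_left hc ha)
    have h2 : n / M2 ≤ a := by
      have : n ^ 2 / M2 = (n / M2) * n := by ring
      rw [this] at h1
      exact le_of_mul_le_mul_right h1 hn0
    refine le_trans ?_ h2
    have : L ^ b ≤ n := by rw [hn]; nlinarith
    exact div_le_div₀ hn0.le this hM20 hM'M2
  have hM'n : M2 * n ≤ M' * L ^ b := by
    rw [hn, ← mul_assoc]
    refine mul_le_mul_of_nonneg_right ?_ hLb.le
    linarith
  refine ⟨XX θ0, YY θ0, (fun θ => q θ / p θ) '' T', ?_⟩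
  constructor
  · exact hlow1 _ _ (by positivity) hYc hprod
  · exact hlow1 _ _ (by positivity) hXc (by rw [mul_comm]; exact hprod)
  · exact hdX.trans hM'n
  · exact hdY.trans hM'n
  · intro x hx x' hx'
    exact (h.bd x (hX0 hx) x' (hX0 hx')).trans (mul_le_mul_of_nonneg_right hM'M hL0.le)
  · rintro _ ⟨θ, hθ, rfl⟩
    have hθ' := Finset.mem_filter.1 (Finset.mem_coe.1 hθ)
    obtain ⟨hθT, hθc⟩ := hθ'
    obtain ⟨hp1, hp2⟩ := h.p1 θ hθT
    obtain ⟨hq1, hq2⟩ := h.q1 θ hθT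
    refine ⟨?_, ?_, ?_⟩
    · simp only [abs_div]
      refine div_le_div₀ (by positivity) hq1 (by linarith) (by linarith)
    · simp only [abs_div]
      rw [div_le_iff₀ (by linarith)]
      nlinarith
    · simp only
      refine (fl_div _ hp1).trans ?_
      set P := H θ ∩ H θ0 with hP
      have hPpos : (0:ℝ) < P.card := lt_of_lt_of_le (by positivity) hθc
      have hPne : P.Nonempty := by
        rw [← Finset.card_pos]; exact_mod_cast hPpos
      have him : ((P.image (fun t => fl (p θ) (q θ) t.1 t.2)).card : ℝ) ≤ n := by
        refine le_trans ?_ (h.Gi θ hθT)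
        exact_mod_cast Finset.card_le_card (Finset.image_subset_image
          (Finset.inter_subset_left.trans (Finset.filter_subset _ _)))
      obtain ⟨s, hs⟩ := exists_popular P (fun t => fl (p θ) (q θ) t.1 t.2) hn0 hθc him hPne
      have htri := fl_triangle (XX θ0) (YY θ0) hp1 (P.filter (fun t => fl (p θ) (q θ) t.1 t.2 = s))
        ((Finset.filter_subset _ _).trans (Finset.inter_subset_right.trans hHsub)) s
        (fun t ht => (Finset.mem_filter.1 ht).2) hs
      set I := (((XX θ0 ×ˢ YY θ0).image (fun t => fl (p θ) (q θ) t.1 t.2)).card : ℝ) with hI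
      have h1 : 3 * ((XX θ0 - XX θ0).card : ℝ) * (YY θ0 - YY θ0).card ≤ 3 * (M2 * n) * (M2 * n) := by
        refine mul_le_mul (by linarith) hdY (by positivity) (by positivity)
      have h2 := htri.trans h1
      have e3 : n ^ 2 / (2 * M ^ 2 * M2 ^ 2) / n = n / (2 * M ^ 2 * M2 ^ 2) := by field_simp
      rw [e3] at h2
      have h3 : I ≤ 6 * M2 ^ 4 * M ^ 2 * n := by
        have h4 : I * n ≤ (6 * M2 ^ 4 * M ^ 2 * n) * n := by
          have : I * n = (I * (n / (2 * M ^ 2 * M2 ^ 2))) * (2 * M ^ 2 * M2 ^ 2) := by field_simp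
          rw [this]
          refine (mul_le_mul_of_nonneg_right h2 (by positivity)).trans (le_of_eq (by ring))
        exact le_of_mul_le_mul_right h4 hn0
      calc 3 * I ≤ 3 * (6 * M2 ^ 4 * M ^ 2 * n) := by linarith
        _ = M' * L ^ b := by rw [hM', hn]; ring
  · intro ρ hρ1 hρ2
    have hρ0 : 0 < ρ := lt_of_lt_of_le (by positivity) hρ1
    obtain ⟨S, hS, hsep, hcov⟩ := exists_max_sep hρ0 (T'.image (fun θ => q θ / p θ))
    refine ⟨S, ?_, hsep, ?_⟩
    · intro s hs
      obtain ⟨θ, hθ, rfl⟩ := Finset.mem_image.1 (hS hs)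
      exact ⟨θ, hθ, rfl⟩
    · have h1 := cover_sum T' S (fun θ s => |q θ / p θ - s| ≤ ρ) ν
        (fun θ hθ => (h.ν0 θ (Finset.mem_filter.1 hθ).1).le) (by
          intro θ hθ
          obtain ⟨t, ht, h2⟩ := hcov _ (Finset.mem_image_of_mem _ hθ)
          exact ⟨t, ht, h2.le⟩)
      have h2 : ∑ s ∈ S, ∑ θ ∈ T'.filter (fun θ => |q θ / p θ - s| ≤ ρ), ν θ ≤ ∑ s ∈ S, M * ρ ^ κ := by
        refine Finset.sum_le_sum fun s _ => le_trans ?_ (h.νc ρ hρ1 hρ2 s)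
        refine Finset.sum_le_sum_of_subset_of_nonneg
          (Finset.filter_subset_filter _ (Finset.filter_subset _ _)) ?_
        intro θ hθ _
        exact (h.ν0 θ (Finset.mem_filter.1 hθ).1).le
      rw [Finset.sum_const, nsmul_eq_mul] at h2
      have h3 := hpick.trans (h1.trans h2)
      rw [div_le_iff₀ (by positivity)] at h3
      have hρκ : 0 < ρ ^ κ := by positivity
      rw [Real.rpow_neg hρ0.le, inv_le_iff_one_le_mul₀ hρκ]
      calc 1 ≤ (S.card : ℝ) * (M * ρ ^ κ) * (2 * M ^ 2 * M2 ^ 2) := h3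
        _ = (2 * M ^ 3 * M2 ^ 2) * (S.card * ρ ^ κ) := by ring
        _ ≤ M' * (S.card * ρ ^ κ) := mul_le_mul_of_nonneg_right hM'1 (by positivity)
        _ = _ := by ring
  · intro u hu FX FY hFX hFY
    have hu0 : 0 < u := by linarith
    have h1 := cover_sum (H θ0) (FX ×ˢ FY) (fun t f => |(t.1:ℝ) - f.1| ≤ u ∧ |(t.2:ℝ) - f.2| ≤ u) w
      (fun t _ => h.w0 t) (by
        intro t ht
        have := Finset.mem_product.1 (hHsub ht)
        obtain ⟨f, hf, h1⟩ := hFX _ this.1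
        obtain ⟨g, hg, h2⟩ := hFY _ this.2
        exact ⟨(f, g), Finset.mem_product.2 ⟨hf, hg⟩, h1, h2⟩)
    have h2 : ∑ f ∈ FX ×ˢ FY, ∑ t ∈ (H θ0).filter (fun t => |(t.1:ℝ) - f.1| ≤ u ∧ |(t.2:ℝ) - f.2| ≤ u), w t ≤
        ∑ f ∈ FX ×ˢ FY, M * (u / L) ^ (2 * b) := by
      refine Finset.sum_le_sum fun f _ => le_trans ?_ (h.wu u hu f.1 f.2)
      refine Finset.sum_le_sum_of_subset_of_nonneg
        (Finset.filter_subset_filter _ ((Finset.filter_subset _ _).trans (h.Gs θ0 hθ0))) ?_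
      intro t _ _
      exact h.w0 t
    rw [Finset.sum_const, nsmul_eq_mul, Finset.card_product] at h2
    have h3 : ∑ t ∈ H θ0, 1 / (M * (L ^ b) ^ 2) ≤ ∑ t ∈ H θ0, w t :=
      Finset.sum_le_sum fun t ht => h.wl θ0 hθ0 t (Finset.mem_filter.1 ht).1
    rw [Finset.sum_const, nsmul_eq_mul] at h3
    have h4 : 1 / M2 ≤ ((H θ0).card : ℝ) * (1 / (M * (L ^ b) ^ 2)) := by
      refine le_trans ?_ (mul_le_mul_of_nonneg_right hH0 (by positivity))
      have : n ^ 2 / M2 * (1 / (M * (L ^ b) ^ 2)) = M / M2 := by rw [hn]; field_simp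
      rw [this]
      exact div_le_div_of_nonneg_right hM hM20.le
    have h5 := (h4.trans h3).trans (h1.trans h2)
    have e4 : (L / u) ^ (2 * b) = ((u / L) ^ (2 * b))⁻¹ := by
      rw [← Real.inv_rpow (by positivity), inv_div]
    have hr : 0 < (u / L) ^ (2 * b) := by positivity
    rw [e4, inv_le_iff_one_le_mul₀ hr]
    rw [div_le_iff₀ hM20] at h5
    push_cast at h5
    calc 1 ≤ (FX.card : ℝ) * FY.card * (M * (u / L) ^ (2 * b)) * M2 := h5
      _ = (M * M2) * (FX.card * FY.card * (u / L) ^ (2 * b)) := by ring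
      _ ≤ M' * (FX.card * FY.card * (u / L) ^ (2 * b)) := mul_le_mul_of_nonneg_right hM'2 (by positivity)
      _ = _ := by ring

theorem layerB {b κ : ℝ} (hb0 : 0 < b) (hb1 : b < 1) (hκ : 0 < κ) (hκ1 : κ ≤ 1) :
    ∃ ε : ℝ, 0 < ε ∧ ∃ L0 : ℝ, ∀ L : ℝ, L0 ≤ L → ∀ M : ℝ, 1 ≤ M → M ≤ L ^ ε →
      ∀ (X Y : Finset ℤ) (T : Finset ℝ) (ν p q : ℝ → ℝ) (G : ℝ → Finset (ℤ × ℤ)) (w : ℤ × ℤ → ℝ),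
      BHyp b κ L M X Y T ν p q G w → False := by
  obtain ⟨ε, hε, L0, h⟩ := layerA hb0 hb1 hκ hκ1
  obtain ⟨L1, hL1⟩ := Filter.eventually_atTop.1 (ev_rpow (18 * (2 ^ 180) ^ 4) (975 * (ε / 2000)) ε (by linarith))
  refine ⟨ε / 2000, by positivity, max L0 (max L1 1), ?_⟩
  intro L hL M hM hML X Y T ν p q G w hB
  have hL0 : L0 ≤ L := (le_max_left _ _).trans hL
  have hL1' : L1 ≤ L := (le_max_left _ _).trans ((le_max_right _ _).trans hL)
  have hL2 : 1 ≤ L := (le_max_right _ _).trans ((le_max_right _ _).trans hL)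
  obtain ⟨X0, Y0, C, hA⟩ := hB.ahyp hb0 hL2 hM rfl rfl
  refine h L hL0 _ ?_ ?_ X0 Y0 C hA
  · have h1 : (1:ℝ) ≤ (2 ^ 180 * (M ^ 3) ^ 81) ^ 4 :=
      one_le_pow₀ (one_le_mul_of_one_le_of_one_le (one_le_pow₀ (by norm_num)) (one_le_pow₀ (one_le_pow₀ hM)))
    have h2 : (1:ℝ) ≤ M ^ 3 := one_le_pow₀ hM
    nlinarith
  · have h1 := hL1 L hL1'
    have h2 : M ^ 975 ≤ L ^ (975 * (ε / 2000)) := by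
      calc M ^ 975 ≤ (L ^ (ε / 2000)) ^ 975 := pow_le_pow_left₀ (by linarith) hML 975
        _ = _ := by rw [← Real.rpow_natCast, ← Real.rpow_mul (by linarith)]; congr 1; push_cast; ring
    have e : 18 * (2 ^ 180 * (M ^ 3) ^ 81) ^ 4 * M ^ 3 = (18 * (2 ^ 180) ^ 4) * M ^ 975 := by
      rw [mul_pow, ← pow_mul, ← pow_mul]
      have : M ^ 975 = M ^ (3 * 81 * 4) * M ^ 3 := by rw [← pow_add]
      rw [this]; ring
    rw [e]
    exact (mul_le_mul_of_nonneg_left h2 (by positivity)).trans h1.le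

end BP

open MeasureTheory
open scoped ENNReal Pointwise

namespace BP

lemma abs_sin_ge {x : ℝ} (hx : |x| ≤ 1) : |x| / 2 ≤ |Real.sin x| := by
  have h1 : |Real.sin x| = Real.sin |x| := by
    rcases abs_cases x with ⟨h, h0⟩ | ⟨h, h0⟩
    · rw [h, abs_of_nonneg]
      rw [h] at hx
      exact Real.sin_nonneg_of_nonneg_of_le_pi h0 (by linarith [Real.pi_gt_three])
    · rw [h, Real.sin_neg, abs_of_nonpos]
      rw [h] at hx
      have := Real.sin_nonneg_of_nonneg_of_le_pi (x := -x) (by linarith) (by linarith [Real.pi_gt_three])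
      rw [Real.sin_neg] at this; linarith
  rw [h1]
  have h2 := Real.mul_le_sin (abs_nonneg x) (by linarith [Real.pi_gt_three])
  have h3 : (1:ℝ) / 2 ≤ 2 / Real.pi := by
    rw [div_le_div_iff₀ (by norm_num) Real.pi_pos]; linarith [Real.pi_le_four]
  nlinarith [abs_nonneg x]

/-- projection -/
noncomputable def pr (θ : ℝ) (p : ℝ × ℝ) : ℝ := p.1 * Real.cos θ + p.2 * Real.sin θ

lemma pr_identity (θ θ1 θ2 : ℝ) (p : ℝ × ℝ) :
    Real.sin (θ2 - θ1) * pr θ p = Real.sin (θ2 - θ) * pr θ1 p + Real.sin (θ - θ1) * pr θ2 p := by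
  simp only [pr, Real.sin_sub]; ring

lemma pr_solve1 (θ1 θ2 : ℝ) (p : ℝ × ℝ) :
    Real.sin (θ2 - θ1) * p.1 = Real.sin θ2 * pr θ1 p - Real.sin θ1 * pr θ2 p := by
  simp only [pr, Real.sin_sub]; ring

lemma pr_solve2 (θ1 θ2 : ℝ) (p : ℝ × ℝ) :
    Real.sin (θ2 - θ1) * p.2 = Real.cos θ1 * pr θ2 p - Real.cos θ2 * pr θ1 p := by
  simp only [pr, Real.sin_sub]; ring

lemma sin_identity (θ θ' θ1 θ2 : ℝ) :
    Real.sin (θ - θ1) * Real.sin (θ2 - θ') - Real.sin (θ' - θ1) * Real.sin (θ2 - θ) =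
      Real.sin (θ2 - θ1) * Real.sin (θ - θ') := by
  simp only [Real.sin_sub]
  have h := Real.sin_sq_add_cos_sq θ
  have h1 := Real.sin_sq_add_cos_sq θ1
  have h2 := Real.sin_sq_add_cos_sq θ2
  have h3 := Real.sin_sq_add_cos_sq θ'
  ring

lemma pr_sub (θ : ℝ) (p q : ℝ × ℝ) : pr θ (p - q) = pr θ p - pr θ q := by simp [pr]; ring

lemma abs_pr_le {θ R : ℝ} {p : ℝ × ℝ} (h1 : |p.1| ≤ R) (h2 : |p.2| ≤ R) : |pr θ p| ≤ 2 * R := by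
  have a1 := Real.abs_cos_le_one θ
  have a2 := Real.abs_sin_le_one θ
  have : |pr θ p| ≤ |p.1| * |Real.cos θ| + |p.2| * |Real.sin θ| := by
    unfold pr; refine (abs_add_le _ _).trans ?_; rw [abs_mul, abs_mul]
  nlinarith [abs_nonneg p.1, abs_nonneg p.2]

lemma sum_le_far {T : Finset ℝ} {ν : ℝ → ℝ} (hν : ∀ θ ∈ T, 0 ≤ ν θ) (hν1 : ∑ θ ∈ T, ν θ = 1) (f : ℝ → ℝ) {a : ℝ}
    (h : a ≤ ∑ θ ∈ T, ν θ * f θ) : ∃ θ ∈ T, a ≤ f θ := by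
  by_contra hcon
  push Not at hcon
  have hpos : ∃ θ ∈ T, 0 < ν θ := by
    by_contra hc
    push Not at hc
    have : ∑ θ ∈ T, ν θ ≤ 0 := Finset.sum_nonpos hc
    linarith
  obtain ⟨θ0, hθ0, hp⟩ := hpos
  have : ∑ θ ∈ T, ν θ * f θ < ∑ θ ∈ T, ν θ * a := by
    refine Finset.sum_lt_sum (fun θ hθ => mul_le_mul_of_nonneg_left (hcon θ hθ).le (hν θ hθ)) ⟨θ0, hθ0, ?_⟩
    exact mul_lt_mul_of_pos_left (hcon θ0 hθ0) hp
  rw [← Finset.sum_mul, hν1, one_mul] at this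
  linarith

lemma triple_pick {T : Finset ℝ} {ν : ℝ → ℝ} (hν : ∀ θ ∈ T, 0 ≤ ν θ) (hν1 : ∑ θ ∈ T, ν θ = 1)
    (m : ℝ → ℝ → ℝ → ℝ) (hm0 : ∀ a ∈ T, ∀ b ∈ T, ∀ c ∈ T, 0 ≤ m a b c)
    (hm1 : ∀ a ∈ T, ∀ b ∈ T, ∀ c ∈ T, m a b c ≤ 1) {δ r : ℝ} (hδ : 0 < δ)
    (hsum : 4 * δ ≤ ∑ a ∈ T, ν a * ∑ b ∈ T, ν b * ∑ c ∈ T, ν c * m a b c)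
    (hclose : ∀ a ∈ T, ∑ b ∈ T.filter (fun b => |b - a| ≤ r), ν b ≤ δ / 3) :
    ∃ a ∈ T, ∃ b ∈ T, r < |b - a| ∧
      2 * δ ≤ ∑ c ∈ T.filter (fun c => (r < |c - a| ∧ r < |c - b|) ∧ δ ≤ m a b c), ν c := by
  classical
  -- indicator of closeness
  set cl : ℝ → ℝ → ℝ := fun a b => if |b - a| ≤ r then 1 else 0 with hcl
  have hcl0 : ∀ a b, 0 ≤ cl a b := by intro a b; simp only [hcl]; split_ifs <;> norm_num
  have hclsum : ∀ a ∈ T, ∑ b ∈ T, ν b * cl a b ≤ δ / 3 := by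
    intro a ha
    refine le_trans (le_of_eq ?_) (hclose a ha)
    rw [Finset.sum_filter]
    refine Finset.sum_congr rfl fun b _ => ?_
    simp only [hcl]; split_ifs <;> simp
  set F : ℝ → ℝ → ℝ → ℝ := fun a b c => if r < |b - a| ∧ r < |c - a| ∧ r < |c - b| then m a b c else 0 with hF
  have hmF : ∀ a ∈ T, ∀ b ∈ T, ∀ c ∈ T, m a b c ≤ F a b c + cl a b + cl a c + cl b c := by
    intro a ha b hb c hc
    simp only [hF, hcl]
    by_cases h1 : |b - a| ≤ r
    · have := hcl0 a c; have := hcl0 b c; simp only [hcl] at *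
      rw [if_neg (by push Not; intro h; linarith), if_pos h1]
      linarith [hm1 a ha b hb c hc]
    by_cases h2 : |c - a| ≤ r
    · have := hcl0 a b; have := hcl0 b c; simp only [hcl] at *
      rw [if_neg (by push Not; intro _ h; linarith), if_pos h2]
      linarith [hm1 a ha b hb c hc]
    by_cases h3 : |c - b| ≤ r
    · have := hcl0 a b; have := hcl0 a c; simp only [hcl] at *
      rw [if_neg (by push Not; intro _ _; linarith), if_pos h3]
      linarith [hm1 a ha b hb c hc]
    · push Not at h1 h2 h3
      rw [if_pos ⟨h1, h2, h3⟩]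
      have := hcl0 a b; have := hcl0 a c; have := hcl0 b c; simp only [hcl] at *
      linarith
  have hS : 3 * δ ≤ ∑ a ∈ T, ν a * ∑ b ∈ T, ν b * ∑ c ∈ T, ν c * F a b c := by
    have h1 : ∀ a ∈ T, ∀ b ∈ T, ∑ c ∈ T, ν c * m a b c ≤ (∑ c ∈ T, ν c * F a b c) + cl a b + δ / 3 + δ / 3 := by
      intro a ha b hb
      calc ∑ c ∈ T, ν c * m a b c ≤ ∑ c ∈ T, (ν c * F a b c + ν c * cl a b + ν c * cl a c + ν c * cl b c) := by
            refine Finset.sum_le_sum fun c hc => ?_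
            have := mul_le_mul_of_nonneg_left (hmF a ha b hb c hc) (hν c hc)
            linarith
        _ = (∑ c ∈ T, ν c * F a b c) + (∑ c ∈ T, ν c) * cl a b + (∑ c ∈ T, ν c * cl a c) + ∑ c ∈ T, ν c * cl b c := by
            rw [Finset.sum_add_distrib, Finset.sum_add_distrib, Finset.sum_add_distrib, Finset.sum_mul]
        _ ≤ _ := by
            rw [hν1]
            have := hclsum a ha; have := hclsum b hb
            linarith
    have h2 : ∀ a ∈ T, ∑ b ∈ T, ν b * ∑ c ∈ T, ν c * m a b c ≤ (∑ b ∈ T, ν b * ∑ c ∈ T, ν c * F a b c) + δ := by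
      intro a ha
      calc ∑ b ∈ T, ν b * ∑ c ∈ T, ν c * m a b c
          ≤ ∑ b ∈ T, (ν b * (∑ c ∈ T, ν c * F a b c) + ν b * cl a b + ν b * (δ / 3 + δ / 3)) := by
            refine Finset.sum_le_sum fun b hb => ?_
            have := mul_le_mul_of_nonneg_left (h1 a ha b hb) (hν b hb)
            linarith
        _ = (∑ b ∈ T, ν b * ∑ c ∈ T, ν c * F a b c) + (∑ b ∈ T, ν b * cl a b) + (∑ b ∈ T, ν b) * (δ / 3 + δ / 3) := by
            rw [Finset.sum_add_distrib, Finset.sum_add_distrib, Finset.sum_mul]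
        _ ≤ _ := by
            rw [hν1]
            have := hclsum a ha
            linarith
    have h3 : ∑ a ∈ T, ν a * ∑ b ∈ T, ν b * ∑ c ∈ T, ν c * m a b c ≤
        (∑ a ∈ T, ν a * ∑ b ∈ T, ν b * ∑ c ∈ T, ν c * F a b c) + δ := by
      calc _ ≤ ∑ a ∈ T, (ν a * (∑ b ∈ T, ν b * ∑ c ∈ T, ν c * F a b c) + ν a * δ) := by
            refine Finset.sum_le_sum fun a ha => ?_
            have := mul_le_mul_of_nonneg_left (h2 a ha) (hν a ha)
            linarith
        _ = _ := by rw [Finset.sum_add_distrib, ← Finset.sum_mul, hν1, one_mul]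
    linarith
  obtain ⟨a, ha, h1⟩ := sum_le_far hν hν1 _ hS
  obtain ⟨b, hb, h2⟩ := sum_le_far hν hν1 _ h1
  refine ⟨a, ha, b, hb, ?_, ?_⟩
  · by_contra hc
    have : ∑ c ∈ T, ν c * F a b c = 0 := by
      refine Finset.sum_eq_zero fun c _ => ?_
      simp only [hF]
      rw [if_neg (fun h => hc h.1), mul_zero]
    linarith
  · have h3 : ∑ c ∈ T, ν c * F a b c ≤
        (∑ c ∈ T.filter (fun c => (r < |c - a| ∧ r < |c - b|) ∧ δ ≤ m a b c), ν c) + ∑ c ∈ T, ν c * δ := by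
      rw [Finset.sum_filter, ← Finset.sum_add_distrib]
      refine Finset.sum_le_sum fun c hc => ?_
      have hνc := hν c hc
      have := hm1 a ha b hb c hc
      simp only [hF]
      split_ifs with k1 k2 k2
      · nlinarith
      · have : m a b c < δ := by
          by_contra hh
          push Not at hh
          exact k2 ⟨k1.2, hh⟩
        nlinarith
      · nlinarith
      · nlinarith
    rw [← Finset.sum_mul, hν1] at h3
    linarith

end BP

open MeasureTheory
open scoped ENNReal Pointwise

namespace BP

structure DHyp (b κ L K : ℝ) (P : Finset (ℝ × ℝ)) (μ : ℝ × ℝ → ℝ) (T : Finset ℝ) (ν : ℝ → ℝ)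
    (A : ℝ → Finset (ℝ × ℝ)) : Prop where
  diam : ∀ p ∈ P, ∀ p' ∈ P, |p.1 - p'.1| ≤ L ∧ |p.2 - p'.2| ≤ L
  μ0 : ∀ p ∈ P, 0 ≤ μ p
  μ1 : ∑ p ∈ P, μ p = 1
  μu : ∀ u : ℝ, 1 ≤ u → ∀ p0 : ℝ × ℝ,
    ∑ p ∈ P.filter (fun p => |p.1 - p0.1| ≤ u ∧ |p.2 - p0.2| ≤ u), μ p ≤ K * (u / L) ^ (2 * b)
  Td : ∀ θ ∈ T, ∀ θ' ∈ T, |θ - θ'| ≤ 1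
  ν0 : ∀ θ ∈ T, 0 ≤ ν θ
  ν1 : ∑ θ ∈ T, ν θ = 1
  νu : ∀ ρ : ℝ, 1 / L ≤ ρ → ∀ c : ℝ, ∑ θ ∈ T.filter (fun θ => |θ - c| ≤ ρ), ν θ ≤ K * ρ ^ κ
  As : ∀ θ ∈ T, A θ ⊆ P
  Am : ∀ θ ∈ T, 1 / K ≤ ∑ p ∈ A θ, μ p
  Ai : ∀ θ ∈ T, (((A θ).image (fun p => ⌊pr θ p⌋)).card : ℝ) ≤ K * L ^ b

lemma DHyp.triple {b κ L K R : ℝ} {P : Finset (ℝ × ℝ)} {μ : ℝ × ℝ → ℝ} {T : Finset ℝ} {ν : ℝ → ℝ}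
    {A : ℝ → Finset (ℝ × ℝ)} (h : DHyp b κ L K P μ T ν A)
    (hK : 1 ≤ K) (hR : 1 ≤ R) (hRL : R ≤ L) (h12 : 12 * K ^ 4 ≤ R ^ κ) :
    ∃ θ1 ∈ T, ∃ θ2 ∈ T, 1 / R < |θ2 - θ1| ∧
      2 * (1 / (4 * K ^ 3)) ≤ ∑ θ ∈ T.filter (fun θ => (1 / R < |θ - θ1| ∧ 1 / R < |θ - θ2|) ∧
        1 / (4 * K ^ 3) ≤ ∑ p ∈ (A θ1 ∩ A θ2) ∩ A θ, μ p), ν θ := by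
  classical
  have hK0 : 0 < K := by linarith
  have hR0 : 0 < R := by linarith
  have hsub : ∀ a ∈ T, ∀ b, ∀ c, (A a ∩ A b) ∩ A c ⊆ P := fun a ha b c =>
    (Finset.inter_subset_left.trans Finset.inter_subset_left).trans (h.As a ha)
  refine triple_pick h.ν0 h.ν1 (fun a b c => ∑ p ∈ (A a ∩ A b) ∩ A c, μ p) ?_ ?_ (δ := 1 / (4 * K ^ 3)) (by positivity) ?_ ?_
  · intro a ha b _ c _
    exact Finset.sum_nonneg fun p hp => h.μ0 p (hsub a ha b c hp)
  · intro a ha b _ c _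
    rw [← h.μ1]
    exact Finset.sum_le_sum_of_subset_of_nonneg (hsub a ha b c) fun p hp _ => h.μ0 p hp
  · set N : ℝ × ℝ → ℝ := fun p => ∑ θ ∈ T, ν θ * (if p ∈ A θ then 1 else 0) with hN
    have hm : ∀ S : Finset (ℝ × ℝ), S ⊆ P → ∑ p ∈ S, μ p = ∑ p ∈ P, μ p * (if p ∈ S then (1:ℝ) else 0) := by
      intro S hS
      simp only [mul_ite, mul_one, mul_zero]
      rw [Finset.sum_ite_mem, Finset.inter_eq_right.2 hS]
    have h1 : 1 / K ≤ ∑ p ∈ P, μ p * N p := by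
      have : ∑ p ∈ P, μ p * N p = ∑ θ ∈ T, ν θ * ∑ p ∈ A θ, μ p := by
        simp only [hN, Finset.mul_sum]
        rw [Finset.sum_comm]
        refine Finset.sum_congr rfl fun θ hθ => ?_
        rw [← Finset.mul_sum, hm _ (h.As θ hθ), Finset.mul_sum]
        refine Finset.sum_congr rfl fun p _ => by ring
      rw [this]
      calc 1 / K = ∑ θ ∈ T, ν θ * (1 / K) := by rw [← Finset.sum_mul, h.ν1, one_mul]
        _ ≤ _ := Finset.sum_le_sum fun θ hθ => mul_le_mul_of_nonneg_left (h.Am θ hθ) (h.ν0 θ hθ)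
    have hN0 : ∀ p ∈ P, 0 ≤ N p := by
      intro p _
      refine Finset.sum_nonneg fun θ hθ => mul_nonneg (h.ν0 θ hθ) ?_
      split_ifs <;> norm_num
    have h2 := Real.pow_arith_mean_le_arith_mean_pow P μ N h.μ0 h.μ1 hN0 3
    have h3 : ∑ p ∈ P, μ p * N p ^ 3 = ∑ a ∈ T, ν a * ∑ b ∈ T, ν b * ∑ c ∈ T, ν c * ∑ p ∈ (A a ∩ A b) ∩ A c, μ p := by
      have e : ∀ p ∈ P, μ p * N p ^ 3 = ∑ a ∈ T, ∑ b ∈ T, ∑ c ∈ T,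
          ν a * (ν b * (ν c * (μ p * (if p ∈ (A a ∩ A b) ∩ A c then (1:ℝ) else 0)))) := by
        intro p _
        have : μ p * N p ^ 3 = N p * (N p * (μ p * N p)) := by ring
        rw [this]
        simp only [hN]
        rw [Finset.sum_mul]
        refine Finset.sum_congr rfl fun a _ => ?_
        rw [Finset.sum_mul, Finset.mul_sum]
        refine Finset.sum_congr rfl fun b _ => ?_
        rw [Finset.mul_sum, Finset.mul_sum, Finset.mul_sum]
        refine Finset.sum_congr rfl fun c _ => ?_
        simp only [Finset.mem_inter]
        by_cases k1 : p ∈ A a <;> by_cases k2 : p ∈ A b <;> by_cases k3 : p ∈ A c <;>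
          simp only [k1, k2, k3, and_true, and_false, false_and, if_true, if_false] <;> ring
      rw [Finset.sum_congr rfl e, Finset.sum_comm]
      refine Finset.sum_congr rfl fun a ha => ?_
      rw [Finset.sum_comm, Finset.mul_sum]
      refine Finset.sum_congr rfl fun b _ => ?_
      rw [Finset.sum_comm, Finset.mul_sum, Finset.mul_sum]
      refine Finset.sum_congr rfl fun c _ => ?_
      rw [hm _ (hsub a ha b c), Finset.mul_sum, Finset.mul_sum, Finset.mul_sum]
    rw [← h3]
    refine le_trans ?_ h2
    have e4 : 4 * (1 / (4 * K ^ 3)) = (1 / K) ^ 3 := by field_simp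
    rw [e4]
    exact pow_le_pow_left₀ (by positivity) h1 3
  · intro a _
    have h1 := h.νu (1 / R) (one_div_le_one_div_of_le hR0 hRL) a
    refine h1.trans ?_
    rw [one_div, Real.inv_rpow hR0.le]
    have hRκ : 0 < R ^ κ := by positivity
    rw [← div_eq_mul_inv, div_le_iff₀ hRκ]
    have : K = 1 / (4 * K ^ 3) / 3 * (12 * K ^ 4) := by field_simp; norm_num
    calc K = 1 / (4 * K ^ 3) / 3 * (12 * K ^ 4) := this
      _ ≤ _ := mul_le_mul_of_nonneg_left h12 (by positivity)

end BP

open MeasureTheory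
open scoped ENNReal Pointwise

namespace BP

/-- The mass of a parallelogram. -/
lemma DHyp.par {b κ L K R : ℝ} {P : Finset (ℝ × ℝ)} {μ : ℝ × ℝ → ℝ} {T : Finset ℝ} {ν : ℝ → ℝ}
    {A : ℝ → Finset (ℝ × ℝ)} (h : DHyp b κ L K P μ T ν A) (hb0 : 0 < b) (hb1 : b < 1)
    (hK : 1 ≤ K) (hR : 1 ≤ R) (hL : 1 ≤ L) {θ1 θ2 : ℝ} (hσ : 1 / (2 * R) ≤ |Real.sin (θ2 - θ1)|)
    (S : Finset (ℝ × ℝ)) (hS : S ⊆ P) {u x0 y0 : ℝ} (hu : 1 ≤ u)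
    (h1 : ∀ p ∈ S, |pr θ1 p - x0| ≤ 2 * u) (h2 : ∀ p ∈ S, |pr θ2 p - y0| ≤ 2 * u) :
    ∑ p ∈ S, μ p ≤ 256 * K * R ^ 2 * (u / L) ^ (2 * b) := by
  have hR0 : 0 < R := by linarith
  have hL0 : 0 < L := by linarith
  have hu0 : 0 < u := by linarith
  rcases S.eq_empty_or_nonempty with rfl | ⟨p0, hp0⟩
  · rw [Finset.sum_empty]; positivity
  have hσ0 : 0 < |Real.sin (θ2 - θ1)| := lt_of_lt_of_le (by positivity) hσ
  have hRσ : 1 ≤ 2 * R * |Real.sin (θ2 - θ1)| := by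
    rw [div_le_iff₀ (by positivity)] at hσ; linarith
  have hsub : S ⊆ P.filter (fun p => |p.1 - p0.1| ≤ 16 * R * u ∧ |p.2 - p0.2| ≤ 16 * R * u) := by
    intro p hp
    refine Finset.mem_filter.2 ⟨hS hp, ?_⟩
    have k1 : |pr θ1 (p - p0)| ≤ 4 * u := by
      rw [pr_sub]
      calc |pr θ1 p - pr θ1 p0| = |(pr θ1 p - x0) - (pr θ1 p0 - x0)| := by congr 1; ring
        _ ≤ _ := (abs_sub _ _).trans (by linarith [h1 p hp, h1 p0 hp0])
    have k2 : |pr θ2 (p - p0)| ≤ 4 * u := by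
      rw [pr_sub]
      calc |pr θ2 p - pr θ2 p0| = |(pr θ2 p - y0) - (pr θ2 p0 - y0)| := by congr 1; ring
        _ ≤ _ := (abs_sub _ _).trans (by linarith [h2 p hp, h2 p0 hp0])
    have gen : ∀ (z s c a a' : ℝ), Real.sin (θ2 - θ1) * z = s * a - c * a' → |s| ≤ 1 → |c| ≤ 1 → |a| ≤ 4 * u →
        |a'| ≤ 4 * u → |z| ≤ 16 * R * u := by
      intro z s c a a' e hs hc ha ha'
      have h3 : |Real.sin (θ2 - θ1)| * |z| ≤ 8 * u := by
        rw [← abs_mul, e]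
        refine (abs_sub _ _).trans ?_
        rw [abs_mul, abs_mul]
        nlinarith [abs_nonneg s, abs_nonneg c, abs_nonneg a, abs_nonneg a']
      have h4 : |z| ≤ 2 * R * (|Real.sin (θ2 - θ1)| * |z|) := by
        nlinarith [abs_nonneg z]
      nlinarith
    exact ⟨gen _ _ _ _ _ (pr_solve1 θ1 θ2 (p - p0)) (Real.abs_sin_le_one _) (Real.abs_sin_le_one _) k1 k2,
      gen _ _ _ _ _ (pr_solve2 θ1 θ2 (p - p0)) (Real.abs_cos_le_one _) (Real.abs_cos_le_one _) k2 k1⟩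
  have h3 : ∑ p ∈ S, μ p ≤ K * (16 * R * u / L) ^ (2 * b) :=
    (Finset.sum_le_sum_of_subset_of_nonneg hsub fun p hp _ => h.μ0 p (Finset.mem_filter.1 hp).1).trans
      (h.μu _ (by nlinarith) p0)
  refine h3.trans ?_
  have e : 16 * R * u / L = (16 * R) * (u / L) := by ring
  have h4 : (16 * R) ^ (2 * b) ≤ (16 * R) ^ 2 := by
    rw [← Real.rpow_natCast (16 * R) 2]
    exact Real.rpow_le_rpow_of_exponent_le (by linarith) (by push_cast; linarith)
  rw [e, Real.mul_rpow (by positivity) (by positivity)]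
  have h5 : 0 ≤ (u / L) ^ (2 * b) := by positivity
  calc K * ((16 * R) ^ (2 * b) * (u / L) ^ (2 * b)) ≤ K * ((16 * R) ^ 2 * (u / L) ^ (2 * b)) :=
        mul_le_mul_of_nonneg_left (mul_le_mul_of_nonneg_right h4 h5) (by linarith)
    _ = _ := by ring

set_option maxHeartbeats 2000000 in
lemma DHyp.bhyp {b κ L K R : ℝ} {P : Finset (ℝ × ℝ)} {μ : ℝ × ℝ → ℝ} {T : Finset ℝ} {ν : ℝ → ℝ}
    {A : ℝ → Finset (ℝ × ℝ)} (h : DHyp b κ L K P μ T ν A) (hb0 : 0 < b) (hb1 : b < 1) (hκ : 0 < κ) (hκ1 : κ ≤ 1)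
    (hK : 1 ≤ K) (hR : 1 ≤ R) (hRL : R ≤ L) (h12 : 12 * K ^ 4 ≤ R ^ κ) :
    ∃ (X Y : Finset ℤ) (T' : Finset ℝ) (p q : ℝ → ℝ) (G : ℝ → Finset (ℤ × ℤ)) (w : ℤ × ℤ → ℝ),
      BHyp b κ L (2048 * K ^ 5 * R ^ 2) X Y T' ν p q G w := by
  classical
  obtain ⟨θ1, hθ1, θ2, hθ2, hfar, hbig⟩ := h.triple hK hR hRL h12
  have hK0 : 0 < K := by linarith
  have hR0 : 0 < R := by linarith
  have hL : 1 ≤ L := hR.trans hRL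
  have hL0 : 0 < L := by linarith
  have hLb : 0 < L ^ b := by positivity
  obtain ⟨δ, hδ⟩ : ∃ δ, δ = 1 / (4 * K ^ 3) := ⟨_, rfl⟩
  have hδ0 : 0 < δ := by rw [hδ]; positivity
  rw [← hδ] at hbig
  obtain ⟨M, hM⟩ : ∃ M, M = 2048 * K ^ 5 * R ^ 2 := ⟨_, rfl⟩
  rw [← hM]
  have hKp : ∀ i j : ℕ, i ≤ j → K ^ i ≤ K ^ j := fun i j hij => pow_le_pow_right₀ hK hij
  have hR2 : R ≤ R ^ 2 := by nlinarith
  have hR1 : 1 ≤ R ^ 2 := by nlinarith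
  have hMb : ∀ c s : ℝ, ∀ i ≤ 5, 0 ≤ c → c ≤ 2048 → 0 ≤ s → s ≤ R ^ 2 → c * K ^ i * s ≤ M := by
    intro c s i hi hc0 hc hs0 hs
    rw [hM]
    have := hKp i 5 hi
    refine mul_le_mul (mul_le_mul hc this (by positivity) (by norm_num)) hs hs0 (by positivity)
  have hM1 : 1 ≤ M := by
    refine le_trans ?_ (hMb 1 1 0 (by norm_num) (by norm_num) (by norm_num) (by norm_num) hR1); norm_num
  have hMK : K ≤ M := by
    refine le_trans ?_ (hMb 1 1 1 (by norm_num) (by norm_num) (by norm_num) (by norm_num) hR1); norm_num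
  have hM0 : 0 < M := by linarith
  set A' := A θ1 ∩ A θ2 with hA'
  have hA'P : A' ⊆ P := Finset.inter_subset_left.trans (h.As θ1 hθ1)
  set X := A'.image (fun p => ⌊pr θ1 p⌋) with hX
  set Y := A'.image (fun p => ⌊pr θ2 p⌋) with hY
  have hXc : (X.card : ℝ) ≤ K * L ^ b := by
    refine le_trans ?_ (h.Ai θ1 hθ1)
    exact_mod_cast Finset.card_le_card (Finset.image_subset_image Finset.inter_subset_left)
  have hYc : (Y.card : ℝ) ≤ K * L ^ b := by
    refine le_trans ?_ (h.Ai θ2 hθ2)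
    exact_mod_cast Finset.card_le_card (Finset.image_subset_image Finset.inter_subset_right)
  set φ : ℝ × ℝ → ℤ × ℤ := fun p => (⌊pr θ1 p⌋, ⌊pr θ2 p⌋) with hφ
  have hφm : ∀ p ∈ A', φ p ∈ X ×ˢ Y := fun p hp => Finset.mem_product.2
    ⟨Finset.mem_image_of_mem (fun p => ⌊pr θ1 p⌋) hp, Finset.mem_image_of_mem (fun p => ⌊pr θ2 p⌋) hp⟩
  have hμA : ∀ p ∈ A', 0 ≤ μ p := fun p hp => h.μ0 p (hA'P hp)
  set wt : Finset (ℝ × ℝ) → ℤ × ℤ → ℝ := fun S t => ∑ p ∈ S.filter (fun p => φ p = t), μ p with hwt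
  set T1 := T.filter (fun θ => (1 / R < |θ - θ1| ∧ 1 / R < |θ - θ2|) ∧ δ ≤ ∑ p ∈ A' ∩ A θ, μ p) with hT1
  set T' := T1.filter (fun θ => 0 < ν θ) with hT'
  have hT'T : ∀ θ ∈ T', θ ∈ T := fun θ hθ => (Finset.mem_filter.1 (Finset.mem_filter.1 hθ).1).1
  have hT'p : ∀ θ ∈ T', (1 / R < |θ - θ1| ∧ 1 / R < |θ - θ2|) ∧ δ ≤ ∑ p ∈ A' ∩ A θ, μ p :=
    fun θ hθ => (Finset.mem_filter.1 (Finset.mem_filter.1 hθ).1).2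
  have hsin : ∀ a ∈ T, ∀ b ∈ T, 1 / R < |a - b| → 1 / (2 * R) ≤ |Real.sin (a - b)| := by
    intro a ha b hb hab
    refine le_trans ?_ (abs_sin_ge (h.Td a ha b hb))
    have : 1 / (2 * R) = 1 / R / 2 := by field_simp
    rw [this]; linarith
  have hσ := hsin θ2 hθ2 θ1 hθ1 hfar
  have hw_u : ∀ u : ℝ, 1 ≤ u → ∀ x0 y0 : ℝ,
      ∑ t ∈ (X ×ˢ Y).filter (fun t => |(t.1:ℝ) - x0| ≤ u ∧ |(t.2:ℝ) - y0| ≤ u), wt A' t ≤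
        256 * K * R ^ 2 * (u / L) ^ (2 * b) := by
    intro u hu x0 y0
    set Z := (X ×ˢ Y).filter (fun t => |(t.1:ℝ) - x0| ≤ u ∧ |(t.2:ℝ) - y0| ≤ u) with hZ
    have e : ∑ t ∈ Z, wt A' t = ∑ p ∈ A'.filter (fun p => φ p ∈ Z), μ p := by
      rw [← Finset.sum_fiberwise_of_maps_to (s := A'.filter (fun p => φ p ∈ Z)) (t := Z) (g := φ)
        (fun p hp => (Finset.mem_filter.1 hp).2)]
      refine Finset.sum_congr rfl fun t ht => ?_
      simp only [hwt]
      refine Finset.sum_congr ?_ fun _ _ => rfl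
      ext p
      simp only [Finset.mem_filter]
      constructor
      · rintro ⟨h1, h2⟩; exact ⟨⟨h1, h2 ▸ ht⟩, h2⟩
      · rintro ⟨⟨h1, _⟩, h2⟩; exact ⟨h1, h2⟩
    rw [e]
    have gen : ∀ a x0 : ℝ, |(⌊a⌋ : ℝ) - x0| ≤ u → |a - x0| ≤ 2 * u := by
      intro a x0 ha
      have k1 := Int.floor_le a
      have k2 := Int.lt_floor_add_one a
      rw [abs_le] at ha ⊢
      constructor <;> linarith
    refine h.par hb0 hb1 hK hR hL hσ _ ((Finset.filter_subset _ _).trans hA'P) (x0 := x0) (y0 := y0) hu ?_ ?_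
    · intro p hp
      exact gen _ _ (Finset.mem_filter.1 (Finset.mem_filter.1 hp).2).2.1
    · intro p hp
      exact gen _ _ (Finset.mem_filter.1 (Finset.mem_filter.1 hp).2).2.2
  obtain ⟨η, hη⟩ : ∃ η, η = δ / (2 * (K * L ^ b) ^ 2) := ⟨_, rfl⟩
  have hη0 : 0 < η := by rw [hη]; positivity
  set G : ℝ → Finset (ℤ × ℤ) := fun θ => (X ×ˢ Y).filter (fun t => η ≤ wt (A' ∩ A θ) t) with hG
  have hw1 : ∀ θ t, wt (A' ∩ A θ) t ≤ wt A' t := by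
    intro θ t
    refine Finset.sum_le_sum_of_subset_of_nonneg (Finset.filter_subset_filter _ Finset.inter_subset_left) ?_
    intro p hp _
    exact hμA p (Finset.mem_filter.1 hp).1
  have hw0 : ∀ t, 0 ≤ wt A' t := fun t => Finset.sum_nonneg fun p hp => hμA p (Finset.mem_filter.1 hp).1
  have hwle : ∀ t ∈ X ×ˢ Y, wt A' t ≤ 256 * K * R ^ 2 * (1 / L) ^ (2 * b) := by
    intro t ht
    refine le_trans ?_ (hw_u 1 le_rfl t.1 t.2)
    exact Finset.single_le_sum (f := wt A') (fun t _ => hw0 t) (Finset.mem_filter.2 ⟨ht, by simp⟩)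
  refine ⟨X, Y, T', fun θ => 2 * R * Real.sin (θ2 - θ), fun θ => 2 * R * Real.sin (θ - θ1), G, wt A', ?_⟩
  have hLb2 : (1 / L) ^ (2 * b) = 1 / (L ^ b) ^ 2 := by
    rw [one_div, Real.inv_rpow hL0.le, ← Real.rpow_natCast (L ^ b) 2, ← Real.rpow_mul hL0.le, one_div]
    congr 2; push_cast; ring
  constructor
  · exact hXc.trans (mul_le_mul_of_nonneg_right hMK hLb.le)
  · exact hYc.trans (mul_le_mul_of_nonneg_right hMK hLb.le)
  · intro x hx x' hx'
    obtain ⟨p, hp, rfl⟩ := Finset.mem_image.1 hx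
    obtain ⟨p', hp', rfl⟩ := Finset.mem_image.1 hx'
    have hd := h.diam p (hA'P hp) p' (hA'P hp')
    have h1 := abs_pr_le (θ := θ1) (p := p - p') hd.1 hd.2
    rw [pr_sub] at h1
    have k1 := Int.floor_le (pr θ1 p)
    have k2 := Int.lt_floor_add_one (pr θ1 p)
    have k3 := Int.floor_le (pr θ1 p')
    have k4 := Int.lt_floor_add_one (pr θ1 p')
    have : (3:ℝ) ≤ M := by
      refine le_trans ?_ (hMb 3 1 0 (by norm_num) (by norm_num) (by norm_num) (by norm_num) hR1); norm_num
    have : 3 * L ≤ M * L := mul_le_mul_of_nonneg_right this hL0.le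
    rw [abs_le] at h1 ⊢
    constructor <;> linarith
  · intro θ hθ; exact (Finset.mem_filter.1 hθ).2
  · rw [← h.ν1]
    exact Finset.sum_le_sum_of_subset_of_nonneg hT'T fun θ hθ _ => h.ν0 θ hθ
  · have e : ∑ θ ∈ T', ν θ = ∑ θ ∈ T1, ν θ := by
      refine Finset.sum_subset (Finset.filter_subset _ _) ?_
      intro θ hθ hn
      have h1 := h.ν0 θ (Finset.mem_filter.1 hθ).1
      by_contra hne
      exact hn (Finset.mem_filter.2 ⟨hθ, lt_of_le_of_ne h1 (Ne.symm hne)⟩)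
    rw [e]
    refine le_trans ?_ hbig
    have h1 : 2 * K ^ 3 ≤ M := by
      have := hMb 2 1 3 (by norm_num) (by norm_num) (by norm_num) (by norm_num) hR1; linarith
    have h2 : 2 * δ = 1 / (2 * K ^ 3) := by rw [hδ]; field_simp; norm_num
    rw [h2]
    exact one_div_le_one_div_of_le (by positivity) h1
  · intro θ hθ
    have h1 := hsin θ2 hθ2 θ (hT'T θ hθ) (by rw [abs_sub_comm]; exact (hT'p θ hθ).1.2)
    have h2 := Real.abs_sin_le_one (θ2 - θ)
    rw [abs_mul, abs_of_pos (show (0:ℝ) < 2 * R by positivity)]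
    rw [div_le_iff₀ (by positivity)] at h1
    refine ⟨by linarith, ?_⟩
    have : 2 * R ≤ M := by
      have := hMb 2 R 0 (by norm_num) (by norm_num) (by norm_num) hR0.le hR2; linarith
    nlinarith
  · intro θ hθ
    have h1 := hsin θ (hT'T θ hθ) θ1 hθ1 (hT'p θ hθ).1.1
    have h2 := Real.abs_sin_le_one (θ - θ1)
    rw [abs_mul, abs_of_pos (show (0:ℝ) < 2 * R by positivity)]
    rw [div_le_iff₀ (by positivity)] at h1
    refine ⟨by linarith, ?_⟩
    have : 2 * R ≤ M := by
      have := hMb 2 R 0 (by norm_num) (by norm_num) (by norm_num) hR0.le hR2; linarith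
    nlinarith
  · intro θ _; exact Finset.filter_subset _ _
  · intro θ hθ
    have h1 := (hT'p θ hθ).2
    have h2 : ∑ p ∈ A' ∩ A θ, μ p = ∑ t ∈ X ×ˢ Y, wt (A' ∩ A θ) t := by
      rw [← Finset.sum_fiberwise_of_maps_to (s := A' ∩ A θ) (t := X ×ˢ Y) (g := φ)
        (fun p hp => hφm p (Finset.mem_inter.1 hp).1)]
    have h3 : ∑ t ∈ X ×ˢ Y, wt (A' ∩ A θ) t ≤
        ((G θ).card : ℝ) * (256 * K * R ^ 2 * (1 / L) ^ (2 * b)) + ((X ×ˢ Y).card : ℝ) * η := by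
      have e1 : ((G θ).card : ℝ) * (256 * K * R ^ 2 * (1 / L) ^ (2 * b)) =
          ∑ t ∈ X ×ˢ Y, if η ≤ wt (A' ∩ A θ) t then (256 * K * R ^ 2 * (1 / L) ^ (2 * b)) else 0 := by
        rw [← Finset.sum_filter, Finset.sum_const, nsmul_eq_mul]
      have e2 : ((X ×ˢ Y).card : ℝ) * η = ∑ t ∈ X ×ˢ Y, η := by rw [Finset.sum_const, nsmul_eq_mul]
      rw [e1, e2, ← Finset.sum_add_distrib]
      refine Finset.sum_le_sum fun t ht => ?_
      split_ifs with hc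
      · have := (hw1 θ t).trans (hwle t ht); linarith
      · push Not at hc; linarith
    have h4 : ((X ×ˢ Y).card : ℝ) * η ≤ δ / 2 := by
      have : ((X ×ˢ Y).card : ℝ) ≤ (K * L ^ b) ^ 2 := by
        rw [Finset.card_product]; push_cast; rw [sq]
        exact mul_le_mul hXc hYc (by positivity) (by positivity)
      calc ((X ×ˢ Y).card : ℝ) * η ≤ (K * L ^ b) ^ 2 * η := mul_le_mul_of_nonneg_right this hη0.le
        _ = δ / 2 := by rw [hη]; field_simp
    have h5 : δ / 2 ≤ ((G θ).card : ℝ) * (256 * K * R ^ 2 * (1 / L) ^ (2 * b)) := by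
      rw [← h2] at h3; linarith
    rw [hLb2] at h5
    have hMx : 2048 * K ^ 4 * R ^ 2 ≤ M := hMb 2048 (R ^ 2) 4 (by norm_num) (by norm_num) le_rfl (by positivity) le_rfl
    rw [div_le_iff₀ hM0]
    have h6 : (L ^ b) ^ 2 ≤ (G θ).card * (2048 * K ^ 4 * R ^ 2) := by
      have h7 := mul_le_mul_of_nonneg_right h5 (show 0 ≤ 8 * K ^ 3 * (L ^ b) ^ 2 by positivity)
      calc (L ^ b) ^ 2 = δ / 2 * (8 * K ^ 3 * (L ^ b) ^ 2) := by rw [hδ]; field_simp; norm_num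
        _ ≤ _ := h7
        _ = _ := by field_simp; ring
    exact h6.trans (mul_le_mul_of_nonneg_left hMx (by positivity))
  · intro θ hθ
    obtain ⟨I, hI, hIc⟩ : ∃ I : Finset ℤ, (I.card : ℝ) ≤ 17 * R ∧ ∀ i : ℤ, |(i:ℝ)| ≤ 6 * R + 2 → i ∈ I := by
      refine ⟨Finset.Icc (-⌊6 * R + 2⌋) ⌊6 * R + 2⌋, ?_, ?_⟩
      · rw [Int.card_Icc]
        have h0 : 0 ≤ ⌊6 * R + 2⌋ := Int.floor_nonneg.2 (by positivity)
        have h2 : ((⌊6 * R + 2⌋ + 1 - -⌊6 * R + 2⌋).toNat : ℤ) = ⌊6 * R + 2⌋ + 1 - -⌊6 * R + 2⌋ :=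
          Int.toNat_of_nonneg (by linarith)
        have h3 : ((⌊6 * R + 2⌋ + 1 - -⌊6 * R + 2⌋).toNat : ℝ) = ((⌊6 * R + 2⌋ + 1 - -⌊6 * R + 2⌋ : ℤ) : ℝ) := by
          exact_mod_cast h2
        rw [h3]; push_cast
        have := Int.floor_le (6 * R + 2)
        linarith
      · intro i hi
        rw [abs_le] at hi
        rw [Finset.mem_Icc]
        constructor
        · have : -i ≤ ⌊6 * R + 2⌋ := Int.le_floor.2 (by push_cast; linarith)
          linarith
        · exact Int.le_floor.2 hi.2
    set V := (A θ).image (fun p => ⌊pr θ p⌋) with hV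
    have hVc := h.Ai θ (hT'T θ hθ)
    have hsub : (G θ).image (fun t => fl (2 * R * Real.sin (θ2 - θ)) (2 * R * Real.sin (θ - θ1)) t.1 t.2) ⊆
        (V ×ˢ I).image (fun r => ⌊2 * R * Real.sin (θ2 - θ1) * (r.1:ℝ)⌋ + r.2) := by
      intro v hv
      obtain ⟨t, ht, rfl⟩ := Finset.mem_image.1 hv
      have ht2 := (Finset.mem_filter.1 ht).2
      have hne : ((A' ∩ A θ).filter (fun p => φ p = t)).Nonempty := by
        by_contra hc
        rw [Finset.not_nonempty_iff_eq_empty] at hc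
        simp only [hwt, hc, Finset.sum_empty] at ht2
        linarith
      obtain ⟨p, hp⟩ := hne
      obtain ⟨hp1, hp2⟩ := Finset.mem_filter.1 hp
      have hpA := (Finset.mem_inter.1 hp1).2
      refine Finset.mem_image.2 ⟨(⌊pr θ p⌋, fl (2 * R * Real.sin (θ2 - θ)) (2 * R * Real.sin (θ - θ1)) t.1 t.2 -
        ⌊2 * R * Real.sin (θ2 - θ1) * (⌊pr θ p⌋:ℝ)⌋), Finset.mem_product.2 ⟨Finset.mem_image_of_mem (fun p => ⌊pr θ p⌋) hpA, ?_⟩,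
        by ring⟩
      refine hIc _ ?_
      rw [← hp2]
      simp only [hφ, fl]
      have hid := pr_identity θ θ1 θ2 p
      have s0 := Real.abs_sin_le_one (θ2 - θ1)
      have s1 := Real.abs_sin_le_one (θ2 - θ)
      have s2 := Real.abs_sin_le_one (θ - θ1)
      have fr : ∀ (s a : ℝ), |s| ≤ 1 → |2 * R * s * (a - ⌊a⌋)| ≤ 2 * R := by
        intro s a hs
        have k1 := Int.floor_le a
        have k2 := Int.lt_floor_add_one a
        have k3 : |a - ⌊a⌋| ≤ 1 := by rw [abs_le]; constructor <;> linarith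
        rw [abs_mul, abs_mul, abs_of_pos (show (0:ℝ) < 2 * R by positivity)]
        have k4 : |s| * |a - ⌊a⌋| ≤ 1 := by nlinarith [abs_nonneg s, abs_nonneg (a - ⌊a⌋)]
        rw [mul_assoc]
        nlinarith
      have f0 := abs_le.1 (fr _ (pr θ p) s0)
      have f1 := abs_le.1 (fr _ (pr θ1 p) s1)
      have f2 := abs_le.1 (fr _ (pr θ2 p) s2)
      have hid2 : 2 * R * Real.sin (θ2 - θ1) * pr θ p =
          2 * R * Real.sin (θ2 - θ) * pr θ1 p + 2 * R * Real.sin (θ - θ1) * pr θ2 p := by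
        rw [mul_assoc, hid]; ring
      rw [mul_sub] at f0 f1 f2
      set a1 := 2 * R * Real.sin (θ2 - θ) * (⌊pr θ1 p⌋:ℝ)
      set a2 := 2 * R * Real.sin (θ - θ1) * (⌊pr θ2 p⌋:ℝ)
      set a0 := 2 * R * Real.sin (θ2 - θ1) * (⌊pr θ p⌋:ℝ)
      have k1 := Int.floor_le (a1 + a2)
      have k2 := Int.lt_floor_add_one (a1 + a2)
      have k3 := Int.floor_le a0
      have k4 := Int.lt_floor_add_one a0
      push_cast
      rw [abs_le]
      constructor <;> linarith
    have h1 : (((G θ).image (fun t => fl (2 * R * Real.sin (θ2 - θ)) (2 * R * Real.sin (θ - θ1)) t.1 t.2)).card : ℝ) ≤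
        (V.card : ℝ) * I.card := by
      have := (Finset.card_le_card hsub).trans Finset.card_image_le
      rw [Finset.card_product] at this
      exact_mod_cast this
    refine h1.trans ((mul_le_mul hVc hI (by positivity) (by positivity)).trans ?_)
    have h2 := hMb 17 R 1 (by norm_num) (by norm_num) (by norm_num) hR0.le hR2
    calc K * L ^ b * (17 * R) = (17 * K ^ 1 * R) * L ^ b := by ring
      _ ≤ _ := mul_le_mul_of_nonneg_right h2 hLb.le
  · exact hw0
  · intro θ hθ t ht
    refine le_trans ?_ ((Finset.mem_filter.1 ht).2.trans (hw1 θ t))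
    have h1 := hMb 8 1 5 (by norm_num) (by norm_num) (by norm_num) (by norm_num) hR1
    have h2 : η = 1 / ((8 * K ^ 5 * 1) * (L ^ b) ^ 2) := by rw [hη, hδ]; field_simp; norm_num
    rw [h2]
    exact one_div_le_one_div_of_le (by positivity) (mul_le_mul_of_nonneg_right h1 (by positivity))
  · intro u hu x0 y0
    refine (hw_u u hu x0 y0).trans ?_
    have h1 := hMb 256 (R ^ 2) 1 (by norm_num) (by norm_num) (by norm_num) (by positivity) le_rfl
    rw [pow_one] at h1
    exact mul_le_mul_of_nonneg_right h1 (by positivity)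
  · intro ρ hρ1 hρ2 c0
    have hρ0 : 0 < ρ := lt_of_lt_of_le (by positivity) hρ1
    set Z := T'.filter (fun θ => |2 * R * Real.sin (θ - θ1) / (2 * R * Real.sin (θ2 - θ)) - c0| ≤ ρ) with hZ
    rcases Z.eq_empty_or_nonempty with hZe | ⟨a, ha⟩
    · rw [hZe, Finset.sum_empty]; positivity
    have hZT : ∀ θ ∈ Z, θ ∈ T := fun θ hθ => hT'T θ (Finset.mem_filter.1 hθ).1
    have hsubZ : Z ⊆ T.filter (fun θ => |θ - a| ≤ 8 * R * ρ) := by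
      intro θ hθ
      refine Finset.mem_filter.2 ⟨hZT θ hθ, ?_⟩
      have g1 : ∀ θ ∈ Z, |Real.sin (θ - θ1) / Real.sin (θ2 - θ) - c0| ≤ ρ ∧ Real.sin (θ2 - θ) ≠ 0 := by
        intro θ hθ
        have h1 := (Finset.mem_filter.1 hθ).2
        have h2 := hsin θ2 hθ2 θ (hZT θ hθ)
          (by rw [abs_sub_comm]; exact (hT'p θ (Finset.mem_filter.1 hθ).1).1.2)
        have h3 : Real.sin (θ2 - θ) ≠ 0 := abs_pos.1 (lt_of_lt_of_le (by positivity) h2)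
        rw [mul_div_mul_left _ _ (by positivity)] at h1
        exact ⟨h1, h3⟩
      obtain ⟨h1, h1'⟩ := g1 θ hθ
      obtain ⟨h2, h2'⟩ := g1 a ha
      have h3 : |Real.sin (θ - θ1) / Real.sin (θ2 - θ) - Real.sin (a - θ1) / Real.sin (θ2 - a)| ≤ 2 * ρ := by
        rw [abs_le] at h1 h2 ⊢; constructor <;> linarith
      have e : Real.sin (θ - θ1) / Real.sin (θ2 - θ) - Real.sin (a - θ1) / Real.sin (θ2 - a) =
          (Real.sin (θ2 - θ1) * Real.sin (θ - a)) / (Real.sin (θ2 - θ) * Real.sin (θ2 - a)) := by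
        rw [← sin_identity, div_sub_div _ _ h1' h2']
        congr 1; ring
      rw [e, abs_div, abs_mul, abs_mul, div_le_iff₀ (mul_pos (abs_pos.2 h1') (abs_pos.2 h2'))] at h3
      have h4 := abs_sin_ge (h.Td θ (hZT θ hθ) a (hZT a ha))
      have h5 : |Real.sin (θ2 - θ)| * |Real.sin (θ2 - a)| ≤ 1 :=
        mul_le_one₀ (Real.abs_sin_le_one _) (abs_nonneg _) (Real.abs_sin_le_one _)
      have h6 : 1 / (2 * R) * (|θ - a| / 2) ≤ 2 * ρ := by
        refine (mul_le_mul hσ h4 (by positivity) (abs_nonneg _)).trans (h3.trans ?_)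
        nlinarith
      have h7 : |θ - a| = 4 * R * (1 / (2 * R) * (|θ - a| / 2)) := by field_simp; norm_num
      rw [h7]
      calc 4 * R * (1 / (2 * R) * (|θ - a| / 2)) ≤ 4 * R * (2 * ρ) := mul_le_mul_of_nonneg_left h6 (by positivity)
        _ = _ := by ring
    have h1 : ∑ θ ∈ Z, ν θ ≤ K * (8 * R * ρ) ^ κ :=
      (Finset.sum_le_sum_of_subset_of_nonneg hsubZ fun θ hθ _ => h.ν0 θ (Finset.mem_filter.1 hθ).1).trans
        (h.νu _ (by nlinarith) a)
    refine h1.trans ?_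
    rw [Real.mul_rpow (by positivity) hρ0.le]
    have h2 : (8 * R) ^ κ ≤ 8 * R := by
      calc (8 * R) ^ κ ≤ (8 * R) ^ (1:ℝ) := Real.rpow_le_rpow_of_exponent_le (by linarith) hκ1
        _ = _ := Real.rpow_one _
    have h3 := hMb 8 R 1 (by norm_num) (by norm_num) (by norm_num) hR0.le hR2
    have h4 : 0 ≤ ρ ^ κ := by positivity
    calc K * ((8 * R) ^ κ * ρ ^ κ) ≤ K * ((8 * R) * ρ ^ κ) :=
          mul_le_mul_of_nonneg_left (mul_le_mul_of_nonneg_right h2 h4) hK0.le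
      _ = (8 * K ^ 1 * R) * ρ ^ κ := by ring
      _ ≤ _ := mul_le_mul_of_nonneg_right h3 h4

end BP

open MeasureTheory
open scoped ENNReal
namespace BP

/-- Discretised projection theorem, at a single scale. -/
theorem thmD (b κ : ℝ) (hb0 : 0 < b) (hb1 : b < 1) (hκ : 0 < κ) (hκ1 : κ ≤ 1) :
    ∃ ε : ℝ, 0 < ε ∧ ∃ L0 : ℝ, ∀ L : ℝ, L0 ≤ L → ∀ K : ℝ, 1 ≤ K → K ≤ L ^ ε →
      ∀ (P : Finset (ℝ × ℝ)) (μ : ℝ × ℝ → ℝ) (T : Finset ℝ) (ν : ℝ → ℝ)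
        (A : ℝ → Finset (ℝ × ℝ)), DHyp b κ L K P μ T ν A → False := by
  obtain ⟨εB, hεB, L1, hB⟩ := layerB hb0 hb1 hκ hκ1
  set e : ℝ := min εB 1 with he
  have he0 : 0 < e := lt_min hεB one_pos
  have heB : e ≤ εB := min_le_left _ _
  have he1 : e ≤ 1 := min_le_right _ _
  set D : ℝ := 5 + 8 / κ with hD
  have hD0 : 0 < D := by positivity
  set ε : ℝ := e / (2 * D) with hε
  have hε0 : 0 < ε := by positivity
  have hεD : ε * D = e / 2 := by rw [hε]; field_simp
  set C : ℝ := 2048 * ((12:ℝ) ^ (1/κ)) ^ 2 with hC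
  have h12 : (1:ℝ) ≤ (12:ℝ) ^ (1/κ) := Real.one_le_rpow (by norm_num) (by positivity)
  have hev := ev_rpow C (e/2) e (by linarith)
  obtain ⟨L2, hL2⟩ := Filter.eventually_atTop.1 hev
  refine ⟨ε, hε0, max (max L1 L2) 1, ?_⟩
  intro L hL K hK hKL P μ T ν A h
  have hLL1 : L1 ≤ L := le_trans (le_trans (le_max_left _ _) (le_max_left _ _)) hL
  have hLL2 : L2 ≤ L := le_trans (le_trans (le_max_right _ _) (le_max_left _ _)) hL
  have hL1 : 1 ≤ L := le_trans (le_max_right _ _) hL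
  have hL0 : 0 < L := by linarith
  have hK0 : 0 < K := by linarith
  set R : ℝ := (12 * K ^ 4) ^ (1/κ) with hR
  have h12K : (1:ℝ) ≤ 12 * K ^ 4 := by
    have := one_le_pow₀ hK (n := 4); linarith
  have hR1 : 1 ≤ R := Real.one_le_rpow h12K (by positivity)
  have hRκ : R ^ κ = 12 * K ^ 4 := by
    rw [hR, ← Real.rpow_mul (by linarith)]
    rw [one_div_mul_cancel hκ.ne', Real.rpow_one]
  have hRe : R = (12:ℝ) ^ (1/κ) * K ^ (4/κ) := by
    rw [hR, Real.mul_rpow (by norm_num) (by positivity)]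
    congr 1
    rw [← Real.rpow_natCast, ← Real.rpow_mul hK0.le]
    congr 1; push_cast; ring
  have hM : 2048 * K ^ 5 * R ^ 2 = C * K ^ D := by
    have : K ^ D = K ^ 5 * (K ^ (4/κ)) ^ 2 := by
      rw [hD, Real.rpow_add hK0, ← Real.rpow_natCast (K ^ (4/κ)) 2, ← Real.rpow_mul hK0.le]
      congr 1
      · rw [← Real.rpow_natCast]; norm_num
      · congr 1; push_cast; ring
    rw [this, hRe, hC]; ring
  have hKD : K ^ D ≤ L ^ (e/2) := by
    calc K ^ D ≤ (L ^ ε) ^ D := Real.rpow_le_rpow hK0.le hKL hD0.le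
      _ = L ^ (e/2) := by rw [← Real.rpow_mul hL0.le, hεD]
  have hC0 : 0 < C := by positivity
  have hMe : 2048 * K ^ 5 * R ^ 2 ≤ L ^ e := by
    rw [hM]
    exact le_trans (mul_le_mul_of_nonneg_left hKD hC0.le) (hL2 L hLL2).le
  have hMB : 2048 * K ^ 5 * R ^ 2 ≤ L ^ εB :=
    hMe.trans (Real.rpow_le_rpow_of_exponent_le hL1 heB)
  have hM1 : 2048 * K ^ 5 * R ^ 2 ≤ L := by
    refine hMe.trans ?_
    calc L ^ e ≤ L ^ (1:ℝ) := Real.rpow_le_rpow_of_exponent_le hL1 he1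
      _ = L := Real.rpow_one L
  have hK5 : 1 ≤ K ^ 5 := one_le_pow₀ hK
  have hRR : R ≤ 2048 * K ^ 5 * R ^ 2 := by nlinarith
  have hM1' : 1 ≤ 2048 * K ^ 5 * R ^ 2 := hR1.trans hRR
  obtain ⟨X, Y, T', p, q, G, w, hh⟩ := h.bhyp hb0 hb1 hκ hκ1 hK hR1 (hRR.trans hM1) hRκ.ge
  exact hB L hLL1 _ hM1' hMB X Y T' ν p q G w hh

end BP

open MeasureTheory
open scoped ENNReal
namespace BP

section content
variable {X ι : Type*}

/-- `C` covers `S` by cells. -/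
def CCov (cell : ℕ → X → ι) (C : Set (ℕ × ι)) (S : Set X) : Prop :=
  ∀ x ∈ S, ∃ k, (k, cell k x) ∈ C

/-- total weight of a family of cells -/
noncomputable def cost (w : ℕ → ℝ≥0∞) (C : Set (ℕ × ι)) : ℝ≥0∞ :=
  ∑' c, C.indicator (fun c => w c.1) c

/-- net content -/
noncomputable def ctt (cell : ℕ → X → ι) (w : ℕ → ℝ≥0∞) (S : Set X) : ℝ≥0∞ :=
  ⨅ (C : Set (ℕ × ι)) (_ : CCov cell C S), cost w C

theorem cost_mono (w : ℕ → ℝ≥0∞) {C D : Set (ℕ × ι)} (h : C ⊆ D) : cost w C ≤ cost w D :=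
  ENNReal.tsum_le_tsum fun c => Set.indicator_le_indicator_of_subset h (fun _ => zero_le) c

theorem cost_iUnion (w : ℕ → ℝ≥0∞) {β : Type*} (C : β → Set (ℕ × ι)) :
    cost w (⋃ n, C n) ≤ ∑' n, cost w (C n) := by
  unfold cost
  rw [ENNReal.tsum_comm]
  refine ENNReal.tsum_le_tsum fun c => ?_
  by_cases hc : c ∈ ⋃ n, C n
  · obtain ⟨n, hn⟩ := Set.mem_iUnion.1 hc
    refine le_trans ?_ (ENNReal.le_tsum n)
    rw [Set.indicator_of_mem hc, Set.indicator_of_mem hn]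
  · rw [Set.indicator_of_notMem hc]; exact zero_le

theorem ctt_le {cell : ℕ → X → ι} (w : ℕ → ℝ≥0∞) {C : Set (ℕ × ι)} {S : Set X}
    (h : CCov cell C S) : ctt cell w S ≤ cost w C := iInf₂_le C h

theorem ctt_mono (cell : ℕ → X → ι) (w : ℕ → ℝ≥0∞) {S S' : Set X} (h : S ⊆ S') :
    ctt cell w S ≤ ctt cell w S' :=
  le_iInf₂ fun _ hC => ctt_le w fun x hx => hC x (h hx)

theorem ctt_exists {cell : ℕ → X → ι} {w : ℕ → ℝ≥0∞} {S : Set X} {c : ℝ≥0∞}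
    (h : ctt cell w S < c) : ∃ C, CCov cell C S ∧ cost w C < c := by
  unfold ctt at h
  simp only [iInf_lt_iff] at h
  obtain ⟨C, hC, h⟩ := h
  exact ⟨C, hC, h⟩

theorem ctt_iUnion (cell : ℕ → X → ι) (w : ℕ → ℝ≥0∞) {β : Type*} [Countable β]
    (S : β → Set X) : ctt cell w (⋃ n, S n) ≤ ∑' n, ctt cell w (S n) := by
  refine ENNReal.le_of_forall_pos_le_add fun ε hε hfin => ?_
  have hε' : (ε : ℝ≥0∞) ≠ 0 := by exact_mod_cast hε.ne'
  obtain ⟨δ, hδ, hδs⟩ := ENNReal.exists_pos_sum_of_countable hε' β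
  have h1 : ∀ n, ∃ C, CCov cell C (S n) ∧ cost w C < ctt cell w (S n) + δ n := by
    intro n
    apply ctt_exists
    refine ENNReal.lt_add_right ?_ (by exact_mod_cast (hδ n).ne')
    exact ne_top_of_le_ne_top hfin.ne (ENNReal.le_tsum n)
  choose C hC hc using h1
  have h2 : CCov cell (⋃ n, C n) (⋃ n, S n) := by
    intro x hx
    obtain ⟨n, hn⟩ := Set.mem_iUnion.1 hx
    obtain ⟨k, hk⟩ := hC n x hn
    exact ⟨k, Set.mem_iUnion.2 ⟨n, hk⟩⟩
  calc ctt cell w (⋃ n, S n) ≤ cost w (⋃ n, C n) := ctt_le w h2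
    _ ≤ ∑' n, cost w (C n) := cost_iUnion w C
    _ ≤ ∑' n, (ctt cell w (S n) + δ n) := ENNReal.tsum_le_tsum fun n => (hc n).le
    _ = ∑' n, ctt cell w (S n) + ∑' n, (δ n : ℝ≥0∞) := ENNReal.tsum_add
    _ ≤ _ := by gcongr

/-- refining partitions -/
def Refi (cell : ℕ → X → ι) : Prop :=
  ∀ k l x y, k ≤ l → cell l x = cell l y → cell k x = cell k y

/-- strict ancestor -/
def SAnc (cell : ℕ → X → ι) (d c : ℕ × ι) : Prop :=
  ∃ x k l, k < l ∧ d = (k, cell k x) ∧ c = (l, cell l x)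

/-- maximal cells of a family -/
def MaxC (cell : ℕ → X → ι) (C : Set (ℕ × ι)) : Set (ℕ × ι) :=
  {c | c ∈ C ∧ ∀ d ∈ C, ¬ SAnc cell d c}

theorem cov_max {cell : ℕ → X → ι} (hr : Refi cell) {C : Set (ℕ × ι)} {S : Set X}
    (h : CCov cell C S) : CCov cell (MaxC cell C) S := by
  classical
  intro x hx
  have hk := h x hx
  refine ⟨Nat.find hk, Nat.find_spec hk, ?_⟩
  rintro d hd ⟨y, k, l, hkl, rfl, he⟩
  rw [Prod.mk.injEq] at he
  obtain ⟨h1, h2⟩ := he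
  rw [h1] at h2
  have h3 := hr k l x y hkl.le h2
  refine Nat.find_min hk (m := k) (by omega) ?_
  rw [h3]; exact hd

theorem strong_sub {cell : ℕ → X → ι} (w : ℕ → ℝ≥0∞) {C D : Set (ℕ × ι)} {S : Set X}
    (hC : CCov cell C S) (hD : CCov cell D S) :
    cost w (MaxC cell (C ∪ D)) + ctt cell w S ≤ cost w C + cost w D := by
  have hcov : CCov cell (((C ∪ D) \ MaxC cell (C ∪ D)) ∪ (C ∩ D)) S := by
    intro x hx
    obtain ⟨k, hk⟩ := hC x hx
    obtain ⟨l, hl⟩ := hD x hx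
    rcases lt_trichotomy k l with h | h | h
    · refine ⟨l, Or.inl ⟨Or.inr hl, fun hm => hm.2 (k, cell k x) (Or.inl hk) ⟨x, k, l, h, rfl, rfl⟩⟩⟩
    · subst h; exact ⟨k, Or.inr ⟨hk, hl⟩⟩
    · refine ⟨k, Or.inl ⟨Or.inl hk, fun hm => hm.2 (l, cell l x) (Or.inr hl) ⟨x, l, k, h, rfl, rfl⟩⟩⟩
  refine (add_le_add_right (ctt_le w hcov) _).trans ?_
  unfold cost
  rw [← ENNReal.tsum_add, ← ENNReal.tsum_add]
  refine ENNReal.tsum_le_tsum fun c => ?_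
  have hsub : c ∈ MaxC cell (C ∪ D) → c ∈ C ∪ D := fun h => h.1
  classical
  simp only [Set.indicator_apply, Set.mem_union, Set.mem_sdiff, Set.mem_inter_iff]
  rw [Set.mem_union] at hsub
  by_cases h1 : c ∈ C <;> by_cases h2 : c ∈ D <;> by_cases h3 : c ∈ MaxC cell (C ∪ D) <;>
    simp_all

theorem ctt_iSup {cell : ℕ → X → ι} (hr : Refi cell) (w : ℕ → ℝ≥0∞) (E : ℕ → Set X)
    (hE : Monotone E) {c : ℝ≥0∞} (h : ∀ n, ctt cell w (E n) ≤ c) :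
    ctt cell w (⋃ n, E n) ≤ c := by
  refine ENNReal.le_of_forall_pos_le_add fun ε hε hfin => ?_
  have hε' : (ε : ℝ≥0∞) ≠ 0 := by exact_mod_cast hε.ne'
  obtain ⟨δ, hδ, hδs⟩ := ENNReal.exists_pos_sum_of_countable hε' ℕ
  have h1 : ∀ n, ∃ C, CCov cell C (E n) ∧ cost w C < ctt cell w (E n) + δ n := by
    intro n
    apply ctt_exists
    exact ENNReal.lt_add_right (ne_top_of_le_ne_top hfin.ne (h n)) (by exact_mod_cast (hδ n).ne')
  choose C hC hc using h1
  let W : ℕ → Set (ℕ × ι) := fun n => Nat.rec (C 0) (fun m V => MaxC cell (V ∪ C (m+1))) n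
  have hW : ∀ n, W (n+1) = MaxC cell (W n ∪ C (n+1)) := fun n => rfl
  have hWcov : ∀ n, CCov cell (W n) (E n) := by
    intro n
    cases n with
    | zero => exact hC 0
    | succ m =>
      rw [hW]; apply cov_max hr
      intro x hx
      obtain ⟨k, hk⟩ := hC (m+1) x hx
      exact ⟨k, Or.inr hk⟩
  have hWsub : ∀ n, W n ⊆ ⋃ m, C m := by
    intro n
    induction n with
    | zero => exact Set.subset_iUnion C 0
    | succ m ih =>
      rw [hW]; intro c hc
      rcases hc.1 with h | h
      · exact ih h
      · exact Set.mem_iUnion.2 ⟨_, h⟩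
  have hcost : ∀ n, cost w (W n) ≤ ctt cell w (E n) + ∑ i ∈ Finset.range (n+1), (δ i : ℝ≥0∞) := by
    intro n
    induction n with
    | zero =>
      have h2 : cost w (W 0) ≤ _ := (hc 0).le
      simpa using h2
    | succ m ih =>
      have h2 := strong_sub w (hWcov m) (fun x hx => hC (m+1) x (hE (Nat.le_succ m) hx))
      rw [← hW] at h2
      have hf : ctt cell w (E m) ≠ ∞ := ne_top_of_le_ne_top hfin.ne (h m)
      have h3 : ctt cell w (E m) + cost w (W (m+1)) ≤ ctt cell w (E m) +
          (ctt cell w (E (m+1)) + ∑ i ∈ Finset.range (m+1+1), (δ i : ℝ≥0∞)) := by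
        rw [add_comm]
        refine h2.trans ((add_le_add ih (hc (m+1)).le).trans (le_of_eq ?_))
        rw [Finset.sum_range_succ _ (m+1)]
        ring
      exact (ENNReal.add_le_add_iff_left hf).1 h3
  have hmem : ∀ m c, c ∈ MaxC cell (⋃ m, C m) → c ∈ C m → ∀ n, m ≤ n → c ∈ W n := by
    intro m c hcm hcC n hn
    induction n, hn using Nat.le_induction with
    | base =>
      cases m with
      | zero => exact hcC
      | succ m =>
        rw [hW]
        refine ⟨Or.inr hcC, fun d hd => hcm.2 d ?_⟩
        rcases hd with hd | hd
        · exact hWsub _ hd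
        · exact Set.mem_iUnion.2 ⟨_, hd⟩
    | succ n hn ih =>
      rw [hW]
      refine ⟨Or.inl ih, fun d hd => hcm.2 d ?_⟩
      rcases hd with hd | hd
      · exact hWsub _ hd
      · exact Set.mem_iUnion.2 ⟨_, hd⟩
  have hcov : CCov cell (MaxC cell (⋃ m, C m)) (⋃ n, E n) := by
    apply cov_max hr
    intro x hx
    obtain ⟨n, hn⟩ := Set.mem_iUnion.1 hx
    obtain ⟨k, hk⟩ := hC n x hn
    exact ⟨k, Set.mem_iUnion.2 ⟨n, hk⟩⟩
  refine (ctt_le w hcov).trans ?_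
  unfold cost
  rw [ENNReal.tsum_eq_iSup_sum]
  refine iSup_le fun F => ?_
  have hF : ∃ n, ∀ c ∈ F, c ∈ MaxC cell (⋃ m, C m) → c ∈ W n := by
    have : ∀ c : ℕ × ι, ∃ m, c ∈ MaxC cell (⋃ m, C m) → c ∈ C m := by
      intro c
      by_cases hcm : c ∈ MaxC cell (⋃ m, C m)
      · obtain ⟨m, hm⟩ := Set.mem_iUnion.1 hcm.1
        exact ⟨m, fun _ => hm⟩
      · exact ⟨0, fun h => absurd h hcm⟩
    choose m hm using this
    refine ⟨F.sup m, fun c hcF hcm => hmem (m c) c hcm (hm c hcm) _ (Finset.le_sup hcF)⟩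
  obtain ⟨n, hn⟩ := hF
  calc ∑ c ∈ F, (MaxC cell (⋃ m, C m)).indicator (fun c => w c.1) c
      ≤ ∑ c ∈ F, (W n).indicator (fun c => w c.1) c := by
        refine Finset.sum_le_sum fun c hcF => ?_
        by_cases hcm : c ∈ MaxC cell (⋃ m, C m)
        · rw [Set.indicator_of_mem hcm, Set.indicator_of_mem (hn c hcF hcm)]
        · rw [Set.indicator_of_notMem hcm]; exact zero_le
    _ ≤ cost w (W n) := ENNReal.sum_le_tsum F
    _ ≤ _ := hcost n
    _ ≤ c + ε := by
        refine add_le_add (h n) (le_trans (ENNReal.sum_le_tsum _) hδs.le)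

/-- discrete Frostman lemma -/
theorem frostman_disc {cell : ℕ → X → ι} (hr : Refi cell) (w : ℕ → ℝ) (hw : ∀ k, 0 < w k)
    (J : ℕ) (P : Finset X) (hP : ∀ p ∈ P, ∀ q ∈ P, cell J p = cell J q → p = q) [DecidableEq ι] :
    ∃ ν : X → ℝ, (∀ p, 0 ≤ ν p) ∧
      (∀ l ≤ J, ∀ i, ∑ p ∈ P.filter (fun p => cell l p = i), ν p ≤ w l) ∧
      ∀ p ∈ P, ∃ l ≤ J, ∑ q ∈ P.filter (fun q => cell l q = cell l p), ν q = w l := by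
  have key : ∀ n ≤ J, ∃ ν : X → ℝ, (∀ p, 0 ≤ ν p) ∧
      (∀ l ≤ J, J - n ≤ l → ∀ i, ∑ p ∈ P.filter (fun p => cell l p = i), ν p ≤ w l) ∧
      ∀ p ∈ P, ∃ l ≤ J, J - n ≤ l ∧ ∑ q ∈ P.filter (fun q => cell l q = cell l p), ν q = w l := by
    intro n
    induction n with
    | zero =>
      intro _
      refine ⟨fun _ => w J, fun _ => (hw J).le, ?_, ?_⟩
      · intro l hl hl' i
        obtain rfl : l = J := by omega
        have : (P.filter (fun p => cell l p = i)).card ≤ 1 := by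
          rw [Finset.card_le_one]
          intro a ha b hb
          rw [Finset.mem_filter] at ha hb
          exact hP a ha.1 b hb.1 (ha.2.trans hb.2.symm)
        rw [Finset.sum_const, nsmul_eq_mul]
        have h1 : ((P.filter (fun p => cell l p = i)).card : ℝ) ≤ 1 := by exact_mod_cast this
        have := hw l
        nlinarith
      · intro p hp
        refine ⟨J, le_rfl, by omega, ?_⟩
        have : P.filter (fun q => cell J q = cell J p) = {p} := by
          ext q
          rw [Finset.mem_filter, Finset.mem_singleton]
          exact ⟨fun h => hP q h.1 p hp h.2, fun h => by subst h; exact ⟨hp, rfl⟩⟩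
        rw [this, Finset.sum_singleton]
    | succ n ih =>
      intro hn
      obtain ⟨ν, h0, hc, hs⟩ := ih (by omega)
      set k := J - (n+1) with hk
      let m : ι → ℝ := fun i => ∑ p ∈ P.filter (fun p => cell k p = i), ν p
      let f : ι → ℝ := fun i => if m i ≤ w k then 1 else w k / m i
      have hf0 : ∀ i, 0 ≤ f i := by
        intro i; simp only [f]; split_ifs with h
        · norm_num
        · push Not at h
          exact div_nonneg (hw k).le ((hw k).trans h).le
      have hf1 : ∀ i, f i ≤ 1 := by
        intro i; simp only [f]; split_ifs with h
        · exact le_rfl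
        · push Not at h
          rw [div_le_one ((hw k).trans h)]; exact h.le
      have hmk : ∀ i, ∑ p ∈ P.filter (fun p => cell k p = i), ν p * f (cell k p) = m i * f i := by
        intro i
        simp only [m]
        rw [Finset.sum_mul]
        refine Finset.sum_congr rfl fun p hp => ?_
        rw [(Finset.mem_filter.1 hp).2]
      have hmf : ∀ i, m i * f i = if m i ≤ w k then m i else w k := by
        intro i; simp only [f]; split_ifs with h
        · ring
        · push Not at h
          have := (hw k).trans h
          field_simp
      refine ⟨fun p => ν p * f (cell k p), fun p => mul_nonneg (h0 p) (hf0 _), ?_, ?_⟩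
      · intro l hl hl' i
        rcases eq_or_lt_of_le hl' with h | h
        · subst h
          rw [hmk, hmf]; split_ifs with h
          · exact h
          · exact le_rfl
        · refine le_trans (Finset.sum_le_sum fun p _ => ?_) (hc l hl (by omega) i)
          exact mul_le_of_le_one_right (h0 p) (hf1 _)
      · intro p hp
        by_cases h : m (cell k p) ≤ w k
        · obtain ⟨l, hl, hl', hs⟩ := hs p hp
          refine ⟨l, hl, by omega, ?_⟩
          rw [← hs]
          refine Finset.sum_congr rfl fun q hq => ?_
          have h1 : cell k q = cell k p := hr k l q p (by omega) (Finset.mem_filter.1 hq).2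
          beta_reduce
          rw [h1]; simp only [f]; rw [if_pos h, mul_one]
        · refine ⟨k, by omega, le_rfl, ?_⟩
          rw [hmk, hmf, if_neg h]
  obtain ⟨ν, h0, hc, hs⟩ := key J le_rfl
  refine ⟨ν, h0, fun l hl => hc l hl (by omega), fun p hp => ?_⟩
  obtain ⟨l, hl, _, h⟩ := hs p hp
  exact ⟨l, hl, h⟩

/-- discrete Frostman lemma, full form -/
theorem frostman {cell : ℕ → X → ι} (hr : Refi cell) (w : ℕ → ℝ) (hw : ∀ k, 0 < w k)
    (J : ℕ) (S : Set X) (hS : (cell J '' S).Finite) [DecidableEq ι] [Nonempty X] :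
    ∃ (P : Finset X) (ν : X → ℝ), (∀ p ∈ P, p ∈ S) ∧ (∀ p, 0 ≤ ν p) ∧
      (∀ l ≤ J, ∀ i, ∑ p ∈ P.filter (fun p => cell l p = i), ν p ≤ w l) ∧
      ctt cell (fun k => ENNReal.ofReal (w k)) S ≤ ENNReal.ofReal (∑ p ∈ P, ν p) := by
  classical
  have hrep : ∀ i : ι, ∃ x, i ∈ cell J '' S → x ∈ S ∧ cell J x = i := by
    intro i
    by_cases h : i ∈ cell J '' S
    · obtain ⟨x, hx, rfl⟩ := h
      exact ⟨x, fun _ => ⟨hx, rfl⟩⟩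
    · exact ⟨Classical.arbitrary X, fun h' => absurd h' h⟩
  choose r hrr using hrep
  let P : Finset X := hS.toFinset.image r
  have hPS : ∀ p ∈ P, p ∈ S := by
    intro p hp
    obtain ⟨i, hi, rfl⟩ := Finset.mem_image.1 hp
    exact (hrr i (hS.mem_toFinset.1 hi)).1
  have hPi : ∀ p ∈ P, ∀ q ∈ P, cell J p = cell J q → p = q := by
    intro p hp q hq h
    obtain ⟨i, hi, rfl⟩ := Finset.mem_image.1 hp
    obtain ⟨j, hj, rfl⟩ := Finset.mem_image.1 hq
    rw [(hrr i (hS.mem_toFinset.1 hi)).2, (hrr j (hS.mem_toFinset.1 hj)).2] at h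
    rw [h]
  obtain ⟨ν, h0, hc, hs⟩ := frostman_disc hr w hw J P hPi
  refine ⟨P, ν, hPS, h0, hc, ?_⟩
  -- minimal saturated level
  have hex : ∀ p, ∃ l, p ∈ P → (l ≤ J ∧ ∑ q ∈ P.filter (fun q => cell l q = cell l p), ν q = w l ∧
      ∀ l' < l, ∑ q ∈ P.filter (fun q => cell l' q = cell l' p), ν q ≠ w l') := by
    intro p
    by_cases hp : p ∈ P
    · have hh := hs p hp
      refine ⟨Nat.find hh, fun _ => ⟨(Nat.find_spec hh).1, (Nat.find_spec hh).2, fun l' hl' he => ?_⟩⟩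
      exact Nat.find_min hh hl' ⟨hl'.le.trans (Nat.find_spec hh).1, he⟩
    · exact ⟨0, fun h => absurd h hp⟩
  choose lev hlev using hex
  let g : X → ℕ × ι := fun p => (lev p, cell (lev p) p)
  let C : Finset (ℕ × ι) := P.image g
  have hcov : CCov cell (C : Set (ℕ × ι)) S := by
    intro x hx
    have hxi : cell J x ∈ cell J '' S := ⟨x, hx, rfl⟩
    have hp : r (cell J x) ∈ P := Finset.mem_image.2 ⟨_, hS.mem_toFinset.2 hxi, rfl⟩
    refine ⟨lev (r (cell J x)), ?_⟩
    have h1 := hr _ J _ x (hlev _ hp).1 (hrr _ hxi).2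
    rw [← h1]
    exact Finset.mem_coe.2 (Finset.mem_image.2 ⟨_, hp, rfl⟩)
  refine (ctt_le _ hcov).trans ?_
  have hcost : cost (fun k => ENNReal.ofReal (w k)) (C : Set (ℕ × ι)) =
      ∑ c ∈ C, ENNReal.ofReal (w c.1) := by
    unfold cost
    rw [tsum_eq_sum (s := C)]
    · refine Finset.sum_congr rfl fun c hc => ?_
      rw [Set.indicator_of_mem (Finset.mem_coe.2 hc)]
    · intro c hc
      rw [Set.indicator_of_notMem (by simpa using hc)]
  rw [hcost, ← ENNReal.ofReal_sum_of_nonneg (fun c _ => (hw _).le)]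
  apply ENNReal.ofReal_le_ofReal
  rw [← Finset.sum_fiberwise_of_maps_to (s := P) (t := C) (g := g)
    (fun p hp => Finset.mem_image_of_mem g hp)]
  refine Finset.sum_le_sum fun c hcC => ?_
  obtain ⟨p, hp, rfl⟩ := Finset.mem_image.1 hcC
  show w (lev p) ≤ _
  rw [← (hlev p hp).2.1]
  refine Finset.sum_le_sum_of_subset_of_nonneg ?_ (fun q _ _ => h0 q)
  intro q hq
  rw [Finset.mem_filter] at hq ⊢
  refine ⟨hq.1, ?_⟩
  have hlow : ∀ l, l ≤ lev p → cell l q = cell l p := fun l hl => hr l _ q p hl hq.2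
  have hle : lev q = lev p := by
    rcases lt_trichotomy (lev q) (lev p) with h | h | h
    · exfalso
      refine (hlev p hp).2.2 _ h ?_
      rw [← hlow _ h.le]; exact (hlev q hq.1).2.1
    · exact h
    · exfalso
      refine (hlev q hq.1).2.2 _ h ?_
      rw [hlow _ le_rfl]; exact (hlev p hp).2.1
  simp only [g]
  rw [hle, hq.2]

end content
end BP

open MeasureTheory
open scoped ENNReal
namespace BP

/-- dyadic cells on the line -/
noncomputable def cl1 (k : ℕ) (x : ℝ) : ℤ := ⌊(2:ℝ) ^ k * x⌋

/-- dyadic cells in the plane -/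
noncomputable def cl2 (k : ℕ) (p : ℝ × ℝ) : ℤ × ℤ := (cl1 k p.1, cl1 k p.2)

/-- dyadic weights -/
noncomputable def wt (s : ℝ) (k : ℕ) : ℝ := ((1/2:ℝ) ^ k) ^ s

theorem wt_pos (s : ℝ) (k : ℕ) : 0 < wt s k := by unfold wt; positivity

theorem cl1_succ (k : ℕ) (x : ℝ) : cl1 k x = cl1 (k+1) x / 2 := by
  unfold cl1
  have h := Int.floor_div_natCast ((2:ℝ)^(k+1) * x) 2
  have h2 : (2:ℝ)^(k+1) * x / ((2:ℕ):ℝ) = 2^k * x := by push_cast; ring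
  rw [h2] at h
  rw [h]; rfl

theorem refi1 : Refi cl1 := by
  intro k l x y hkl
  induction l, hkl using Nat.le_induction with
  | base => exact id
  | succ n hn ih =>
    intro h
    apply ih
    rw [cl1_succ, cl1_succ n y, h]

theorem refi2 : Refi cl2 := by
  intro k l x y hkl h
  have h1 := congrArg Prod.fst h
  have h2 := congrArg Prod.snd h
  exact Prod.ext (refi1 k l _ _ hkl h1) (refi1 k l _ _ hkl h2)

theorem cl1_dist {k : ℕ} {x y : ℝ} (h : cl1 k x = cl1 k y) : |x - y| ≤ (1/2)^k := by
  unfold cl1 at h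
  have h1 := Int.abs_sub_lt_one_of_floor_eq_floor h
  have h2 : (2:ℝ)^k * x - 2^k*y = 2^k * (x - y) := by ring
  rw [h2, abs_mul, abs_of_pos (show (0:ℝ) < 2^k by positivity)] at h1
  rw [one_div, inv_pow, ← one_div, le_div_iff₀ (by positivity)]
  linarith

theorem ctt_pos {X ι : Type*} [MetricSpace X] [MeasurableSpace X] [BorelSpace X] [Countable ι]
    (cell : ℕ → X → ι) (hd : ∀ k x y, cell k x = cell k y → dist x y ≤ (1/2:ℝ)^k)
    (s : ℝ) (hs : 0 < s) (S : Set X) (hS : ENNReal.ofReal s < dimH S) :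
    0 < ctt cell (fun k => ENNReal.ofReal (wt s k)) S := by
  by_contra hcon
  have h0 : ctt cell (fun k => ENNReal.ofReal (wt s k)) S = 0 := by simpa using hcon
  have h1 : ∀ n : ℕ, ∃ C, CCov cell C S ∧
      cost (fun k => ENNReal.ofReal (wt s k)) C < ENNReal.ofReal (wt s n) := by
    intro n
    apply ctt_exists
    rw [h0]; exact ENNReal.ofReal_pos.2 (wt_pos s n)
  choose C hC hc using h1
  have hlev : ∀ n, ∀ c ∈ C n, n ≤ c.1 := by
    intro n c hcn
    by_contra hlt
    push Not at hlt
    have h2 : ENNReal.ofReal (wt s c.1) ≤ cost (fun k => ENNReal.ofReal (wt s k)) (C n) := by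
      unfold cost
      refine le_trans (le_of_eq ?_) (ENNReal.le_tsum c)
      rw [Set.indicator_of_mem hcn]
    have h3 := h2.trans_lt (hc n)
    rw [ENNReal.ofReal_lt_ofReal_iff (wt_pos s n)] at h3
    have h4 : wt s n ≤ wt s c.1 := by
      unfold wt
      exact Real.rpow_le_rpow (by positivity)
        (pow_le_pow_of_le_one (by norm_num) (by norm_num) hlt.le) hs.le
    linarith
  have hdiam : ∀ (k : ℕ) (i : ι), Metric.ediam {x | cell k x = i} ≤ ENNReal.ofReal ((1/2:ℝ)^k) := by
    intro k i
    apply Metric.ediam_le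
    intro x hx y hy
    rw [edist_dist]
    exact ENNReal.ofReal_le_ofReal (hd k x y (hx.trans hy.symm))
  have htend : Filter.Tendsto (fun n : ℕ => ENNReal.ofReal ((1/2:ℝ)^n)) Filter.atTop (nhds 0) := by
    have h := tendsto_pow_atTop_nhds_zero_of_lt_one (r := (1/2:ℝ)) (by norm_num) (by norm_num)
    simpa using ENNReal.tendsto_ofReal h
  have htend2 : Filter.Tendsto (fun n : ℕ => ENNReal.ofReal (wt s n)) Filter.atTop (nhds 0) := by
    have h := tendsto_pow_atTop_nhds_zero_of_lt_one (r := (1/2:ℝ)) (by norm_num) (by norm_num)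
    have h2 := h.rpow_const (p := s) (Or.inr hs.le)
    rw [Real.zero_rpow hs.ne'] at h2
    simpa [wt] using ENNReal.tendsto_ofReal h2
  have hm := Measure.hausdorffMeasure_le_liminf_tsum (X := X) s S (ι := fun n : ℕ => (C n))
    (l := Filter.atTop) (fun n : ℕ => ENNReal.ofReal ((1/2:ℝ)^n)) htend
    (fun n c => {x | cell c.1.1 x = c.1.2})
    (Filter.Eventually.of_forall fun n c => (hdiam _ _).trans (ENNReal.ofReal_le_ofReal
      (pow_le_pow_of_le_one (by norm_num) (by norm_num) (hlev n c.1 c.2))))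
    (Filter.Eventually.of_forall fun n x hx => by
      obtain ⟨k, hk⟩ := hC n x hx
      exact Set.mem_iUnion.2 ⟨⟨_, hk⟩, rfl⟩)
  have hm2 : ∀ n, (∑' c : C n, Metric.ediam {x | cell c.1.1 x = c.1.2} ^ s) ≤ ENNReal.ofReal (wt s n) := by
    intro n
    refine le_trans ?_ (hc n).le
    unfold cost
    rw [← tsum_subtype (C n) (fun c : ℕ × ι => ENNReal.ofReal (wt s c.1))]
    refine ENNReal.tsum_le_tsum fun c => ?_
    refine (ENNReal.rpow_le_rpow (hdiam _ _) hs.le).trans (le_of_eq ?_)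
    rw [ENNReal.ofReal_rpow_of_nonneg (by positivity) hs.le]; rfl
  have hm3 : Measure.hausdorffMeasure s S = 0 := by
    have h5 : Filter.liminf (fun n => ∑' c : C n, Metric.ediam {x | cell c.1.1 x = c.1.2} ^ s) Filter.atTop ≤
        Filter.liminf (fun n => ENNReal.ofReal (wt s n)) Filter.atTop :=
      Filter.liminf_le_liminf (Filter.Eventually.of_forall hm2)
    rw [htend2.liminf_eq] at h5
    exact le_antisymm (hm.trans h5) zero_le
  have hm4 := hausdorffMeasure_of_lt_dimH (s := S) (d := s.toNNReal) hS
  rw [Real.coe_toNNReal s hs.le, hm3] at hm4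
  exact ENNReal.zero_ne_top hm4

theorem dist_cl1 (k : ℕ) (x y : ℝ) (h : cl1 k x = cl1 k y) : dist x y ≤ (1/2:ℝ)^k := by
  rw [Real.dist_eq]; exact cl1_dist h

theorem dist_cl2 (k : ℕ) (x y : ℝ × ℝ) (h : cl2 k x = cl2 k y) : dist x y ≤ (1/2:ℝ)^k := by
  rw [Prod.dist_eq]
  exact max_le (dist_cl1 k _ _ (congrArg Prod.fst h)) (dist_cl1 k _ _ (congrArg Prod.snd h))

/-- shift of cells -/
def shf (d : ℤ × ℤ) : (ℕ × (ℤ × ℤ)) ≃ (ℕ × (ℤ × ℤ)) :=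
  (Equiv.refl ℕ).prodCongr (Equiv.addRight d)

theorem cost_shf (w : ℕ → ℝ≥0∞) (C : Set (ℕ × (ℤ × ℤ))) (d : ℤ × ℤ) :
    cost w (shf d ⁻¹' C) = cost w C := by
  unfold cost
  rw [← (shf d).tsum_eq (fun c => C.indicator (fun c => w c.1) c)]
  rfl

/-- neighbourhood of a cell -/
def nbd (c : ℕ × (ℤ × ℤ)) : Set (ℝ × ℝ) :=
  {p | ((c.2.1:ℝ) - 1 < 2^c.1 * p.1 ∧ 2^c.1 * p.1 < c.2.1 + 2) ∧
       ((c.2.2:ℝ) - 1 < 2^c.1 * p.2 ∧ 2^c.1 * p.2 < c.2.2 + 2)}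

theorem nbd_open (c : ℕ × (ℤ × ℤ)) : IsOpen (nbd c) := by
  have f1 : Continuous fun p : ℝ × ℝ => (2:ℝ)^c.1 * p.1 := by fun_prop
  have f2 : Continuous fun p : ℝ × ℝ => (2:ℝ)^c.1 * p.2 := by fun_prop
  exact ((isOpen_lt continuous_const f1).inter (isOpen_lt f1 continuous_const)).inter
    ((isOpen_lt continuous_const f2).inter (isOpen_lt f2 continuous_const))

theorem floor_nb {x : ℝ} {i : ℤ} (h1 : (i:ℝ) - 1 < x) (h2 : x < i + 2) :
    ∃ d : Fin 3, i = ⌊x⌋ + ((d : ℕ) : ℤ) - 1 := by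
  have h3 : i - 1 ≤ ⌊x⌋ := by rw [Int.le_floor]; push_cast; linarith
  have h4 : ⌊x⌋ < i + 2 := by rw [Int.floor_lt]; push_cast; linarith
  refine ⟨⟨(i - ⌊x⌋ + 1).toNat, by omega⟩, ?_⟩
  simp only
  omega

theorem ctt_nbd (w : ℕ → ℝ≥0∞) (C : Set (ℕ × (ℤ × ℤ))) (S : Set (ℝ × ℝ))
    (h : S ⊆ ⋃ c ∈ C, nbd c) : ctt cl2 w S ≤ 9 * cost w C := by
  let g : Fin 3 × Fin 3 → ℤ × ℤ := fun d => (((d.1:ℕ):ℤ) - 1, ((d.2:ℕ):ℤ) - 1)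
  have hcov : CCov cl2 (⋃ d, shf (g d) ⁻¹' C) S := by
    intro p hp
    have := h hp
    simp only [Set.mem_iUnion] at this
    obtain ⟨⟨k, i, j⟩, hc, ⟨h1, h2⟩, h3, h4⟩ := this
    obtain ⟨d1, hd1⟩ := floor_nb h1 h2
    obtain ⟨d2, hd2⟩ := floor_nb h3 h4
    refine ⟨k, Set.mem_iUnion.2 ⟨(d1, d2), ?_⟩⟩
    show (k, (cl1 k p.1 + (((d1:ℕ):ℤ) - 1), cl1 k p.2 + (((d2:ℕ):ℤ) - 1))) ∈ C
    simp only at hd1 hd2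
    have e1 : cl1 k p.1 + (((d1:ℕ):ℤ) - 1) = i := by unfold cl1; rw [hd1]; ring
    have e2 : cl1 k p.2 + (((d2:ℕ):ℤ) - 1) = j := by unfold cl1; rw [hd2]; ring
    rw [e1, e2]; exact hc
  refine (ctt_le w hcov).trans ((cost_iUnion w _).trans (le_of_eq ?_))
  simp only [cost_shf, tsum_fintype, Finset.sum_const, Finset.card_univ, Fintype.card_prod,
    Fintype.card_fin, nsmul_eq_mul]
  norm_num

theorem cell_sub_nbd (k : ℕ) (p : ℝ × ℝ) : p ∈ nbd (k, cl2 k p) := by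
  unfold nbd cl2 cl1
  have h1 := Int.floor_le ((2:ℝ)^k * p.1)
  have h2 := Int.lt_floor_add_one ((2:ℝ)^k * p.1)
  have h3 := Int.floor_le ((2:ℝ)^k * p.2)
  have h4 := Int.lt_floor_add_one ((2:ℝ)^k * p.2)
  exact ⟨⟨by simp only; linarith, by simp only; linarith⟩, by simp only; linarith, by simp only; linarith⟩

theorem choquet (w : ℕ → ℝ≥0∞) (A : Set (ℝ × ℝ)) (hA : MeasurableSet A) (c : ℝ≥0∞)
    (hc : c < ctt cl2 w A) : ∃ K, K ⊆ A ∧ IsCompact K ∧ c ≤ 9 * ctt cl2 w K := by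
  have han := hA.analyticSet
  rw [AnalyticSet] at han
  rcases han with rfl | ⟨f, hf, rfl⟩
  · exfalso
    have : ctt cl2 w (∅ : Set (ℝ × ℝ)) ≤ cost w ∅ := ctt_le w (fun x hx => absurd hx (by simp))
    have h2 : cost w (∅ : Set (ℕ × (ℤ × ℤ))) = 0 := by simp [cost]
    rw [h2] at this
    exact absurd (hc.trans_le this) (by simp)
  -- choose bounds recursively
  let St : List ℕ → Set (ℕ → ℕ) := fun l => {x | ∀ i (h : i < l.length), x i ≤ l[i]}
  have step : ∀ l : List ℕ, c < ctt cl2 w (f '' St l) →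
      ∃ n, c < ctt cl2 w (f '' St (l ++ [n])) := by
    intro l hl
    by_contra hcon
    push Not at hcon
    have hU : f '' St l = ⋃ n, f '' St (l ++ [n]) := by
      rw [← Set.image_iUnion]
      congr 1
      ext x
      simp only [St, Set.mem_ofPred_eq, Set.mem_iUnion]
      constructor
      · intro h
        refine ⟨x l.length, fun i hi => ?_⟩
        by_cases hil : i < l.length
        · rw [List.getElem_append_left hil]; exact h i hil
        · have : i = l.length := by simp at hi; omega
          subst this; simp
      · rintro ⟨n, h⟩ i hi
        have := h i (by simp; omega)
        rwa [List.getElem_append_left hi] at this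
    rw [hU] at hl
    refine absurd (ctt_iSup refi2 w _ ?_ hcon) (not_le.2 hl)
    intro m n hmn
    apply Set.image_mono
    intro x hx i hi
    have hi' : i < (l ++ [m]).length := by simp at hi ⊢; omega
    refine (hx i hi').trans ?_
    by_cases hil : i < l.length
    · rw [List.getElem_append_left hil, List.getElem_append_left hil]
    · have : i = l.length := by simp at hi; omega
      subst this; simpa using hmn
  choose nx hnx using step
  have h0 : c < ctt cl2 w (f '' St []) := by
    have : St [] = Set.univ := by ext x; simp [St]
    rw [this, Set.image_univ]; exact hc
  let Q : ℕ → {l : List ℕ // c < ctt cl2 w (f '' St l)} := fun n =>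
    Nat.rec ⟨[], h0⟩ (fun _ l => ⟨l.1 ++ [nx l.1 l.2], hnx l.1 l.2⟩) n
  have hQ : ∀ n, (Q (n+1)).1 = (Q n).1 ++ [nx (Q n).1 (Q n).2] := fun n => rfl
  have hlen : ∀ n, (Q n).1.length = n := by
    intro n
    induction n with
    | zero => rfl
    | succ n ih => rw [hQ, List.length_append, ih]; rfl
  let b : ℕ → ℕ := fun n => nx (Q n).1 (Q n).2
  have hget : ∀ n i (h : i < (Q n).1.length), (Q n).1[i] = b i := by
    intro n
    induction n with
    | zero => intro i h; rw [hlen] at h; omega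
    | succ n ih =>
      intro i h
      by_cases hi : i < (Q n).1.length
      · have : (Q (n+1)).1[i] = (Q n).1[i] := by
          simp only [hQ]; rw [List.getElem_append_left hi]
        rw [this]; exact ih i hi
      · have hi' : i = n := by
          have e1 : i < n + 1 := lt_of_lt_of_eq h (hlen (n+1))
          have e2 := hlen n
          omega
        subst hi'
        simp only [hQ]
        rw [List.getElem_append_right (by rw [hlen])]
        simp [b]
  have hSt : ∀ n, St (Q n).1 = {x | ∀ i < n, x i ≤ b i} := by
    intro n
    ext x
    simp only [St, Set.mem_ofPred_eq]
    constructor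
    · intro h i hi
      have := h i (by rw [hlen]; exact hi)
      rwa [hget] at this
    · intro h i hi
      rw [hget]; exact h i (by rw [hlen] at hi; exact hi)
  have hcb : ∀ n, c < ctt cl2 w (f '' {x | ∀ i < n, x i ≤ b i}) := by
    intro n; rw [← hSt]; exact (Q n).2
  let B : Set (ℕ → ℕ) := Set.pi Set.univ (fun i => Set.Iic (b i))
  have hB : IsCompact B := isCompact_univ_pi fun i => (Set.finite_Iic (b i)).isCompact
  refine ⟨f '' B, Set.image_subset_range _ _, hB.image hf, ?_⟩
  by_contra hcon
  push Not at hcon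
  have hcon2 : ctt cl2 w (f '' B) < c / 9 := by
    rw [ENNReal.lt_div_iff_mul_lt (by norm_num) (by norm_num), mul_comm]; exact hcon
  obtain ⟨C, hC, hCc⟩ := ctt_exists hcon2
  let U : Set (ℝ × ℝ) := ⋃ c ∈ C, nbd c
  have hUo : IsOpen U := isOpen_biUnion fun c _ => nbd_open c
  have hBU : f '' B ⊆ U := by
    intro p hp
    obtain ⟨k, hk⟩ := hC p hp
    exact Set.mem_biUnion hk (cell_sub_nbd k p)
  have hex : ∃ n, f '' {x | ∀ i < n, x i ≤ b i} ⊆ U := by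
    by_contra hno
    push Not at hno
    have : ∀ n, ∃ x : ℕ → ℕ, (∀ i < n, x i ≤ b i) ∧ f x ∉ U := by
      intro n
      obtain ⟨p, ⟨x, hx, rfl⟩, hp⟩ := Set.not_subset.1 (hno n)
      exact ⟨x, hx, hp⟩
    choose x hx hxU using this
    let y : ℕ → ℕ → ℕ := fun n i => min (x n i) (b i)
    have hyB : ∀ n, y n ∈ B := fun n i _ => Set.mem_Iic.2 (min_le_right _ _)
    obtain ⟨z, hzB, φ, hφ, hlim⟩ := hB.tendsto_subseq hyB
    have hlim2 : Filter.Tendsto (x ∘ φ) Filter.atTop (nhds z) := by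
      rw [tendsto_pi_nhds] at hlim ⊢
      intro i
      refine (hlim i).congr' ?_
      filter_upwards [Filter.eventually_gt_atTop i] with n hn
      exact min_eq_left (hx (φ n) i (hn.trans_le (hφ.id_le n)))
    have hlim3 := (hf.tendsto z).comp hlim2
    have hzU : f z ∈ U := hBU ⟨z, hzB, rfl⟩
    have := hlim3.eventually (hUo.mem_nhds hzU)
    obtain ⟨n, hn⟩ := this.exists
    exact hxU _ hn
  obtain ⟨n, hn⟩ := hex
  have h1 := ctt_nbd w C _ hn
  have h2 : 9 * cost w C < c := by
    rwa [ENNReal.lt_div_iff_mul_lt (by norm_num) (by norm_num), mul_comm] at hCc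
  exact absurd ((hcb n).trans_le h1) (not_lt.2 h2.le)

end BP

open MeasureTheory
open scoped ENNReal
namespace BP

theorem wt_anti {s : ℝ} (hs : 0 < s) {k l : ℕ} (h : wt s k ≤ wt s l) : l ≤ k := by
  by_contra hlt
  push Not at hlt
  have : wt s l < wt s k := by
    unfold wt
    exact Real.rpow_lt_rpow (by positivity)
      (pow_lt_pow_right_of_lt_one₀ (by norm_num) (by norm_num) hlt) hs
  linarith

theorem wt_le_one {s : ℝ} (hs : 0 ≤ s) (k : ℕ) : wt s k ≤ 1 := by
  unfold wt
  exact Real.rpow_le_one (by positivity) (pow_le_one₀ (by norm_num) (by norm_num)) hs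

theorem cover_fin {η : ℝ} (hη : 0 < η) (hη2 : η ≤ 2) {S : Set ℝ} (hSc : IsCompact S)
    (hS : dimH S < ENNReal.ofReal η) (j0 : ℕ) :
    ∃ F : Finset (ℕ × ℝ), (∀ c ∈ F, j0 ≤ c.1) ∧
      (∀ j, ((F.filter (fun c => c.1 = j)).card : ℝ) * wt η j ≤ 1) ∧
      ∀ x ∈ S, ∃ c ∈ F, |x - c.2| < 2 * (1/2:ℝ)^c.1 := by
  classical
  set δ : ℝ := wt η j0 with hδ
  have hδ0 : 0 < δ := wt_pos _ _
  have hδ1 : δ ≤ 1 := wt_le_one hη.le _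
  have hm : Measure.hausdorffMeasure η S = 0 := by
    have h := hausdorffMeasure_of_dimH_lt (s := S) (d := η.toNNReal) hS
    rwa [Real.coe_toNNReal η hη.le] at h
  rw [Measure.hausdorffMeasure_apply] at hm
  simp only [ENNReal.iSup_eq_zero] at hm
  have hm1 := hm (ENNReal.ofReal (1/2)) (by simp)
  have hm2 : (0:ℝ≥0∞) < ENNReal.ofReal (δ/8) := ENNReal.ofReal_pos.2 (by positivity)
  rw [← hm1] at hm2
  simp only [iInf_lt_iff] at hm2
  obtain ⟨t, hSt, htd, hsum⟩ := hm2
  let d : ℕ → ℝ := fun n => (Metric.ediam (t n)).toReal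
  have hd0 : ∀ n, 0 ≤ d n := fun n => ENNReal.toReal_nonneg
  have hdf : ∀ n, Metric.ediam (t n) ≠ ∞ := fun n => ne_top_of_le_ne_top ENNReal.ofReal_ne_top (htd n)
  have hd1 : ∀ n, d n ≤ 1/2 := by
    intro n
    have := ENNReal.toReal_mono ENNReal.ofReal_ne_top (htd n)
    rwa [ENNReal.toReal_ofReal (by norm_num)] at this
  have hdsum : ∀ F : Finset ℕ, ∑ n ∈ F, d n ^ η ≤ δ / 8 := by
    intro F
    have h1 : ∑ n ∈ F, ENNReal.ofReal (d n ^ η) ≤ ENNReal.ofReal (δ/8) := by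
      refine le_trans (Finset.sum_le_sum fun n _ => ?_) ((ENNReal.sum_le_tsum F).trans hsum.le)
      rw [← ENNReal.ofReal_rpow_of_nonneg (hd0 n) hη.le]
      simp only [d]
      rw [ENNReal.ofReal_toReal (hdf n)]
      by_cases hn : (t n).Nonempty
      · simp [hn]
      · rw [Set.not_nonempty_iff_eq_empty] at hn
        simp [hn, hη]
    rw [← ENNReal.ofReal_sum_of_nonneg (fun n _ => Real.rpow_nonneg (hd0 n) _)] at h1
    exact (ENNReal.ofReal_le_ofReal_iff (by positivity)).1 h1
  let u : ℕ → ℝ := fun n => δ / 8 * ((1/2) ^ (n+1))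
  have hu0 : ∀ n, 0 < u n := fun n => by simp only [u]; positivity
  have hu1 : ∀ n, u n ≤ 1 := by
    intro n
    have : (1/2:ℝ)^(n+1) ≤ 1 := pow_le_one₀ (by norm_num) (by norm_num)
    have h2 : (0:ℝ) < (1/2:ℝ)^(n+1) := by positivity
    simp only [u]; nlinarith
  have husum : ∀ F : Finset ℕ, ∑ n ∈ F, u n ≤ δ / 8 := by
    intro F
    simp only [u]
    rw [← Finset.mul_sum]
    have hh : HasSum (fun n : ℕ => (1/2:ℝ)^(n+1)) 1 := by
      have := hasSum_geometric_two' (1:ℝ)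
      convert this using 2 with n
      rw [pow_succ, one_div_pow]; field_simp
    have : ∑ n ∈ F, (1/2:ℝ)^(n+1) ≤ 1 := sum_le_hasSum F (fun n _ => by positivity) hh
    nlinarith
  let r : ℕ → ℝ := fun n => u n ^ (1/η)
  have hr0 : ∀ n, 0 < r n := fun n => Real.rpow_pos_of_pos (hu0 n) _
  have hr1 : ∀ n, r n ≤ 1 := fun n => Real.rpow_le_one (hu0 n).le (hu1 n) (by positivity)
  have hrη : ∀ n, r n ^ η = u n := by
    intro n
    simp only [r]
    rw [← Real.rpow_mul (hu0 n).le, one_div_mul_cancel hη.ne', Real.rpow_one]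
  have hj : ∀ n, ∃ j : ℕ, d n ≤ (1/2:ℝ)^j ∧ wt η j ≤ 4 * (d n ^ η + u n) := by
    intro n
    obtain ⟨j, hj1, hj2⟩ := exists_nat_pow_near_of_lt_one (x := max (d n) (r n)) (y := (1/2:ℝ))
      (lt_max_of_lt_right (hr0 n)) (max_le (by linarith [hd1 n]) (hr1 n)) (by norm_num) (by norm_num)
    refine ⟨j, (le_max_left _ _).trans hj2, ?_⟩
    unfold wt
    have h1 : (1/2:ℝ)^j ≤ 2 * max (d n) (r n) := by
      rw [pow_succ] at hj1; linarith
    have hmax : (max (d n) (r n)) ^ η ≤ d n ^ η + u n := by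
      rcases le_total (d n) (r n) with h | h
      · rw [max_eq_right h, hrη]; linarith [Real.rpow_nonneg (hd0 n) η]
      · rw [max_eq_left h]; linarith [hu0 n]
    have h4 : (2:ℝ)^η ≤ 4 := by
      calc (2:ℝ)^η ≤ 2^(2:ℝ) := Real.rpow_le_rpow_of_exponent_le (by norm_num) hη2
        _ = 4 := by norm_num
    have hmn : 0 ≤ max (d n) (r n) := (hd0 n).trans (le_max_left _ _)
    calc ((1/2:ℝ)^j)^η ≤ (2 * max (d n) (r n))^η := Real.rpow_le_rpow (by positivity) h1 hη.le
      _ = 2^η * (max (d n) (r n))^η := Real.mul_rpow (by norm_num) hmn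
      _ ≤ 4 * (d n ^ η + u n) := mul_le_mul h4 hmax (Real.rpow_nonneg hmn _) (by norm_num)
  choose j hjd hjw using hj
  have hx : ∀ n, ∃ x : ℝ, ∀ y ∈ t n, |y - x| ≤ d n := by
    intro n
    by_cases hn : (t n).Nonempty
    · obtain ⟨x, hx⟩ := hn
      refine ⟨x, fun y hy => ?_⟩
      have h1 := Metric.edist_le_ediam_of_mem hy hx
      have h2 := ENNReal.toReal_mono (hdf n) h1
      rwa [edist_dist, ENNReal.toReal_ofReal dist_nonneg, Real.dist_eq] at h2
    · rw [Set.not_nonempty_iff_eq_empty] at hn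
      exact ⟨0, fun y hy => by rw [hn] at hy; exact absurd hy (by simp)⟩
  choose x hx using hx
  have hUcov : S ⊆ ⋃ n, Metric.ball (x n) (2 * (1/2:ℝ)^(j n)) := by
    intro y hy
    obtain ⟨n, hn⟩ := Set.mem_iUnion.1 (hSt hy)
    refine Set.mem_iUnion.2 ⟨n, ?_⟩
    rw [Metric.mem_ball, Real.dist_eq]
    have h1 := (hx n y hn).trans (hjd n)
    have : (0:ℝ) < (1/2)^(j n) := by positivity
    linarith
  obtain ⟨F0, hF0⟩ := hSc.elim_finite_subcover _ (fun n => Metric.isOpen_ball) hUcov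
  have hwsum : ∀ F : Finset ℕ, ∑ n ∈ F, wt η (j n) ≤ δ := by
    intro F
    calc ∑ n ∈ F, wt η (j n) ≤ ∑ n ∈ F, 4 * (d n ^ η + u n) := Finset.sum_le_sum fun n _ => hjw n
      _ = 4 * (∑ n ∈ F, d n ^ η + ∑ n ∈ F, u n) := by rw [← Finset.mul_sum, Finset.sum_add_distrib]
      _ ≤ δ := by linarith [hdsum F, husum F]
  refine ⟨F0.image (fun n => (j n, x n)), ?_, ?_, ?_⟩
  · intro c hc
    obtain ⟨n, _, rfl⟩ := Finset.mem_image.1 hc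
    have := hwsum {n}
    rw [Finset.sum_singleton] at this
    exact wt_anti hη this
  · intro k
    have h1 : ((F0.image (fun n => (j n, x n))).filter (fun c => c.1 = k)).card ≤
        (F0.filter (fun n => j n = k)).card := by
      rw [Finset.filter_image]
      exact Finset.card_image_le
    have h2 : ((F0.filter (fun n => j n = k)).card : ℝ) * wt η k ≤ 1 := by
      rw [← nsmul_eq_mul, ← Finset.sum_const]
      refine le_trans (le_of_eq ?_) ((hwsum (F0.filter (fun n => j n = k))).trans hδ1)
      exact Finset.sum_congr rfl fun n hn => by rw [(Finset.mem_filter.1 hn).2]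
    refine le_trans (mul_le_mul_of_nonneg_right ?_ (wt_pos η k).le) h2
    exact_mod_cast h1
  · intro y hy
    have := hF0 hy
    simp only [Set.mem_iUnion] at this
    obtain ⟨n, hn, hy2⟩ := this
    rw [Metric.mem_ball, Real.dist_eq] at hy2
    exact ⟨_, Finset.mem_image_of_mem _ hn, hy2⟩

theorem lev_exists {s : ℝ} (hs : 0 < s) (hs2 : s ≤ 2) (j : ℕ)
    (ρ : ℝ) (hρ : (1/2:ℝ)^j ≤ ρ) (hρ1 : ρ ≤ 1) :
    ∃ k ≤ j, ρ ≤ (1/2:ℝ)^k ∧ wt s k ≤ 4 * ρ ^ s := by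
  have hρ0 : 0 < ρ := lt_of_lt_of_le (by positivity) hρ
  obtain ⟨k, hk1, hk2⟩ := exists_nat_pow_near_of_lt_one (x := ρ) (y := (1/2:ℝ)) hρ0 hρ1
    (by norm_num) (by norm_num)
  have hkj : k ≤ j := by
    by_contra hlt
    push Not at hlt
    have := pow_lt_pow_right_of_lt_one₀ (a := (1/2:ℝ)) (by norm_num) (by norm_num) hlt
    linarith
  refine ⟨k, hkj, hk2, ?_⟩
  unfold wt
  have h1 : (1/2:ℝ)^k ≤ 2 * ρ := by rw [pow_succ] at hk1; linarith
  have h4 : (2:ℝ)^s ≤ 4 := by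
    calc (2:ℝ)^s ≤ 2^(2:ℝ) := Real.rpow_le_rpow_of_exponent_le (by norm_num) hs2
      _ = 4 := by norm_num
  calc ((1/2:ℝ)^k)^s ≤ (2 * ρ)^s := Real.rpow_le_rpow (by positivity) h1 hs.le
    _ = 2^s * ρ^s := Real.mul_rpow (by norm_num) hρ0.le
    _ ≤ 4 * ρ ^ s := mul_le_mul_of_nonneg_right h4 (Real.rpow_nonneg hρ0.le _)

theorem floor_close {x y : ℝ} (h : |x - y| ≤ 1) : ⌊x⌋ ∈ Finset.Icc (⌊y⌋ - 1) (⌊y⌋ + 1) := by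
  rw [abs_le] at h
  rw [Finset.mem_Icc]
  constructor
  · have := Int.floor_mono (show y - 1 ≤ x by linarith)
    rwa [Int.floor_sub_one] at this
  · have := Int.floor_mono (show x ≤ y + 1 by linarith)
    rwa [Int.floor_add_one] at this

theorem cl1_close {k : ℕ} {x y ρ : ℝ} (h : |x - y| ≤ ρ) (hρ : ρ ≤ (1/2:ℝ)^k) :
    cl1 k x ∈ Finset.Icc (cl1 k y - 1) (cl1 k y + 1) := by
  unfold cl1
  apply floor_close
  have h2 : (2:ℝ)^k * x - 2^k*y = 2^k * (x - y) := by ring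
  rw [h2, abs_mul, abs_of_pos (show (0:ℝ) < 2^k by positivity)]
  have h3 : (2:ℝ)^k * (1/2)^k = 1 := by rw [← mul_pow]; norm_num
  calc (2:ℝ)^k * |x - y| ≤ 2^k * (1/2)^k := mul_le_mul_of_nonneg_left (h.trans hρ) (by positivity)
    _ = 1 := h3

theorem ball_gen {X ι : Type*} [DecidableEq ι] (P : Finset X) (ν : X → ℝ) (h0 : ∀ p, 0 ≤ ν p)
    (g : X → ι) (I : Finset ι) (Q : X → Prop) [DecidablePred Q] (hQ : ∀ p, Q p → g p ∈ I) (W : ℝ)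
    (hW : ∀ i, ∑ p ∈ P.filter (fun p => g p = i), ν p ≤ W) :
    ∑ p ∈ P.filter Q, ν p ≤ I.card * W := by
  rw [← Finset.sum_fiberwise_of_maps_to (s := P.filter Q) (t := I) (g := g)
    (fun p hp => hQ p (Finset.mem_filter.1 hp).2), ← nsmul_eq_mul]
  refine Finset.sum_le_card_nsmul _ _ _ fun i _ => le_trans ?_ (hW i)
  refine Finset.sum_le_sum_of_subset_of_nonneg ?_ (fun p _ _ => h0 p)
  exact Finset.filter_subset_filter _ (Finset.filter_subset _ _)

/-- Ball mass estimate on the line. -/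
theorem ball1 {s : ℝ} (hs : 0 < s) (hs2 : s ≤ 2) (P : Finset ℝ) (ν : ℝ → ℝ) (h0 : ∀ p, 0 ≤ ν p) (j : ℕ)
    (h : ∀ l ≤ j, ∀ i, ∑ p ∈ P.filter (fun p => cl1 l p = i), ν p ≤ wt s l)
    (ρ : ℝ) (hρ : (1/2:ℝ)^j ≤ ρ) (hρ1 : ρ ≤ 1) (c : ℝ) :
    ∑ p ∈ P.filter (fun p => |p - c| ≤ ρ), ν p ≤ 12 * ρ ^ s := by
  obtain ⟨k, hkj, hk, hwt⟩ := lev_exists hs hs2 j ρ hρ hρ1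
  have h1 := ball_gen P ν h0 (cl1 k) (Finset.Icc (cl1 k c - 1) (cl1 k c + 1))
    (fun p => |p - c| ≤ ρ) (fun p hp => cl1_close hp hk) (wt s k) (h k hkj)
  have h2 : (Finset.Icc (cl1 k c - 1) (cl1 k c + 1)).card = 3 := by
    rw [Int.card_Icc]; ring_nf; rfl
  rw [h2] at h1
  push_cast at h1
  linarith

/-- Ball mass estimate in the plane. -/
theorem ball2 {s : ℝ} (hs : 0 < s) (hs2 : s ≤ 2) (P : Finset (ℝ × ℝ)) (ν : ℝ × ℝ → ℝ)
    (h0 : ∀ p, 0 ≤ ν p) (j : ℕ)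
    (h : ∀ l ≤ j, ∀ i, ∑ p ∈ P.filter (fun p => cl2 l p = i), ν p ≤ wt s l)
    (ρ : ℝ) (hρ : (1/2:ℝ)^j ≤ ρ) (hρ1 : ρ ≤ 1) (c : ℝ × ℝ) :
    ∑ p ∈ P.filter (fun p => |p.1 - c.1| ≤ ρ ∧ |p.2 - c.2| ≤ ρ), ν p ≤ 36 * ρ ^ s := by
  obtain ⟨k, hkj, hk, hwt⟩ := lev_exists hs hs2 j ρ hρ hρ1
  have h1 := ball_gen P ν h0 (cl2 k) (Finset.Icc (cl1 k c.1 - 1) (cl1 k c.1 + 1) ×ˢ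
      Finset.Icc (cl1 k c.2 - 1) (cl1 k c.2 + 1))
    (fun p => |p.1 - c.1| ≤ ρ ∧ |p.2 - c.2| ≤ ρ)
    (fun p hp => Finset.mem_product.2 ⟨cl1_close hp.1 hk, cl1_close hp.2 hk⟩) (wt s k) (h k hkj)
  have h2 : ∀ z : ℤ, (Finset.Icc (z - 1) (z + 1)).card = 3 := by
    intro z
    rw [Int.card_Icc]; ring_nf; rfl
  rw [Finset.card_product, h2, h2] at h1
  push_cast at h1
  linarith

end BP

open MeasureTheory
open scoped ENNReal
namespace BP

/-- scaling of the plane -/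
def scl (L : ℝ) (p : ℝ × ℝ) : ℝ × ℝ := (L * p.1, L * p.2)

theorem scl_inv {L : ℝ} (hL : L ≠ 0) (p : ℝ × ℝ) : scl L⁻¹ (scl L p) = p := by
  unfold scl
  ext
  · simp only; rw [← mul_assoc, inv_mul_cancel₀ hL, one_mul]
  · simp only; rw [← mul_assoc, inv_mul_cancel₀ hL, one_mul]

theorem scl_sum {L : ℝ} (hL : L ≠ 0) (Q : Finset (ℝ × ℝ)) (f : ℝ × ℝ → ℝ) :
    ∑ q ∈ Q.image (scl L), f (scl L⁻¹ q) = ∑ p ∈ Q, f p := by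
  rw [Finset.sum_image (fun p _ q _ h => by
    have := congrArg (scl L⁻¹) h
    rwa [scl_inv hL, scl_inv hL] at this)]
  exact Finset.sum_congr rfl fun p _ => by rw [scl_inv hL]

theorem floor_close2 {x y : ℝ} (h : |x - y| < 2) : ⌊x⌋ ∈ Finset.Icc (⌊y⌋ - 2) (⌊y⌋ + 2) := by
  rw [abs_lt] at h
  rw [Finset.mem_Icc]
  constructor
  · have := Int.floor_mono (show y - 2 ≤ x by linarith)
    have h2 := Int.floor_sub_ofNat y 2
    rwa [h2] at this
  · have := Int.floor_mono (show x ≤ y + 2 by linarith)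
    have h2 := Int.floor_add_ofNat y 2
    rwa [h2] at this

set_option maxHeartbeats 1000000 in
/-- Assemble the single-scale data. -/
theorem mkD {b κ a e eps : ℝ} (hb0 : 0 < b) (hb1 : b < 1) (hκ : 0 < κ) (hκ1 : κ ≤ 1)
    (ha : 0 < a) (he : 0 < e) (heps : 0 ≤ eps) (j : ℕ)
    (P : Finset (ℝ × ℝ)) (μ : ℝ × ℝ → ℝ) (hμ : ∀ p, 0 ≤ μ p)
    (hP : ∀ p ∈ P, ∀ p' ∈ P, |p.1 - p'.1| ≤ 1 ∧ |p.2 - p'.2| ≤ 1)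
    (hPm : ∀ l ≤ j, ∀ i, ∑ p ∈ P.filter (fun p => cl2 l p = i), μ p ≤ wt (2 * b) l)
    (hPa : a ≤ ∑ p ∈ P, μ p)
    (T : Finset ℝ) (ν : ℝ → ℝ) (hν : ∀ θ, 0 ≤ ν θ)
    (hT : ∀ θ ∈ T, ∀ θ' ∈ T, |θ - θ'| ≤ 1)
    (hTm : ∀ l ≤ j, ∀ i, ∑ p ∈ T.filter (fun p => cl1 l p = i), ν p ≤ wt κ l)
    (hTa : e * (1 / (((j:ℝ)+1)*((j:ℝ)+2))) ≤ ∑ θ ∈ T, ν θ)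
    (A : ℝ → Finset (ℝ × ℝ)) (hAs : ∀ θ ∈ T, A θ ⊆ P)
    (hAm : ∀ θ ∈ T, (∑ p ∈ P, μ p) * (1 / (((j:ℝ)+1)*((j:ℝ)+2))) ≤ ∑ p ∈ A θ, μ p)
    (hAi : ∀ θ ∈ T, ∃ F : Finset ℝ, (F.card : ℝ) * wt (b + eps) j ≤ 1 ∧
      ∀ p ∈ A θ, ∃ c ∈ F, |pr θ p - c| < 2 * (1/2:ℝ)^j) :
    ∃ (P' : Finset (ℝ × ℝ)) (μ' : ℝ × ℝ → ℝ) (T' : Finset ℝ) (ν' : ℝ → ℝ)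
      (A' : ℝ → Finset (ℝ × ℝ)),
      DHyp b κ ((2:ℝ)^j) ((36/a + 12/e + 5) * (((j:ℝ)+1)*((j:ℝ)+2)) * ((2:ℝ)^j)^eps)
        P' μ' T' ν' A' := by
  classical
  set L : ℝ := (2:ℝ)^j with hL
  have hL1 : 1 ≤ L := one_le_pow₀ (by norm_num)
  have hL0 : 0 < L := by linarith
  have hLi : 1 / L = (1/2:ℝ)^j := by rw [hL, one_div_pow]
  set q : ℝ := ((j:ℝ)+1)*((j:ℝ)+2) with hq
  have hj0 : (0:ℝ) ≤ j := Nat.cast_nonneg j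
  have hq1 : 1 ≤ q := by rw [hq]; nlinarith
  have hq0 : 0 < q := by linarith
  set C : ℝ := 36/a + 12/e + 5 with hC
  have ha' : 0 < 36/a := by positivity
  have he' : 0 < 12/e := by positivity
  set X : ℝ := L ^ eps with hX
  have hX1 : 1 ≤ X := Real.one_le_rpow hL1 heps
  set K : ℝ := C * q * X with hK
  have hC0 : 0 < C := by rw [hC]; linarith
  have hKq : C * q ≤ K := by
    rw [hK]; exact le_mul_of_one_le_right (by positivity) hX1
  have hCq : C ≤ C * q := le_mul_of_one_le_right hC0.le hq1
  have hKX : C * X ≤ K := by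
    rw [hK]; exact mul_le_mul_of_nonneg_right hCq (by linarith)
  have hKC : C ≤ K := hCq.trans hKq
  have hK1 : 1 ≤ K := by linarith
  have hK0 : 0 < K := by linarith
  set m : ℝ := ∑ p ∈ P, μ p with hm
  have hm0 : 0 < m := by linarith
  set n : ℝ := ∑ θ ∈ T, ν θ with hn
  have hn0 : 0 < n := lt_of_lt_of_le (by positivity) hTa
  have hLne : L ≠ 0 := hL0.ne'
  have hscale : ∀ Q : Finset (ℝ × ℝ), ∑ p ∈ Q.image (scl L), μ (scl L⁻¹ p) / m =
      (∑ p ∈ Q, μ p) / m := by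
    intro Q
    rw [scl_sum hLne Q (fun p => μ p / m), Finset.sum_div]
  refine ⟨P.image (scl L), fun p => μ (scl L⁻¹ p) / m, T, fun θ => ν θ / n,
    fun θ => (A θ).image (scl L), ?_, ?_, ?_, ?_, hT, ?_, ?_, ?_, ?_, ?_, ?_⟩
  · intro p hp p' hp'
    obtain ⟨x, hx, rfl⟩ := Finset.mem_image.1 hp
    obtain ⟨y, hy, rfl⟩ := Finset.mem_image.1 hp'
    obtain ⟨h1, h2⟩ := hP x hx y hy
    simp only [scl]
    rw [← mul_sub, ← mul_sub, abs_mul, abs_mul, abs_of_pos hL0]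
    exact ⟨mul_le_of_le_one_right hL0.le h1, mul_le_of_le_one_right hL0.le h2⟩
  · intro p _; exact div_nonneg (hμ _) hm0.le
  · rw [hscale, ← hm, div_self hm0.ne']
  · intro u hu p0
    rw [Finset.filter_image, hscale]
    have hup : 0 < u / L := by positivity
    by_cases hu1 : u / L ≤ 1
    · have h1 := ball2 (by positivity : 0 < 2 * b) (by linarith) P μ hμ j hPm (u/L)
        (by rw [← hLi]; exact div_le_div_of_nonneg_right hu hL0.le) hu1 (p0.1 / L, p0.2 / L)
      have hsc : ∀ x y : ℝ, |L * x - y| ≤ u ↔ |x - y / L| ≤ u / L := by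
        intro x y
        rw [le_div_iff₀ hL0]
        have : |x - y / L| * L = |L * x - y| := by
          rw [← abs_of_pos hL0, ← abs_mul, abs_of_pos hL0]; congr 1; field_simp
        rw [this]
      have hfe : P.filter (fun a => |(scl L a).1 - p0.1| ≤ u ∧ |(scl L a).2 - p0.2| ≤ u) =
          P.filter (fun p => |p.1 - p0.1/L| ≤ u/L ∧ |p.2 - p0.2/L| ≤ u/L) := by
        apply Finset.filter_congr
        intro p _
        simp only [scl]
        rw [hsc, hsc]
      rw [hfe]
      have hr0 : 0 ≤ (u/L)^(2*b) := Real.rpow_nonneg hup.le _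
      calc (∑ p ∈ P.filter (fun p => |p.1 - p0.1/L| ≤ u/L ∧ |p.2 - p0.2/L| ≤ u/L), μ p) / m
          ≤ (36 * (u/L)^(2*b)) / m := div_le_div_of_nonneg_right h1 hm0.le
        _ ≤ (36 * (u/L)^(2*b)) / a := div_le_div_of_nonneg_left (by positivity) ha hPa
        _ = 36 / a * (u/L)^(2*b) := by ring
        _ ≤ K * (u/L)^(2*b) := mul_le_mul_of_nonneg_right (by linarith) hr0
    · push Not at hu1
      have h1 : (∑ p ∈ P.filter (fun a => |(scl L a).1 - p0.1| ≤ u ∧ |(scl L a).2 - p0.2| ≤ u), μ p) / m ≤ 1 := by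
        rw [div_le_one hm0]
        exact Finset.sum_le_sum_of_subset_of_nonneg (Finset.filter_subset _ _) (fun p _ _ => hμ p)
      have h2 : 1 ≤ (u/L)^(2*b) := Real.one_le_rpow hu1.le (by positivity)
      refine h1.trans ?_
      nlinarith
  · intro θ _; exact div_nonneg (hν _) hn0.le
  · rw [← Finset.sum_div, ← hn, div_self hn0.ne']
  · intro ρ hρ c
    rw [← Finset.sum_div]
    have hρ0 : 0 < ρ := lt_of_lt_of_le (by positivity) hρ
    by_cases hρ1 : ρ ≤ 1
    · have h1 := ball1 hκ (by linarith) T ν hν j hTm ρ (by rw [← hLi]; exact hρ) hρ1 c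
      have hr0 : 0 ≤ ρ ^ κ := Real.rpow_nonneg hρ0.le _
      have h2 : e / q ≤ n := by rw [div_eq_mul_one_div]; exact hTa
      calc (∑ θ ∈ T.filter (fun θ => |θ - c| ≤ ρ), ν θ) / n
          ≤ (12 * ρ^κ) / n := div_le_div_of_nonneg_right h1 hn0.le
        _ ≤ (12 * ρ^κ) / (e/q) := div_le_div_of_nonneg_left (by positivity) (by positivity) h2
        _ = (12 / e * q) * ρ^κ := by field_simp
        _ ≤ K * ρ^κ := by
          refine mul_le_mul_of_nonneg_right (le_trans ?_ hKq) hr0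
          exact mul_le_mul_of_nonneg_right (by linarith) hq0.le
    · push Not at hρ1
      have h1 : (∑ θ ∈ T.filter (fun θ => |θ - c| ≤ ρ), ν θ) / n ≤ 1 := by
        rw [div_le_one hn0]
        exact Finset.sum_le_sum_of_subset_of_nonneg (Finset.filter_subset _ _) (fun p _ _ => hν p)
      have h2 : 1 ≤ ρ ^ κ := Real.one_le_rpow hρ1.le hκ.le
      refine h1.trans ?_
      nlinarith
  · intro θ hθ
    exact Finset.image_subset_image (hAs θ hθ)
  · intro θ hθ
    rw [hscale]
    have h1 : 1 / q ≤ (∑ p ∈ A θ, μ p) / m := by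
      rw [le_div_iff₀ hm0, mul_comm]; exact hAm θ hθ
    refine le_trans (one_div_le_one_div_of_le hq0 ?_) h1
    have : q ≤ C * q := le_mul_of_one_le_left hq0.le (by linarith)
    linarith
  · intro θ hθ
    obtain ⟨F, hF1, hF2⟩ := hAi θ hθ
    have hsub : ((A θ).image (scl L)).image (fun p => ⌊pr θ p⌋) ⊆
        F.biUnion (fun c => Finset.Icc (⌊L * c⌋ - 2) (⌊L * c⌋ + 2)) := by
      intro z hz
      obtain ⟨p', hp', rfl⟩ := Finset.mem_image.1 hz
      obtain ⟨p, hp, rfl⟩ := Finset.mem_image.1 hp'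
      obtain ⟨c, hc, hpc⟩ := hF2 p hp
      refine Finset.mem_biUnion.2 ⟨c, hc, floor_close2 ?_⟩
      have h1 : pr θ (scl L p) - L * c = L * (pr θ p - c) := by unfold pr scl; ring
      rw [h1, abs_mul, abs_of_pos hL0]
      rw [← hLi] at hpc
      calc L * |pr θ p - c| < L * (2 * (1 / L)) := mul_lt_mul_of_pos_left hpc hL0
        _ = 2 := by field_simp
    have h5 : ∀ z : ℤ, (Finset.Icc (z - 2) (z + 2)).card = 5 := by
      intro z
      rw [Int.card_Icc]; ring_nf; rfl
    have hcard : (((A θ).image (scl L)).image (fun p => ⌊pr θ p⌋)).card ≤ F.card * 5 :=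
      (Finset.card_le_card hsub).trans (Finset.card_biUnion_le_card_mul _ _ _ (fun c _ => (h5 _).le))
    have hcard' : ((((A θ).image (scl L)).image (fun p => ⌊pr θ p⌋)).card : ℝ) ≤ F.card * 5 := by
      exact_mod_cast hcard
    have hw : wt (b + eps) j * L ^ (b + eps) = 1 := by
      unfold wt
      rw [← hLi, ← Real.mul_rpow (by positivity) hL0.le, one_div_mul_cancel hLne, Real.one_rpow]
    have hFL : (F.card : ℝ) ≤ L ^ (b + eps) := by
      have hp : 0 ≤ L ^ (b+eps) := Real.rpow_nonneg hL0.le _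
      calc (F.card : ℝ) = (F.card * wt (b+eps) j) * L ^ (b + eps) := by rw [mul_assoc, hw, mul_one]
        _ ≤ 1 * L ^ (b + eps) := mul_le_mul_of_nonneg_right hF1 hp
        _ = _ := one_mul _
    have hsplit : L ^ (b + eps) = X * L ^ b := by rw [Real.rpow_add hL0, mul_comm]
    have hLb : 0 ≤ L ^ b := Real.rpow_nonneg hL0.le _
    calc ((((A θ).image (scl L)).image (fun p => ⌊pr θ p⌋)).card : ℝ) ≤ F.card * 5 := hcard'
      _ ≤ (X * L ^ b) * 5 := by rw [← hsplit]; linarith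
      _ = (5 * X) * L ^ b := by ring
      _ ≤ K * L ^ b := by
        refine mul_le_mul_of_nonneg_right (le_trans ?_ hKX) hLb
        exact mul_le_mul_of_nonneg_right (by linarith) (by linarith)

end BP

open MeasureTheory
open scoped ENNReal
namespace BP

theorem cl1_finite (J : ℕ) (i : ℤ) : (cl1 J '' {x | cl1 0 x = i}).Finite := by
  refine (Set.finite_Icc ⌊(2:ℝ)^J * i⌋ ⌊(2:ℝ)^J * (i+1)⌋).subset ?_
  rintro _ ⟨x, hx, rfl⟩
  have hx' : ⌊(2:ℝ)^0 * x⌋ = i := hx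
  rw [pow_zero, one_mul, Int.floor_eq_iff] at hx'
  unfold cl1
  constructor
  · exact Int.floor_mono (mul_le_mul_of_nonneg_left hx'.1 (by positivity))
  · exact Int.floor_mono (mul_le_mul_of_nonneg_left hx'.2.le (by positivity))

theorem cl2_finite (J : ℕ) (i : ℤ × ℤ) : (cl2 J '' {x | cl2 0 x = i}).Finite := by
  refine ((cl1_finite J i.1).prod (cl1_finite J i.2)).subset ?_
  rintro _ ⟨x, hx, rfl⟩
  exact ⟨⟨x.1, congrArg Prod.fst hx, rfl⟩, ⟨x.2, congrArg Prod.snd hx, rfl⟩⟩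

theorem sum_tel (n : ℕ) : ∑ j ∈ Finset.range n, 1 / (((j:ℝ)+1)*((j:ℝ)+2)) = 1 - 1/((n:ℝ)+1) := by
  induction n with
  | zero => simp
  | succ n ih =>
    rw [Finset.sum_range_succ, ih]
    push_cast
    have h1 : (n:ℝ) + 1 ≠ 0 := by positivity
    have h2 : (n:ℝ) + 2 ≠ 0 := by positivity
    have h3 : (n:ℝ) + 1 + 1 ≠ 0 := by positivity
    field_simp
    ring

theorem choose_j0 (C ε L0 : ℝ) (hC : 0 < C) (hε : 0 < ε) : ∃ j0 : ℕ, ∀ j : ℕ, j0 ≤ j →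
    L0 ≤ (2:ℝ)^j ∧ C * (((j:ℝ)+1)*((j:ℝ)+2)) * ((2:ℝ)^j)^(ε/2) ≤ ((2:ℝ)^j)^ε := by
  have hr : 1 < (2:ℝ)^(ε/2) := Real.one_lt_rpow (by norm_num) (by positivity)
  have h1 := tendsto_pow_const_div_const_pow_of_one_lt 2 hr
  have h2 := h1.eventually (gt_mem_nhds (show (0:ℝ) < 1 / (6 * C) by positivity))
  have h3 := (tendsto_pow_atTop_atTop_of_one_lt (show (1:ℝ) < 2 by norm_num)).eventually
    (Filter.eventually_ge_atTop L0)
  obtain ⟨j0, hj0⟩ := Filter.eventually_atTop.1 ((h2.and h3).and (Filter.eventually_ge_atTop 1))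
  refine ⟨j0, fun j hj => ?_⟩
  obtain ⟨⟨h4, h5⟩, h6⟩ := hj0 j hj
  refine ⟨h5, ?_⟩
  have h6' : (1:ℝ) ≤ j := by exact_mod_cast h6
  have e1 : ((2:ℝ)^j)^(ε/2) = ((2:ℝ)^(ε/2))^j := by
    rw [← Real.rpow_natCast, ← Real.rpow_natCast, ← Real.rpow_mul (by norm_num),
      ← Real.rpow_mul (by norm_num), mul_comm]
  have hp : (0:ℝ) < (2:ℝ)^j := by positivity
  have e2 : ((2:ℝ)^j)^ε = ((2:ℝ)^j)^(ε/2) * ((2:ℝ)^j)^(ε/2) := by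
    rw [← Real.rpow_add hp]; congr 1; ring
  have hX : 0 < ((2:ℝ)^j)^(ε/2) := Real.rpow_pos_of_pos hp _
  rw [e2]
  refine mul_le_mul_of_nonneg_right ?_ hX.le
  rw [← e1, div_lt_div_iff₀ hX (by positivity)] at h4
  have h7 : ((j:ℝ)+1)*((j:ℝ)+2) ≤ 6 * (j:ℝ)^2 := by nlinarith
  have h8 := mul_le_mul_of_nonneg_left h7 hC.le
  nlinarith

/-- The core of the theorem, for `κ ≤ 1`. -/
theorem core (b κ : ℝ) (hb0 : 0 < b) (hb1 : b < 1) (hκ : 0 < κ) (hκ1 : κ ≤ 1) :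
    ∃ η : ℝ, b < η ∧ ∀ A : Set (ℝ × ℝ), MeasurableSet A → ENNReal.ofReal (2 * b) < dimH A →
      dimH {θ : ℝ | dimH (pr θ '' A) < ENNReal.ofReal η} ≤ ENNReal.ofReal κ := by
  classical
  obtain ⟨ε1, hε1, L0, hD⟩ := thmD b κ hb0 hb1 hκ hκ1
  set ε : ℝ := min ε1 1 with hε
  have hε0 : 0 < ε := lt_min hε1 one_pos
  have hεle : ε ≤ ε1 := min_le_left _ _
  have hεone : ε ≤ 1 := min_le_right _ _
  refine ⟨b + ε/2, by linarith, ?_⟩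
  intro A hA hdA
  by_contra hcon
  push Not at hcon
  set E : Set ℝ := {θ : ℝ | dimH (pr θ '' A) < ENNReal.ofReal (b + ε/2)} with hE
  set w2 : ℕ → ℝ≥0∞ := fun k => ENNReal.ofReal (wt (2*b) k) with hw2
  set w1 : ℕ → ℝ≥0∞ := fun k => ENNReal.ofReal (wt κ k) with hw1
  -- localise A
  have hA1 : 0 < ctt cl2 w2 A := ctt_pos cl2 dist_cl2 (2*b) (by positivity) A hdA
  have hA2 : ∃ i, 0 < ctt cl2 w2 (A ∩ {p | cl2 0 p = i}) := by
    by_contra hno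
    push Not at hno
    have h1 := ctt_iUnion cl2 w2 (fun i : ℤ × ℤ => A ∩ {p | cl2 0 p = i})
    have h2 : (⋃ i : ℤ × ℤ, A ∩ {p | cl2 0 p = i}) = A := by
      ext p; simp
    rw [h2] at h1
    have h3 : ∑' i : ℤ × ℤ, ctt cl2 w2 (A ∩ {p | cl2 0 p = i}) = 0 := by
      rw [ENNReal.tsum_eq_zero]; intro i; exact le_antisymm (hno i) zero_le
    rw [h3] at h1
    exact absurd hA1 (not_lt.2 h1)
  obtain ⟨iA, hiA⟩ := hA2
  have hmeas : MeasurableSet (A ∩ {p | cl2 0 p = iA}) := by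
    refine hA.inter ?_
    have hm : Measurable (cl2 0) := by
      unfold cl2 cl1
      exact (Int.measurable_floor.comp (measurable_fst.const_mul _)).prodMk
        (Int.measurable_floor.comp (measurable_snd.const_mul _))
    exact hm (measurableSet_singleton iA)
  obtain ⟨c0, hc0, hc1⟩ := exists_between hiA
  obtain ⟨K0, hK0A, hK0c, hK0⟩ := choquet w2 _ hmeas c0 hc1
  have hK0pos : 0 < ctt cl2 w2 K0 := by
    rcases eq_or_ne (ctt cl2 w2 K0) 0 with h | h
    · rw [h, mul_zero] at hK0; exact absurd hc0 (not_lt.2 hK0)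
    · exact pos_iff_ne_zero.2 h
  obtain ⟨a', ha'0, ha'⟩ := ENNReal.lt_iff_exists_nnreal_btwn.1 hK0pos
  set a : ℝ := (a' : ℝ) with haa
  have ha : 0 < a := by exact_mod_cast ha'0
  have haK : ENNReal.ofReal a ≤ ctt cl2 w2 K0 := by rw [haa, ENNReal.ofReal_coe_nnreal]; exact ha'.le
  -- localise E
  have hE1 : 0 < ctt cl1 w1 E := ctt_pos cl1 dist_cl1 κ hκ E hcon
  have hE2 : ∃ i, 0 < ctt cl1 w1 (E ∩ {p | cl1 0 p = i}) := by
    by_contra hno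
    push Not at hno
    have h1 := ctt_iUnion cl1 w1 (fun i : ℤ => E ∩ {p | cl1 0 p = i})
    have h2 : (⋃ i : ℤ, E ∩ {p | cl1 0 p = i}) = E := by
      ext p; simp
    rw [h2] at h1
    have h3 : ∑' i : ℤ, ctt cl1 w1 (E ∩ {p | cl1 0 p = i}) = 0 := by
      rw [ENNReal.tsum_eq_zero]; intro i; exact le_antisymm (hno i) zero_le
    rw [h3] at h1
    exact absurd hE1 (not_lt.2 h1)
  obtain ⟨iE, hiE⟩ := hE2
  set E' : Set ℝ := E ∩ {p | cl1 0 p = iE} with hE'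
  obtain ⟨e', he'0, he'⟩ := ENNReal.lt_iff_exists_nnreal_btwn.1 hiE
  set e : ℝ := (e' : ℝ) with hee
  have he : 0 < e := by exact_mod_cast he'0
  have heE : ENNReal.ofReal e < ctt cl1 w1 E' := by rw [hee, ENNReal.ofReal_coe_nnreal]; exact he'
  -- scale
  set C : ℝ := 36/a + 12/e + 5 with hC
  have hC0 : 0 < C := by positivity
  obtain ⟨j0, hj0⟩ := choose_j0 C ε L0 hC0 hε0
  -- covers
  have hcov : ∀ θ, ∃ F : Finset (ℕ × ℝ), θ ∈ E' → (∀ c ∈ F, j0 ≤ c.1) ∧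
      (∀ j, ((F.filter (fun c => c.1 = j)).card : ℝ) * wt (b + ε/2) j ≤ 1) ∧
      ∀ x ∈ pr θ '' K0, ∃ c ∈ F, |x - c.2| < 2 * (1/2:ℝ)^c.1 := by
    intro θ
    by_cases hθ : θ ∈ E'
    · have hcont : Continuous (pr θ) := by unfold pr; fun_prop
      have hd : dimH (pr θ '' K0) < ENNReal.ofReal (b + ε/2) :=
        lt_of_le_of_lt (dimH_mono (Set.image_mono (hK0A.trans Set.inter_subset_left))) hθ.1
      obtain ⟨F, hF⟩ := cover_fin (by positivity) (by linarith) (hK0c.image hcont) hd j0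
      exact ⟨F, fun _ => hF⟩
    · exact ⟨∅, fun h => absurd h hθ⟩
  choose F hF using hcov
  let G : ℕ → Set ℝ := fun J => {θ | θ ∈ E' ∧ ∀ c ∈ F θ, c.1 ≤ J}
  have hGm : Monotone G := fun J J' h θ hθ => ⟨hθ.1, fun c hc => (hθ.2 c hc).trans h⟩
  have hGU : (⋃ J, G J) = E' := by
    ext θ
    rw [Set.mem_iUnion]
    constructor
    · rintro ⟨J, hJ⟩; exact hJ.1
    · intro h
      exact ⟨(F θ).sup Prod.fst, h, fun c hc => Finset.le_sup (f := Prod.fst) hc⟩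
  have hJ : ∃ J, ENNReal.ofReal e < ctt cl1 w1 (G J) := by
    by_contra hno
    push Not at hno
    have h1 := ctt_iSup refi1 w1 G hGm hno
    rw [hGU] at h1
    exact absurd heE (not_lt.2 h1)
  obtain ⟨J, hJ⟩ := hJ
  -- measure on K0
  have hK0cell : K0 ⊆ {p | cl2 0 p = iA} := hK0A.trans Set.inter_subset_right
  obtain ⟨P, μ, hPK, hμ, hPm, hPa⟩ := frostman refi2 (wt (2*b)) (wt_pos _) J K0
    ((cl2_finite J iA).subset (Set.image_mono hK0cell))
  have hm : a ≤ ∑ p ∈ P, μ p :=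
    (ENNReal.ofReal_le_ofReal_iff (Finset.sum_nonneg fun p _ => hμ p)).1 (haK.trans hPa)
  set m : ℝ := ∑ p ∈ P, μ p with hmdef
  have hm0 : 0 < m := by linarith
  let B : ℕ → ℝ → Finset (ℝ × ℝ) := fun j θ =>
    P.filter (fun p => ∃ c ∈ F θ, c.1 = j ∧ |pr θ p - c.2| < 2 * (1/2:ℝ)^j)
  have hpick : ∀ θ ∈ G J, ∃ j, j0 ≤ j ∧ j ≤ J ∧
      m * (1 / (((j:ℝ)+1)*((j:ℝ)+2))) ≤ ∑ p ∈ B j θ, μ p := by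
    intro θ hθ
    by_contra hno
    push Not at hno
    obtain ⟨hF1, hF2, hF3⟩ := hF θ hθ.1
    have h1 : m ≤ ∑ j ∈ Finset.Icc j0 J, ∑ p ∈ B j θ, μ p :=
      cover_sum P (Finset.Icc j0 J)
        (fun p j => ∃ c ∈ F θ, c.1 = j ∧ |pr θ p - c.2| < 2 * (1/2:ℝ)^j) μ (fun p _ => hμ p) (by
        intro p hp
        obtain ⟨c, hc, hpc⟩ := hF3 (pr θ p) ⟨p, hPK p hp, rfl⟩
        exact ⟨c.1, Finset.mem_Icc.2 ⟨hF1 c hc, hθ.2 c hc⟩, c, hc, rfl, hpc⟩)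
    have h2 : ∑ j ∈ Finset.Icc j0 J, ∑ p ∈ B j θ, μ p ≤
        ∑ j ∈ Finset.Icc j0 J, m * (1 / (((j:ℝ)+1)*((j:ℝ)+2))) :=
      Finset.sum_le_sum fun j hj => (hno j (Finset.mem_Icc.1 hj).1 (Finset.mem_Icc.1 hj).2).le
    have h3 : ∑ j ∈ Finset.Icc j0 J, (1 / (((j:ℝ)+1)*((j:ℝ)+2))) ≤
        ∑ j ∈ Finset.range (J+1), (1 / (((j:ℝ)+1)*((j:ℝ)+2))) := by
      refine Finset.sum_le_sum_of_subset_of_nonneg ?_ (fun j _ _ => by positivity)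
      intro j hj
      rw [Finset.mem_Icc] at hj
      exact Finset.mem_range.2 (by omega)
    rw [sum_tel] at h3
    have h4 : (0:ℝ) < 1 / (((J+1 : ℕ):ℝ)+1) := by positivity
    rw [← Finset.mul_sum] at h2
    nlinarith
  let Ej : ℕ → Set ℝ := fun j => {θ | θ ∈ G J ∧ j0 ≤ j ∧ j ≤ J ∧
    m * (1 / (((j:ℝ)+1)*((j:ℝ)+2))) ≤ ∑ p ∈ B j θ, μ p}
  have hsubU : G J ⊆ ⋃ j, Ej j := by
    intro θ hθ
    obtain ⟨j, h1, h2, h3⟩ := hpick θ hθ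
    exact Set.mem_iUnion.2 ⟨j, hθ, h1, h2, h3⟩
  have hj : ∃ j : ℕ, ENNReal.ofReal (e * (1 / (((j:ℝ)+1)*((j:ℝ)+2)))) < ctt cl1 w1 (Ej j) := by
    by_contra hno
    push Not at hno
    have h1 := (ctt_mono cl1 w1 hsubU).trans (ctt_iUnion cl1 w1 Ej)
    have h2 := h1.trans (ENNReal.tsum_le_tsum hno)
    have h3 : ∑' j : ℕ, ENNReal.ofReal (e * (1 / (((j:ℝ)+1)*((j:ℝ)+2)))) ≤ ENNReal.ofReal e := by
      refine ENNReal.tsum_le_of_sum_range_le fun n => ?_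
      rw [← ENNReal.ofReal_sum_of_nonneg (fun j _ => by positivity)]
      apply ENNReal.ofReal_le_ofReal
      rw [← Finset.mul_sum, sum_tel]
      have : (0:ℝ) < 1 / ((n:ℝ)+1) := by positivity
      nlinarith
    exact absurd hJ (not_lt.2 (h2.trans h3))
  obtain ⟨j, hj⟩ := hj
  have hEjE : Ej j ⊆ {p | cl1 0 p = iE} := fun θ hθ => hθ.1.1.2
  obtain ⟨T, ν, hTE, hν, hTm, hTa⟩ := frostman refi1 (wt κ) (wt_pos _) j (Ej j)
    ((cl1_finite j iE).subset (Set.image_mono hEjE))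
  have hn : e * (1 / (((j:ℝ)+1)*((j:ℝ)+2))) ≤ ∑ θ ∈ T, ν θ :=
    (ENNReal.ofReal_le_ofReal_iff (Finset.sum_nonneg fun p _ => hν p)).1 (hj.le.trans hTa)
  have hTne : T.Nonempty := by
    by_contra hemp
    rw [Finset.not_nonempty_iff_eq_empty] at hemp
    rw [hemp, Finset.sum_empty] at hn
    have : 0 < e * (1 / (((j:ℝ)+1)*((j:ℝ)+2))) := by positivity
    linarith
  obtain ⟨θ0, hθ0⟩ := hTne
  have hjj0 : j0 ≤ j := (hTE θ0 hθ0).2.1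
  have hjJ : j ≤ J := (hTE θ0 hθ0).2.2.1
  have hPc : ∀ p ∈ P, ∀ p' ∈ P, |p.1 - p'.1| ≤ 1 ∧ |p.2 - p'.2| ≤ 1 := by
    intro p hp p' hp'
    have h1 : cl2 0 p = cl2 0 p' := (hK0cell (hPK p hp)).trans (hK0cell (hPK p' hp')).symm
    have h2 := cl1_dist (congrArg Prod.fst h1)
    have h3 := cl1_dist (congrArg Prod.snd h1)
    rw [pow_zero] at h2 h3
    exact ⟨h2, h3⟩
  have hTc : ∀ θ ∈ T, ∀ θ' ∈ T, |θ - θ'| ≤ 1 := by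
    intro θ hθ θ' hθ'
    have h2 := cl1_dist (show cl1 0 θ = cl1 0 θ' from
      (hEjE (hTE θ hθ)).trans (hEjE (hTE θ' hθ')).symm)
    rwa [pow_zero] at h2
  obtain ⟨P', μ', T', ν', A', hDH⟩ := mkD hb0 hb1 hκ hκ1 ha he (by linarith : 0 ≤ ε/2) j P μ hμ hPc
    (fun l hl => hPm l (hl.trans hjJ)) hm T ν hν hTc hTm hn (B j)
    (fun θ _ => Finset.filter_subset _ _) (fun θ hθ => (hTE θ hθ).2.2.2) (by
      intro θ hθ
      obtain ⟨hF1, hF2, hF3⟩ := hF θ (hTE θ hθ).1.1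
      refine ⟨((F θ).filter (fun c => c.1 = j)).image Prod.snd, ?_, ?_⟩
      · refine le_trans (mul_le_mul_of_nonneg_right ?_ (wt_pos _ _).le) (hF2 j)
        exact_mod_cast Finset.card_image_le
      · intro p hp
        obtain ⟨c, hc, hcj, hpc⟩ := (Finset.mem_filter.1 hp).2
        exact ⟨c.2, Finset.mem_image.2 ⟨c, Finset.mem_filter.2 ⟨hc, hcj⟩, rfl⟩, hpc⟩)
  obtain ⟨hL0, hKL⟩ := hj0 j hjj0
  have hL1 : (1:ℝ) ≤ 2^j := one_le_pow₀ (by norm_num)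
  have hX1 : 1 ≤ ((2:ℝ)^j)^(ε/2) := Real.one_le_rpow hL1 (by positivity)
  have hjn : (0:ℝ) ≤ j := Nat.cast_nonneg j
  have hq1 : 1 ≤ ((j:ℝ)+1)*((j:ℝ)+2) := by nlinarith
  have hC1 : 1 ≤ C := by
    have h1 : 0 < 36/a := by positivity
    have h2 : 0 < 12/e := by positivity
    linarith
  have hK1 : 1 ≤ C * (((j:ℝ)+1)*((j:ℝ)+2)) * ((2:ℝ)^j)^(ε/2) :=
    one_le_mul_of_one_le_of_one_le (one_le_mul_of_one_le_of_one_le hC1 hq1) hX1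
  exact hD _ hL0 _ hK1 (hKL.trans (Real.rpow_le_rpow_of_exponent_le hL1 hεle)) P' μ' T' ν' A' hDH

end BP

/-- **Bourgain's projection theorem.** For every `α ∈ (0, 2)` and `κ > 0` there exists
`η > α / 2` such that for every Borel set `A ⊆ ℝ × ℝ` with `dimH A > α`, the set of
angles `θ` for which the projection `proj_θ '' A` has Hausdorff dimension `< η` has
Hausdorff dimension at most `κ`. -/
theorem bourgain_projection (α : ℝ) (hα₀ : 0 < α) (hα₂ : α < 2) (κ : ℝ) (hκ : 0 < κ) :
    ∃ η : ℝ, α / 2 < η ∧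
      ∀ A : Set (ℝ × ℝ), MeasurableSet A → ENNReal.ofReal α < dimH A →
        dimH {θ : ℝ |
            dimH ((fun p : ℝ × ℝ => p.1 * Real.cos θ + p.2 * Real.sin θ) '' A)
              < ENNReal.ofReal η}
          ≤ ENNReal.ofReal κ := by
  obtain ⟨η, hη, h⟩ := BP.core (α/2) (min κ 1) (by linarith) (by linarith) (lt_min hκ one_pos)
    (min_le_right _ _)
  refine ⟨η, hη, fun A hA hd => ?_⟩
  have h1 := h A hA (by rwa [show 2 * (α/2) = α by ring])
  exact h1.trans (ENNReal.ofReal_le_ofReal (min_le_left _ _))
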